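/- arXiv:2310.19048 — 7 statements merged into one kernel-verified Lean document; each statement's English description precedes it below -/
import Mathlib

section
/- For every integer k ≥ 1 there exists n₀ such that every C_{2k+1}-free graph G on n ≥ n₀ vertices satisfies e(G) + t(G) ≤ ⌊n²/4⌋, where e(G) is the number of edges and t(G) the number of triangles of G. -/
open SimpleGraph

/-- The number of triangles (copies of `K_3`) in `G`. -/
noncomputable def triangleCount {V : Type*} (G : SimpleGraph V) : ℕ :=
  (G.cliqueSet 3).ncard

/-- The number of edges of `G`. -/
noncomputable def edgeCount {V : Type*} (G : SimpleGraph V) : ℕ :=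
  G.edgeSet.ncard

/-- `G` contains a copy of `H` as a (not necessarily induced) subgraph. -/
def Contains {V W : Type*} (G : SimpleGraph V) (H : SimpleGraph W) : Prop :=
  ∃ f : W → V, Function.Injective f ∧ ∀ ⦃i j⦄, H.Adj i j → G.Adj (f i) (f j)

/-- `G` contains `c` pairwise vertex-disjoint copies of the cycle `C_m`. -/
def HasDisjointCycles {V : Type*} (G : SimpleGraph V) (c m : ℕ) : Prop :=
  ∃ f : Fin c → Fin m → V,
    (∀ j, Function.Injective (f j)) ∧
    (∀ j, ∀ ⦃i i'⦄, (cycleGraph m).Adj i i' → G.Adj (f j i) (f j i')) ∧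
    Pairwise fun j j' => Disjoint (Set.range (f j)) (Set.range (f j'))

/-- The join `G ⋈ H`: disjoint union plus all edges between the two sides. -/
def joinGraph {α β : Type*} (G : SimpleGraph α) (H : SimpleGraph β) : SimpleGraph (α ⊕ β) :=
  SimpleGraph.fromRel (fun x y =>
    (∃ a a', x = Sum.inl a ∧ y = Sum.inl a' ∧ G.Adj a a') ∨
    (∃ b b', x = Sum.inr b ∧ y = Sum.inr b' ∧ H.Adj b b') ∨
    (x.isLeft ∧ y.isRight))

/-- The graph `K_ℓ ⋈ T_2(m)`: the join of a complete graph on `ℓ` vertices with the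
complete balanced bipartite (Turán) graph on `m` vertices. -/
noncomputable def extremalJoin (ℓ m : ℕ) : SimpleGraph (Fin ℓ ⊕ Fin m) :=
  joinGraph (completeGraph (Fin ℓ)) (turanGraph m 2)

/-- `heavySet G k A B` is the set `L` of vertices of `A` having at least
`(1 - 1/(10k))·|B|` neighbours in `B`. -/
noncomputable def heavySet {V : Type*} (G : SimpleGraph V) (k : ℕ) (A B : Set V) : Set V :=
  {v ∈ A | ((1 : ℝ) - 1 / (10 * k)) * B.ncard ≤ ((G.neighborSet v ∩ B).ncard : ℝ)}

section LocalCounts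

open scoped Classical

variable {V : Type*}

/-- The neighbours of `v` in `G` that lie in `S`. -/
noncomputable def nbrsIn (G : SimpleGraph V) (S : Finset V) (v : V) : Finset V :=
  S.filter (G.Adj v)

/-- The cliques of size `r` contained in `S`. -/
noncomputable def cliquesIn (G : SimpleGraph V) (r : ℕ) (S : Finset V) : Finset (Finset V) :=
  S.powerset.filter (G.IsNClique r)

/-- The ordered pairs of adjacent vertices of `S`. -/
noncomputable def pairsIn (G : SimpleGraph V) (S : Finset V) : Finset (V × V) :=
  (S ×ˢ S).filter fun p => G.Adj p.1 p.2

/-- The vertices of the neighbourhood of `v` in `S` that span a triangle with `v` inside `S`. -/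
noncomputable def triangleNbrs (G : SimpleGraph V) (S : Finset V) (v : V) : Finset V :=
  (nbrsIn G S v).filter fun u => ∃ w ∈ nbrsIn G S v, G.Adj w u

/-- Two distinct vertices are adjacent when they have at least `D` common neighbours in `S`. -/
def codegreeGraph (G : SimpleGraph V) (S : Finset V) (D : ℕ) : SimpleGraph V where
  Adj x y := x ≠ y ∧ D ≤ (nbrsIn G S x ∩ nbrsIn G S y).card
  symm := ⟨fun x y h => ⟨h.1.symm, by rw [Finset.inter_comm]; exact h.2⟩⟩
  loopless := ⟨fun _ h => h.1 rfl⟩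

@[simp]
theorem mem_nbrsIn {G : SimpleGraph V} {S : Finset V} {v w : V} :
    w ∈ nbrsIn G S v ↔ w ∈ S ∧ G.Adj v w := by
  simp [nbrsIn]

@[simp]
theorem mem_cliquesIn {G : SimpleGraph V} {S : Finset V} {r : ℕ} {c : Finset V} :
    c ∈ cliquesIn G r S ↔ c ⊆ S ∧ G.IsNClique r c := by
  simp [cliquesIn]

@[simp]
theorem mem_pairsIn {G : SimpleGraph V} {S : Finset V} {p : V × V} :
    p ∈ pairsIn G S ↔ (p.1 ∈ S ∧ p.2 ∈ S) ∧ G.Adj p.1 p.2 := by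
  simp [pairsIn]

theorem nbrsIn_subset (G : SimpleGraph V) (S : Finset V) (v : V) : nbrsIn G S v ⊆ S :=
  Finset.filter_subset _ _

theorem card_cliquesIn_le (G : SimpleGraph V) (r : ℕ) (S : Finset V) :
    (cliquesIn G r S).card ≤ 2 ^ S.card := by
  rw [← Finset.card_powerset]
  exact Finset.card_filter_le _ _

theorem card_cliquesIn_one_le (G : SimpleGraph V) (S : Finset V) :
    (cliquesIn G 1 S).card ≤ S.card := by
  refine (Finset.card_le_card (t := S.image fun x => {x}) ?_).trans Finset.card_image_le
  intro c hc
  obtain ⟨hcS, -, hc1⟩ := mem_cliquesIn.1 hc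
  obtain ⟨x, rfl⟩ := Finset.card_eq_one.1 hc1
  exact Finset.mem_image.2 ⟨x, hcS (Finset.mem_singleton_self x), rfl⟩

/-- Deleting a vertex destroys at most as many cliques as there are cliques, one smaller, in its
neighbourhood. -/
theorem card_cliquesIn_succ_le (G : SimpleGraph V) (r : ℕ) (S : Finset V) (v : V) :
    (cliquesIn G (r + 1) S).card ≤
      (cliquesIn G (r + 1) (S.erase v)).card + (cliquesIn G r (nbrsIn G S v)).card := by
  refine (Finset.card_le_card (t := cliquesIn G (r + 1) (S.erase v) ∪
    (cliquesIn G r (nbrsIn G S v)).image (insert v)) ?_).trans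
    ((Finset.card_union_le _ _).trans (Nat.add_le_add_left Finset.card_image_le _))
  intro c hc
  obtain ⟨hcS, hclique, hcard⟩ := mem_cliquesIn.1 hc
  rw [Finset.mem_union]
  by_cases hv : v ∈ c
  · right
    refine Finset.mem_image.2 ⟨c.erase v, mem_cliquesIn.2 ⟨?_, ?_, ?_⟩, Finset.insert_erase hv⟩
    · intro x hx
      obtain ⟨hxv, hxc⟩ := Finset.mem_erase.1 hx
      exact mem_nbrsIn.2 ⟨hcS hxc, hclique hv hxc hxv.symm⟩
    · exact hclique.subset (by simp)
    · rw [Finset.card_erase_of_mem hv, hcard, Nat.add_sub_cancel]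
  · left
    exact mem_cliquesIn.2 ⟨Finset.subset_erase.2 ⟨hcS, hv⟩, hclique, hcard⟩

theorem card_cliquesIn_two_le (G : SimpleGraph V) (S : Finset V) :
    (cliquesIn G 2 S).card ≤ (pairsIn G S).card := by
  refine (Finset.card_le_card (t := (pairsIn G S).image fun p => {p.1, p.2}) ?_).trans
    Finset.card_image_le
  intro c hc
  obtain ⟨hcS, hclique, hcard⟩ := mem_cliquesIn.1 hc
  obtain ⟨x, y, hxy, rfl⟩ := Finset.card_eq_two.1 hcard
  refine Finset.mem_image.2 ⟨(x, y), mem_pairsIn.2 ⟨⟨hcS (by simp), hcS (by simp)⟩, ?_⟩, rfl⟩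
  exact hclique (by simp) (by simp) hxy

theorem card_pairsIn_le_erase (G : SimpleGraph V) (S : Finset V) (v : V) :
    (pairsIn G S).card ≤ (pairsIn G (S.erase v)).card + 2 * (nbrsIn G S v).card := by
  have hsub : pairsIn G S ⊆ pairsIn G (S.erase v) ∪
      ((nbrsIn G S v).image (fun x => (v, x)) ∪ (nbrsIn G S v).image (fun x => (x, v))) := by
    rintro ⟨x, y⟩ h
    obtain ⟨⟨hx, hy⟩, hadj⟩ := mem_pairsIn.1 h
    simp only at hx hy hadj
    by_cases hxv : x = v
    · subst hxv
      simp [hy, hadj]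
    · by_cases hyv : y = v
      · subst hyv
        simp [hx, hadj.symm]
      · simp [hx, hy, hadj, hxv, hyv]
  have h₁ := Finset.card_le_card hsub
  have h₂ := Finset.card_union_le (pairsIn G (S.erase v))
    ((nbrsIn G S v).image (fun x => (v, x)) ∪ (nbrsIn G S v).image (fun x => (x, v)))
  have h₃ := Finset.card_union_le ((nbrsIn G S v).image (fun x => (v, x)))
    ((nbrsIn G S v).image (fun x => (x, v)))
  have h₄ : ((nbrsIn G S v).image (fun x => (v, x))).card ≤ _ := Finset.card_image_le
  have h₅ : ((nbrsIn G S v).image (fun x => (x, v))).card ≤ _ := Finset.card_image_le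
  omega

/-- A `D`-degenerate graph has at most `D` edges per vertex. -/
theorem card_pairsIn_le_of_degenerate (G : SimpleGraph V) (D : ℕ) (S : Finset V)
    (h : ∀ W ⊆ S, W.Nonempty → ∃ v ∈ W, (nbrsIn G W v).card ≤ D) :
    (pairsIn G S).card ≤ 2 * D * S.card := by
  induction hn : S.card generalizing S with
  | zero =>
    rw [Finset.card_eq_zero] at hn
    simp [hn, pairsIn]
  | succ n ih =>
    obtain ⟨v, hv, hd⟩ := h S subset_rfl (Finset.card_pos.1 (by omega))
    have h₁ := ih (S.erase v) (fun W hW => h W (hW.trans (Finset.erase_subset _ _)))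
      (by rw [Finset.card_erase_of_mem hv, hn, Nat.add_sub_cancel])
    have h₂ := card_pairsIn_le_erase G S v
    nlinarith

/-- A set of minimum degree at least `D` contains paths with prescribed start and length `m`
avoiding any set of at most `D - m` vertices. -/
theorem exists_path_of_minDegree {G : SimpleGraph V} {W : Finset V} {D : ℕ}
    (hW : ∀ v ∈ W, D ≤ (nbrsIn G W v).card) (m : ℕ) :
    ∀ (F : Finset V) (y : V), y ∈ W → y ∉ F → F.card + m ≤ D →
      ∃ z ∈ W, ∃ p : G.Walk y z, p.IsPath ∧ p.length = m ∧ ∀ x ∈ p.support, x ∉ F := by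
  induction m with
  | zero =>
    intro F y hy hyF _
    exact ⟨y, hy, .nil, by simp, by simp, by simpa using hyF⟩
  | succ m ih =>
    intro F y hy hyF hcard
    obtain ⟨y₁, hy₁, hy₁F⟩ := Finset.exists_mem_notMem_of_card_lt_card
      (show F.card < (nbrsIn G W y).card by have := hW y hy; omega)
    obtain ⟨hy₁W, hadj⟩ := mem_nbrsIn.1 hy₁
    obtain ⟨z, hz, p, hp, hlen, hav⟩ := ih (insert y F) y₁ hy₁W
      (by simp [hadj.ne', hy₁F]) (by have := Finset.card_insert_le y F; omega)
    refine ⟨z, hz, .cons hadj p, hp.cons fun hmem => hav y hmem (by simp), by simp [hlen], ?_⟩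
    intro x hx
    rcases List.mem_cons.1 (by simpa using hx) with rfl | hx
    · exact hyF
    · exact fun hxF => hav x hx (Finset.mem_insert_of_mem hxF)

/-- A set of minimum degree at least `D` in the codegree graph contains the endpoints of paths of
length `2 * m` with prescribed start avoiding any set of at most `D - 2 * m` vertices. -/
theorem exists_path_of_minDegree_codegreeGraph {G : SimpleGraph V} {S W : Finset V} {D : ℕ}
    (hW : ∀ v ∈ W, D ≤ (nbrsIn (codegreeGraph G S D) W v).card) (m : ℕ) :
    ∀ (F : Finset V) (y : V), y ∈ W → y ∉ F → F.card + 2 * m ≤ D →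
      ∃ z ∈ W, ∃ p : G.Walk y z, p.IsPath ∧ p.length = 2 * m ∧ ∀ x ∈ p.support, x ∉ F := by
  induction m with
  | zero =>
    intro F y hy hyF _
    exact ⟨y, hy, .nil, by simp, by simp, by simpa using hyF⟩
  | succ m ih =>
    intro F y hy hyF hcard
    obtain ⟨y₁, hy₁, hy₁F⟩ := Finset.exists_mem_notMem_of_card_lt_card
      (show F.card < (nbrsIn (codegreeGraph G S D) W y).card by have := hW y hy; omega)
    obtain ⟨hy₁W, hne, hco⟩ := mem_nbrsIn.1 hy₁
    obtain ⟨w, hw, hwF⟩ := Finset.exists_mem_notMem_of_card_lt_card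
      (show F.card < (nbrsIn G S y ∩ nbrsIn G S y₁).card by omega)
    obtain ⟨hw₀, hw₁⟩ := Finset.mem_inter.1 hw
    have hyw := (mem_nbrsIn.1 hw₀).2
    have hwy₁ := (mem_nbrsIn.1 hw₁).2.symm
    obtain ⟨z, hz, p, hp, hlen, hav⟩ := ih (insert y (insert w F)) y₁ hy₁W
      (by simp [hne.symm, hwy₁.ne', hy₁F])
      (by
        have h₁ := Finset.card_insert_le y (insert w F)
        have h₂ := Finset.card_insert_le w F
        omega)
    have hwp : (Walk.cons hwy₁ p).IsPath := hp.cons fun hmem => hav w hmem (by simp)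
    refine ⟨z, hz, .cons hyw (.cons hwy₁ p), hwp.cons ?_, by simp [hlen]; ring, ?_⟩
    · intro hmem
      rcases List.mem_cons.1 (by simpa using hmem) with h | h
      · exact hyw.ne h
      · exact hav y h (by simp)
    · intro x hx
      have hx' : x = y ∨ x = w ∨ x ∈ p.support := by simpa using hx
      rcases hx' with rfl | rfl | hx
      · exact hyF
      · exact hwF
      · exact fun hxF => hav x hx (by simp [hxF])

theorem contains_cycleGraph_of_path {G : SimpleGraph V} {u w : V} (p : G.Walk u w)
    (hp : p.IsPath) (hadj : G.Adj w u) : Contains G (cycleGraph (p.length + 1)) := by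
  refine ⟨fun i => p.getVert i, ?_, ?_⟩
  · intro i j hij
    exact Fin.ext (hp.getVert_injOn (by simp; omega) (by simp; omega) hij)
  · have key : ∀ i j : Fin (p.length + 1), (j - i).val = 1 → G.Adj (p.getVert i) (p.getVert j) := by
      intro i j hij
      rcases le_or_gt i j with h | h
      · rw [Fin.sub_val_of_le h] at hij
        have hj : (j : ℕ) = i + 1 := by omega
        rw [hj]
        exact p.adj_getVert_succ (by omega)
      · rw [Fin.coe_sub_iff_lt.2 h] at hij
        have hi : (i : ℕ) = p.length := by omega
        have hj : (j : ℕ) = 0 := by omega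
        rw [hi, hj]
        simpa using hadj
    intro i j hij
    rcases cycleGraph_adj'.1 hij with h | h
    · exact (key j i h).symm
    · exact key i j h

theorem contains_cycleGraph_of_path_between_nbrs {G : SimpleGraph V} {a b v : V} {m : ℕ}
    (p : G.Walk a b) (hp : p.IsPath) (hlen : p.length + 2 = m) (hva : G.Adj v a)
    (hvb : G.Adj v b) (hv : v ∉ p.support) : Contains G (cycleGraph m) := by
  subst hlen
  exact contains_cycleGraph_of_path (.cons hva p) (hp.cons hv) hvb.symm

section OddCycleFree

variable {G : SimpleGraph V} {k : ℕ}

theorem card_pairsIn_nbrsIn_le (hk : 1 ≤ k) (hG : ¬ Contains G (cycleGraph (2 * k + 1)))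
    (S : Finset V) (v : V) :
    (pairsIn G (nbrsIn G S v)).card ≤ 4 * k * (nbrsIn G S v).card := by
  have h := card_pairsIn_le_of_degenerate G (2 * k) (nbrsIn G S v) ?_
  · linarith
  intro W hW ⟨y, hy⟩
  by_contra! hdeg
  obtain ⟨z, hz, p, hp, hlen, hav⟩ := exists_path_of_minDegree (G := G) (W := W) (D := 2 * k)
    (fun v hv => (hdeg v hv).le) (2 * k - 1) {v} y hy
    (by simpa using (mem_nbrsIn.1 (hW hy)).2.ne') (by simp; omega)
  exact hG (contains_cycleGraph_of_path_between_nbrs p hp (by omega) (mem_nbrsIn.1 (hW hy)).2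
    (mem_nbrsIn.1 (hW hz)).2 fun h => hav v h (by simp))

theorem card_pairsIn_codegreeGraph_le (hk : 1 ≤ k) (hG : ¬ Contains G (cycleGraph (2 * k + 1)))
    (S : Finset V) (v : V) :
    (pairsIn (codegreeGraph G S (2 * k)) (triangleNbrs G S v)).card ≤
      4 * k * (triangleNbrs G S v).card := by
  have h := card_pairsIn_le_of_degenerate (codegreeGraph G S (2 * k)) (2 * k)
    (triangleNbrs G S v) ?_
  · linarith
  intro W hW ⟨y, hy⟩
  by_contra! hdeg
  obtain ⟨hyN, w, hwN, hwy⟩ := Finset.mem_filter.1 (hW hy)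
  have hvy := (mem_nbrsIn.1 hyN).2
  have hvw := (mem_nbrsIn.1 hwN).2
  obtain ⟨z, hz, p, hp, hlen, hav⟩ := exists_path_of_minDegree_codegreeGraph (D := 2 * k)
    (fun v hv => (hdeg v hv).le) (k - 1) {v, w} y hy (by simp [hvy.ne', hwy.ne'])
    (by rw [Finset.card_pair hvw.ne]; omega)
  refine hG (contains_cycleGraph_of_path_between_nbrs (v := v) (.cons hwy p)
    (hp.cons fun h => hav w h (by simp)) (by simp [hlen]; omega) hvw
    (mem_nbrsIn.1 (Finset.mem_filter.1 (hW hz)).1).2 ?_)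
  intro h
  rcases List.mem_cons.1 (by simpa using h) with h | h
  · exact hvw.ne h
  · exact hav v h (by simp)

/-- Double counting of the common neighbours of pairs from `U`. -/
theorem sq_sum_card_nbrsIn_le (G : SimpleGraph V) (S U : Finset V) :
    (∑ x ∈ U, (nbrsIn G S x).card) ^ 2 ≤
      S.card * ∑ p ∈ U ×ˢ U, (nbrsIn G S p.1 ∩ nbrsIn G S p.2).card := by
  have h₁ : ∑ x ∈ U, (nbrsIn G S x).card = ∑ z ∈ S, (nbrsIn G U z).card := by
    simp only [nbrsIn, Finset.card_filter]
    rw [Finset.sum_comm]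
    simp only [G.adj_comm]
  have h₂ : ∑ p ∈ U ×ˢ U, (nbrsIn G S p.1 ∩ nbrsIn G S p.2).card =
      ∑ z ∈ S, (nbrsIn G U z).card ^ 2 := by
    have h₃ : ∀ p : V × V, (nbrsIn G S p.1 ∩ nbrsIn G S p.2).card =
        ∑ z ∈ S, if G.Adj z p.1 ∧ G.Adj z p.2 then 1 else 0 := by
      intro p
      rw [← Finset.card_filter]
      congr 1
      ext z
      simp only [Finset.mem_inter, mem_nbrsIn, Finset.mem_filter, G.adj_comm z]
      tauto
    simp only [h₃]
    rw [Finset.sum_comm]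
    refine Finset.sum_congr rfl fun z _ => ?_
    rw [← Finset.card_filter, sq, ← Finset.card_product]
    congr 1
    ext p
    simp only [Finset.mem_filter, Finset.mem_product, mem_nbrsIn]
    tauto
  rw [h₁, h₂]
  exact sq_sum_le_card_mul_sum_sq

theorem sum_codegree_le (G : SimpleGraph V) (S U : Finset V) (D : ℕ) :
    ∑ p ∈ U ×ˢ U, (nbrsIn G S p.1 ∩ nbrsIn G S p.2).card ≤
      ((pairsIn (codegreeGraph G S D) U).card + U.card) * S.card + U.card ^ 2 * D := by
  have hle : ∀ p ∈ U ×ˢ U, (nbrsIn G S p.1 ∩ nbrsIn G S p.2).card ≤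
      ((if (codegreeGraph G S D).Adj p.1 p.2 then S.card else 0) +
        (if p.1 = p.2 then S.card else 0)) + D := by
    intro p _
    have hS : (nbrsIn G S p.1 ∩ nbrsIn G S p.2).card ≤ S.card :=
      Finset.card_le_card (Finset.inter_subset_left.trans (nbrsIn_subset _ _ _))
    by_cases h : p.1 = p.2
    · simp only [h, if_true] at hS ⊢
      omega
    · by_cases hD : D ≤ (nbrsIn G S p.1 ∩ nbrsIn G S p.2).card
      · rw [if_pos (show (codegreeGraph G S D).Adj p.1 p.2 from ⟨h, hD⟩)]
        omega
      · omega
  refine (Finset.sum_le_sum hle).trans (le_of_eq ?_)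
  have hdiag : ((U ×ˢ U).filter fun p => p.1 = p.2).card = U.card := by
    rw [← Finset.diag_card U]
    congr 1
    ext p
    simp only [Finset.mem_filter, Finset.mem_product, Finset.mem_diag]
    exact ⟨fun h => ⟨h.1.1, h.2⟩, fun h => ⟨⟨h.1, h.2 ▸ h.1⟩, h.2⟩⟩
  rw [Finset.sum_add_distrib, Finset.sum_add_distrib, ← Finset.sum_filter, ← Finset.sum_filter,
    Finset.sum_const, Finset.sum_const, Finset.sum_const, hdiag, Finset.card_product]
  simp only [smul_eq_mul, pairsIn]
  ring

/-- In an odd-cycle-free graph of linear minimum degree, every vertex has boundedly many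
neighbours that lie in a triangle with it. -/
theorem card_triangleNbrs_le (hk : 1 ≤ k) (hG : ¬ Contains G (cycleGraph (2 * k + 1)))
    {S : Finset V} {q : ℕ} (hq : ∀ v ∈ S, S.card ≤ q * (nbrsIn G S v).card)
    (hS : 4 * k * q ^ 2 < S.card) (v : V) :
    (triangleNbrs G S v).card ≤ 2 * q ^ 2 * (4 * k + 1) := by
  set U := triangleNbrs G S v with hU
  have hUS : U ⊆ S := (Finset.filter_subset _ _).trans (nbrsIn_subset _ _ _)
  have h₁ := sq_sum_card_nbrsIn_le G S U
  have h₂ := sum_codegree_le G S U (2 * k)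
  have h₃ := card_pairsIn_codegreeGraph_le hk hG S v
  rw [← hU] at h₃
  have h₄ : U.card * S.card ≤ q * ∑ x ∈ U, (nbrsIn G S x).card := by
    rw [Finset.mul_sum, ← smul_eq_mul, ← Finset.sum_const]
    exact Finset.sum_le_sum fun x hx => hq x (hUS hx)
  generalize (∑ x ∈ U, (nbrsIn G S x).card) = A at *
  generalize (∑ p ∈ U ×ˢ U, (nbrsIn G S p.1 ∩ nbrsIn G S p.2).card) = X at *
  generalize (pairsIn (codegreeGraph G S (2 * k)) U).card = P at *
  generalize U.card = u at *
  generalize S.card = s at *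
  have hs : 0 < s := by omega
  by_contra! hu
  have hX : X ≤ (4 * k + 1) * u * s + u ^ 2 * (2 * k) := by nlinarith
  have hA : (u * s) ^ 2 ≤ q ^ 2 * A ^ 2 := by
    rw [← mul_pow]
    exact Nat.pow_le_pow_left h₄ 2
  have hus : u ^ 2 * s ≤ q ^ 2 * X := by
    refine Nat.le_of_mul_le_mul_left ?_ hs
    calc s * (u ^ 2 * s) = (u * s) ^ 2 := by ring
      _ ≤ q ^ 2 * A ^ 2 := hA
      _ ≤ q ^ 2 * (s * X) := Nat.mul_le_mul_left _ h₁
      _ = s * (q ^ 2 * X) := by ring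
  have hfin : 2 * (u ^ 2 * s) ≤ 2 * q ^ 2 * (4 * k + 1) * (u * s) + u ^ 2 * (4 * k * q ^ 2) := by
    calc 2 * (u ^ 2 * s) ≤ 2 * (q ^ 2 * X) := Nat.mul_le_mul_left _ hus
      _ ≤ 2 * (q ^ 2 * ((4 * k + 1) * u * s + u ^ 2 * (2 * k))) := by gcongr
      _ = _ := by ring
  have hu0 : 0 < u := by omega
  have e₁ : 2 * q ^ 2 * (4 * k + 1) * (u * s) < u * (u * s) :=
    Nat.mul_lt_mul_of_pos_right hu (Nat.mul_pos hu0 hs)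
  have e₂ : u ^ 2 * (4 * k * q ^ 2) < u ^ 2 * s :=
    Nat.mul_lt_mul_of_pos_left hS (by positivity)
  nlinarith

theorem card_cliquesIn_two_nbrsIn_le (G : SimpleGraph V) (S : Finset V) (v : V) :
    (cliquesIn G 2 (nbrsIn G S v)).card ≤ (triangleNbrs G S v).card ^ 2 := by
  refine (card_cliquesIn_two_le _ _).trans ?_
  rw [sq, ← Finset.card_product]
  refine Finset.card_le_card fun p hp => ?_
  obtain ⟨⟨h₁, h₂⟩, hadj⟩ := mem_pairsIn.1 hp
  exact Finset.mem_product.2 ⟨Finset.mem_filter.2 ⟨h₁, p.2, h₂, hadj.symm⟩,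
    Finset.mem_filter.2 ⟨h₂, p.1, h₁, hadj⟩⟩

/-- An odd-cycle-free graph on a large set `S` in which every vertex lies in about `|S| / 2`
edges and triangles has no triangle at all. -/
theorem exists_cliquesIn_three_eq_empty (hk : 1 ≤ k) : ∃ N : ℕ, ∀ {V : Type*} (G : SimpleGraph V),
    ¬ Contains G (cycleGraph (2 * k + 1)) → ∀ S : Finset V, N ≤ S.card →
    (∀ v ∈ S, S.card / 2 ≤
      (nbrsIn G S v).card + (cliquesIn G 2 (nbrsIn G S v)).card + 1) →
    cliquesIn G 3 S = ∅ := by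
  set q := 8 * k + 5 with hq
  set B := 2 * q ^ 2 * (4 * k + 1) with hB
  refine ⟨4 * k * q ^ 2 + 12 * (B ^ 2 + B + 2), fun G hG S hS hdeg => ?_⟩
  have hlin : ∀ v ∈ S, S.card ≤ q * (nbrsIn G S v).card := by
    intro v hv
    have h₁ := hdeg v hv
    have h₂ := (card_cliquesIn_two_le G (nbrsIn G S v)).trans (card_pairsIn_nbrsIn_le hk hG S v)
    have h₃ : S.card / 2 ≤ (4 * k + 1) * (nbrsIn G S v).card + 1 := by linarith
    have h₄ : 4 ≤ S.card := by omega
    have h₅ : 0 < (nbrsIn G S v).card := by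
      by_contra h0
      have h0' : (nbrsIn G S v).card = 0 := by omega
      rw [h0'] at h₃
      omega
    have h₆ : S.card ≤ 2 * ((4 * k + 1) * (nbrsIn G S v).card + 1) + 1 := by omega
    rw [hq]
    nlinarith
  have hU : ∀ v, (triangleNbrs G S v).card ≤ B :=
    card_triangleNbrs_le hk hG hlin (by omega)
  have hhalf : ∀ v ∈ S, S.card / 2 ≤ (nbrsIn G S v).card + B ^ 2 + 1 := by
    intro v hv
    have h₁ := hdeg v hv
    have h₂ := (card_cliquesIn_two_nbrsIn_le G S v).trans (Nat.pow_le_pow_left (hU v) 2)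
    omega
  have hco : ∀ x ∈ S, ∀ y ∈ S, G.Adj x y → (nbrsIn G S x ∩ nbrsIn G S y).card ≤ B := by
    intro x _ y hy hxy
    refine (Finset.card_le_card fun z hz => ?_).trans (hU x)
    obtain ⟨hzx, hzy⟩ := Finset.mem_inter.1 hz
    exact Finset.mem_filter.2 ⟨hzx, y, mem_nbrsIn.2 ⟨hy, hxy⟩, (mem_nbrsIn.1 hzy).2⟩
  rw [Finset.eq_empty_iff_forall_notMem]
  intro c hc
  obtain ⟨hcS, hclique⟩ := mem_cliquesIn.1 hc
  obtain ⟨x, y, z, hxy, hxz, hyz, rfl⟩ := is3Clique_iff.1 hclique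
  have hx : x ∈ S := hcS (by simp)
  have hy : y ∈ S := hcS (by simp)
  have hz : z ∈ S := hcS (by simp)
  have c₁ := hco x hx y hy hxy
  have c₂ := hco x hx z hz hxz
  have c₃ := hco y hy z hz hyz
  have d₁ := hhalf x hx
  have d₂ := hhalf y hy
  have d₃ := hhalf z hz
  have u₁ := Finset.card_union_add_card_inter (nbrsIn G S x) (nbrsIn G S y)
  have u₂ := Finset.card_union_add_card_inter (nbrsIn G S x ∪ nbrsIn G S y) (nbrsIn G S z)
  have u₃ : ((nbrsIn G S x ∪ nbrsIn G S y) ∩ nbrsIn G S z).card ≤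
      (nbrsIn G S x ∩ nbrsIn G S z).card + (nbrsIn G S y ∩ nbrsIn G S z).card := by
    rw [Finset.union_inter_distrib_right]
    exact Finset.card_union_le _ _
  have u₄ : (nbrsIn G S x ∪ nbrsIn G S y ∪ nbrsIn G S z).card ≤ S.card :=
    Finset.card_le_card (Finset.union_subset (Finset.union_subset (nbrsIn_subset _ _ _)
      (nbrsIn_subset _ _ _)) (nbrsIn_subset _ _ _))
  omega

end OddCycleFree

theorem sq_div_four_succ (n : ℕ) : (n + 1) ^ 2 / 4 = n ^ 2 / 4 + (n + 1) / 2 := by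
  obtain ⟨m, rfl | rfl⟩ := Nat.even_or_odd' n
  · have h₁ : (2 * m + 1) ^ 2 = 4 * (m ^ 2 + m) + 1 := by ring
    have h₂ : (2 * m) ^ 2 = 4 * m ^ 2 := by ring
    omega
  · have h₁ : (2 * m + 1 + 1) ^ 2 = 4 * (m ^ 2 + 2 * m + 1) := by ring
    have h₂ : (2 * m + 1) ^ 2 = 4 * (m ^ 2 + m) + 1 := by ring
    omega

/-- Mantel's theorem for the subgraph induced on a finite set. -/
theorem card_cliquesIn_two_le_sq_div_four (G : SimpleGraph V) (S : Finset V)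
    (h : cliquesIn G 3 S = ∅) : (cliquesIn G 2 S).card ≤ S.card ^ 2 / 4 := by
  induction hn : S.card generalizing S with
  | zero =>
    rw [Finset.card_eq_zero] at hn
    subst hn
    simpa using card_pairsIn_le_of_degenerate G 0 ∅ (by simp) |> (card_cliquesIn_two_le G ∅).trans
  | succ n ih =>
    have hlow : ∃ v ∈ S, (nbrsIn G S v).card ≤ (n + 1) / 2 := by
      by_contra! hdeg
      obtain ⟨x, hx⟩ : S.Nonempty := Finset.card_pos.1 (by omega)
      obtain ⟨y, hy⟩ : (nbrsIn G S x).Nonempty :=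
        Finset.card_pos.1 (by have := hdeg x hx; omega)
      obtain ⟨hyS, hxy⟩ := mem_nbrsIn.1 hy
      have hdisj : Disjoint (nbrsIn G S x) (nbrsIn G S y) := by
        rw [Finset.disjoint_left]
        intro z hzx hzy
        obtain ⟨hzS, hxz⟩ := mem_nbrsIn.1 hzx
        have hyz := (mem_nbrsIn.1 hzy).2
        have hmem : ({x, y, z} : Finset V) ∈ cliquesIn G 3 S := by
          refine mem_cliquesIn.2 ⟨?_, is3Clique_triple_iff.2 ⟨hxy, hxz, hyz⟩⟩
          simp [Finset.insert_subset_iff, hx, hyS, hzS]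
        simp [h] at hmem
      have h₁ := Finset.card_le_card
        (Finset.union_subset (nbrsIn_subset G S x) (nbrsIn_subset G S y))
      rw [Finset.card_union_of_disjoint hdisj] at h₁
      have h₂ := hdeg x hx
      have h₃ := hdeg y hyS
      omega
    obtain ⟨v, hv, hd⟩ := hlow
    have hsub : cliquesIn G 3 (S.erase v) = ∅ := by
      rw [Finset.eq_empty_iff_forall_notMem] at h ⊢
      intro c hc
      obtain ⟨hcS, hc⟩ := mem_cliquesIn.1 hc
      exact h c (mem_cliquesIn.2 ⟨hcS.trans (Finset.erase_subset _ _), hc⟩)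
    have h₁ := ih (S.erase v) hsub (by rw [Finset.card_erase_of_mem hv, hn, Nat.add_sub_cancel])
    have h₂ := card_cliquesIn_succ_le G 1 S v
    have h₃ := card_cliquesIn_one_le G (nbrsIn G S v)
    have h₄ := sq_div_four_succ n
    simp only [Nat.reduceAdd] at h₂
    omega

theorem edgeCount_le_card_cliquesIn [Fintype V] (G : SimpleGraph V) :
    edgeCount G ≤ (cliquesIn G 2 Finset.univ).card := by
  rw [edgeCount, ← Set.ncard_coe_finset]
  refine Set.ncard_le_ncard_of_injOn (fun e => e.toFinset) ?_ ?_ (Finset.finite_toSet _)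
  · intro e he
    induction e with
    | h x y =>
      have hxy : G.Adj x y := he
      simp [Sym2.toFinset_mk_eq, isNClique_iff, hxy, hxy.ne]
  · intro e _ e' _ h
    exact Sym2.ext fun x => by simpa using Finset.ext_iff.1 h x

theorem triangleCount_eq_card_cliquesIn [Fintype V] (G : SimpleGraph V) :
    triangleCount G = (cliquesIn G 3 Finset.univ).card := by
  rw [triangleCount, ← Set.ncard_coe_finset]
  congr 1
  ext c
  simp

/-- If the bound fails for `univ`, maximising the excess over the bound yields a large set that
violates it and in which every vertex lies in many edges and triangles. -/
theorem exists_dense_subset [Fintype V] (G : SimpleGraph V)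
    (h : Fintype.card V ^ 2 / 4 <
      (cliquesIn G 2 Finset.univ).card + (cliquesIn G 3 Finset.univ).card) :
    ∃ S : Finset V, Fintype.card V < 2 * 2 ^ S.card + S.card ∧
      S.card ^ 2 / 4 < (cliquesIn G 2 S).card + (cliquesIn G 3 S).card ∧
      ∀ v ∈ S, S.card / 2 ≤
        (nbrsIn G S v).card + (cliquesIn G 2 (nbrsIn G S v)).card + 1 := by
  obtain ⟨S, -, hS⟩ := Finset.exists_max_image (Finset.univ : Finset (Finset V))
    (fun S => ((cliquesIn G 2 S).card + (cliquesIn G 3 S).card + S.card : ℤ) -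
      ((S.card ^ 2 / 4 : ℕ) : ℤ)) ⟨∅, Finset.mem_univ _⟩
  have huniv := hS Finset.univ (Finset.mem_univ _)
  simp only [Finset.card_univ] at huniv
  have hcard : S.card ≤ Fintype.card V := Finset.card_le_univ S
  have b₂ := card_cliquesIn_le G 2 S
  have b₃ := card_cliquesIn_le G 3 S
  refine ⟨S, by omega, by omega, fun v hv => ?_⟩
  have herase := hS (S.erase v) (Finset.mem_univ _)
  obtain ⟨n, hn⟩ : ∃ n, S.card = n + 1 := Nat.exists_eq_succ_of_ne_zero
    (Finset.card_pos.2 ⟨v, hv⟩).ne'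
  have hne : (S.erase v).card = n := by rw [Finset.card_erase_of_mem hv, hn, Nat.add_sub_cancel]
  have e₂ := card_cliquesIn_succ_le G 1 S v
  have e₃ := card_cliquesIn_succ_le G 2 S v
  have e₁ := card_cliquesIn_one_le G (nbrsIn G S v)
  have hsq := sq_div_four_succ n
  simp only [Nat.reduceAdd] at e₂ e₃
  simp only [hne, hn] at herase
  rw [hn]
  omega

end LocalCounts

/-- Every `C_{2k+1}`-free graph on `n` vertices, with `n` sufficiently large, satisfies
`e(G) + t(G) ≤ ⌊n²/4⌋`. -/
theorem stmt_5 (k : ℕ) (hk : 1 ≤ k) :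
    ∃ n₀ : ℕ, ∀ n : ℕ, n₀ ≤ n →
      ∀ (V : Type) [Fintype V] (G : SimpleGraph V), Fintype.card V = n →
        ¬ Contains G (cycleGraph (2 * k + 1)) →
        edgeCount G + triangleCount G ≤ n ^ 2 / 4 := by
  obtain ⟨N, hN⟩ := exists_cliquesIn_three_eq_empty hk
  refine ⟨2 * 2 ^ N + N, fun n hn V _ G hV hG => ?_⟩
  subst hV
  by_contra! hlt
  have hedge := edgeCount_le_card_cliquesIn G
  have htri := triangleCount_eq_card_cliquesIn G
  obtain ⟨S, hlarge, hviol, hdeg⟩ := exists_dense_subset G (by omega)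
  have hNS : N ≤ S.card := by
    by_contra! hSN
    have hpow : 2 ^ S.card ≤ 2 ^ N := Nat.pow_le_pow_right (by norm_num) hSN.le
    omega
  have hfree := hN G hG S hNS hdeg
  have hmantel := card_cliquesIn_two_le_sq_div_four G S hfree
  rw [hfree, Finset.card_empty] at hviol
  omega
end

section
/- For every integer k ≥ 1 there exists n₀ such that for every C_{2k+1}-free graph G on n ≥ n₀ vertices: if e(G) + t(G) = ⌊n²/4⌋, then G is isomorphic to the complete bipartite graph T_2(n) with parts of sizes ⌊n/2⌋ and ⌈n/2⌉. -/
open SimpleGraph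

lemma contains_cycleGraph_of_isPath {V : Type*} {G : SimpleGraph V} {m : ℕ} (hm : 2 ≤ m) {u v : V}
    (p : G.Walk u v) (hp : p.IsPath) (hl : p.length = m) (h : G.Adj v u) :
    Contains G (cycleGraph (m + 1)) := by
  have hc : cycleGraph (m + 1) ⊑ G := by
    rw [cycleGraph_isContained_iff (by omega)]
    refine ⟨v, Walk.cons h p, ?_, by simp [hl]⟩
    rw [Walk.isCycle_iff_isPath_tail_and_le_length]
    exact ⟨by simpa using hp, by simp; omega⟩
  obtain ⟨f⟩ := hc
  exact ⟨f, f.injective, fun _ _ hij => f.toHom.map_adj hij⟩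

lemma Contains.mono {V W : Type*} {G G' : SimpleGraph V} {H : SimpleGraph W} (h : G ≤ G')
    (hG : Contains G H) : Contains G' H := by
  obtain ⟨f, hf, hadj⟩ := hG
  exact ⟨f, hf, fun _ _ hij => h (hadj hij)⟩

/-- Any two vertices of `S i` have at least `M` common neighbours in `C (!i)`, where `C j ⊆ S j`. -/
structure IsRichPair {V : Type*} [Fintype V] [DecidableEq V] (G : SimpleGraph V)
    [DecidableRel G.Adj] (C S : Bool → Finset V) (M : ℕ) : Prop where
  subset : ∀ i, C i ⊆ S i
  le_card : ∀ i, ∀ x ∈ S i, ∀ y ∈ S i,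
    M ≤ ((C (!i)).filter fun z => G.Adj x z ∧ G.Adj y z).card

namespace IsRichPair

variable {V : Type*} [Fintype V] [DecidableEq V] {G : SimpleGraph V} [DecidableRel G.Adj]
  {C S : Bool → Finset V} {M k : ℕ}

lemma exists_common (h : IsRichPair G C S M) {i : Bool} {x y : V} (hx : x ∈ S i) (hy : y ∈ S i)
    {F : Finset V} (hF : F.card < M) : ∃ z ∈ C (!i), z ∉ F ∧ G.Adj x z ∧ G.Adj y z := by
  obtain ⟨z, hz, hzF⟩ := Finset.exists_mem_notMem_of_card_lt_card (hF.trans_le (h.le_card i x hx y hy))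
  rw [Finset.mem_filter] at hz
  exact ⟨z, hz.1, hzF, hz.2⟩

lemma exists_even_path (h : IsRichPair G C S M) (j : ℕ) : ∀ {i : Bool} {x y : V} {F : Finset V},
    x ∈ S i → y ∈ S i → x ≠ y → x ∉ F → y ∉ F → F.card + 2 * j + 2 < M →
    ∃ p : G.Walk x y, p.IsPath ∧ p.length = 2 * (j + 1) ∧ ∀ w ∈ p.support, w ∉ F := by
  induction j with
  | zero =>
    intro i x y F hx hy hxy hxF hyF hM
    obtain ⟨z, -, hzF, hxz, hyz⟩ := h.exists_common hx hy (F := F) (by omega)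
    refine ⟨.cons hxz (.cons hyz.symm .nil), ?_, by simp, ?_⟩
    · simp [hxz.ne, hxy, hyz.ne']
    · simp [hxF, hzF, hyF]
  | succ j ih =>
    intro i x y F hx hy hxy hxF hyF hM
    obtain ⟨z, hz, hzF, hxz, -⟩ := h.exists_common hx hx (F := insert y F)
      (by have := Finset.card_insert_le y F; omega)
    obtain ⟨w, hw, hwF, hzw, -⟩ := h.exists_common (h.subset _ hz) (h.subset _ hz)
      (F := insert x (insert y F))
      (by have := Finset.card_insert_le y F; have := Finset.card_insert_le x (insert y F); omega)
    simp only [Finset.mem_insert, not_or, Bool.not_not] at hzF hw hwF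
    obtain ⟨p, hp, hl, hpF⟩ := ih (F := insert x (insert z F)) (h.subset _ hw) hy hwF.2.1
      (by simp [hwF, hzw.ne']) (by simp [hxy.symm, hyF, Ne.symm hzF.1])
      (by have := Finset.card_insert_le z F; have := Finset.card_insert_le x (insert z F); omega)
    refine ⟨.cons hxz (.cons hzw p), ?_, by simp [hl]; omega, ?_⟩
    · simp only [Walk.cons_isPath_iff, Walk.support_cons, List.mem_cons, not_or]
      exact ⟨⟨hp, fun hs => hpF _ hs (by simp)⟩, hxz.ne, fun hs => hpF _ hs (by simp)⟩
    · simp only [Walk.support_cons, List.mem_cons]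
      rintro v (rfl | rfl | hv)
      · exact hxF
      · exact hzF.2
      · intro hvF
        exact hpF v hv (by simp [hvF])

lemma not_adj (h : IsRichPair G C S M) (hk : 1 ≤ k) (hM : 2 * k + 4 ≤ M)
    (hG : ¬ Contains G (cycleGraph (2 * k + 1))) {i : Bool} {x y : V} (hx : x ∈ S i)
    (hy : y ∈ S i) : ¬ G.Adj x y := by
  intro hxy
  obtain ⟨p, hp, hl, -⟩ := h.exists_even_path (k - 1) (F := ∅) hx hy hxy.ne (by simp) (by simp)
    (by simp; omega)
  exact hG (contains_cycleGraph_of_isPath (by omega) p hp (by omega) hxy.symm)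

lemma not_adj_both (h : IsRichPair G C S M) (hk : 2 ≤ k) (hM : 2 * k + 4 ≤ M)
    (hG : ¬ Contains G (cycleGraph (2 * k + 1))) {i : Bool} {x y r : V} (hx : x ∈ S i)
    (hy : y ∈ S (!i)) (hrx : G.Adj r x) : ¬ G.Adj r y := by
  intro hry
  obtain ⟨z, hz, hzF, hxz, -⟩ := h.exists_common hx hx (F := {r, y})
    (by have := Finset.card_le_two (a := r) (b := y); omega)
  simp only [Finset.mem_insert, Finset.mem_singleton, not_or] at hzF
  by_cases hxy : x = y
  · subst hxy
    exact h.not_adj (by omega) hM hG (h.subset _ hz) hy hxz.symm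
  obtain ⟨p, hp, hl, hpF⟩ := h.exists_even_path (k - 2) (F := {r, x}) (h.subset _ hz) hy hzF.2
    (by simp [hzF, hxz.ne']) (by simp [hry.ne', Ne.symm hxy])
    (by have := Finset.card_le_two (a := r) (b := x); omega)
  refine hG (contains_cycleGraph_of_isPath (by omega) (.cons hrx (.cons hxz p)) ?_
    (by simp [hl]; omega) hry.symm)
  simp only [Walk.cons_isPath_iff, Walk.support_cons, List.mem_cons, not_or]
  exact ⟨⟨hp, fun hs => hpF _ hs (by simp)⟩, hrx.ne, fun hs => hpF _ hs (by simp)⟩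

lemma eq_of_adj (h : IsRichPair G C S M) (hk : 2 ≤ k) (hM : 2 * k + 4 ≤ M)
    (hG : ¬ Contains G (cycleGraph (2 * k + 1))) {i : Bool} {x y r s : V} (hx : x ∈ S i)
    (hy : y ∈ S i) (hrs : G.Adj r s) (hsx : G.Adj s x) (hry : G.Adj r y) (hrx : r ≠ x)
    (hsy : s ≠ y) : x = y := by
  by_contra hxy
  obtain ⟨p, hp, hl, hpF⟩ := h.exists_even_path (k - 2) (F := {r, s}) hx hy hxy
    (by simp [hrx.symm, hsx.ne']) (by simp [hry.ne', hsy.symm])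
    (by have := Finset.card_le_two (a := r) (b := s); omega)
  refine hG (contains_cycleGraph_of_isPath (by omega) (.cons hrs (.cons hsx p)) ?_
    (by simp [hl]; omega) hry.symm)
  simp only [Walk.cons_isPath_iff, Walk.support_cons, List.mem_cons, not_or]
  exact ⟨⟨hp, fun hs => hpF _ hs (by simp)⟩, hrs.ne, fun hs => hpF _ hs (by simp)⟩

end IsRichPair

section TriangleBound

variable {V : Type*} [DecidableEq V] {G : SimpleGraph V} [DecidableRel G.Adj]

lemma exists_isPath_of_le_card_filter {T : Finset V} (hT : T.Nonempty) {c : ℕ}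
    (hc : ∀ x ∈ T, c ≤ (T.filter (G.Adj x)).card) (m : ℕ) (hm : m ≤ c) :
    ∃ (u v : V) (p : G.Walk u v), p.IsPath ∧ p.length = m ∧ ∀ w ∈ p.support, w ∈ T := by
  induction m with
  | zero =>
    obtain ⟨u, hu⟩ := hT
    exact ⟨u, u, .nil, by simp, rfl, by simp [hu]⟩
  | succ m ih =>
    obtain ⟨u, v, p, hp, hl, hpT⟩ := ih (by omega)
    have hcard : (p.support.toFinset.erase u).card < (T.filter (G.Adj u)).card := by
      rw [Finset.card_erase_of_mem (by simp), List.toFinset_card_of_nodup hp.support_nodup,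
        Walk.length_support]
      have := hc u (hpT u p.start_mem_support)
      omega
    obtain ⟨w, hw, hws⟩ := Finset.exists_mem_notMem_of_card_lt_card hcard
    rw [Finset.mem_filter] at hw
    have hws' : w ∉ p.support := by simpa [hw.2.ne'] using hws
    refine ⟨w, v, .cons hw.2.symm p, by simp [hp, hws'], by simp [hl], ?_⟩
    simp only [Walk.support_cons, List.mem_cons]
    rintro x (rfl | hx)
    · exact hw.1
    · exact hpT x hx

lemma sum_card_filter_adj_le {c : ℕ} (S : Finset V)
    (hS : ∀ (u v : V) (p : G.Walk u v), p.IsPath → (∀ w ∈ p.support, w ∈ S) → p.length ≠ c) :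
    ∑ x ∈ S, (S.filter (G.Adj x)).card ≤ 2 * c * S.card := by
  induction S using Finset.strongInduction with
  | H S ih =>
    rcases S.eq_empty_or_nonempty with rfl | hne
    · simp
    obtain ⟨x, hx, hxc⟩ : ∃ x ∈ S, (S.filter (G.Adj x)).card < c := by
      by_contra! hcon
      obtain ⟨u, v, p, hp, hl, hpS⟩ := exists_isPath_of_le_card_filter hne hcon c le_rfl
      exact hS u v p hp hpS hl
    have hih := ih (S.erase x) (Finset.erase_ssubset hx) fun u v p hp hpS =>
      hS u v p hp fun w hw => Finset.mem_of_mem_erase (hpS w hw)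
    have hdeg : ∀ y ∈ S.erase x, (S.filter (G.Adj y)).card
        = ((S.erase x).filter (G.Adj y)).card + if G.Adj x y then 1 else 0 := by
      intro y hy
      conv_lhs => rw [← Finset.insert_erase hx, Finset.filter_insert]
      simp only [G.adj_comm y x]
      split_ifs
      · rw [Finset.card_insert_of_notMem (by simp)]
      · rfl
    have hcount : ∑ y ∈ S.erase x, (if G.Adj x y then 1 else 0) = (S.filter (G.Adj x)).card := by
      rw [Finset.card_filter, ← Finset.add_sum_erase S _ hx]
      simp
    rw [← Finset.add_sum_erase S _ hx, Finset.sum_congr rfl hdeg, Finset.sum_add_distrib, hcount]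
    have hcard := Finset.card_erase_add_one hx
    calc _ ≤ c + (2 * c * (S.erase x).card + c) := by gcongr
      _ = 2 * c * S.card := by rw [← hcard]; ring

lemma card_cliqueFinset_le [Fintype V] {k : ℕ} (hk : 1 ≤ k)
    (hG : ¬ Contains G (cycleGraph (2 * k + 1))) :
    (G.cliqueFinset 3).card ≤ 8 * k * G.edgeFinset.card := by
  have hsub : G.cliqueFinset 3 ⊆ Finset.univ.biUnion fun v =>
      (G.neighborFinset v).biUnion fun x =>
        ((G.neighborFinset v).filter (G.Adj x)).image fun y => {v, x, y} := by
    intro t ht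
    rw [mem_cliqueFinset_iff, is3Clique_iff] at ht
    obtain ⟨a, b, c, hab, hac, hbc, rfl⟩ := ht
    simp only [Finset.mem_biUnion, Finset.mem_univ, true_and, Finset.mem_image, Finset.mem_filter,
      mem_neighborFinset]
    exact ⟨a, b, hab, c, ⟨hac, hbc⟩, rfl⟩
  have hv : ∀ v, ∑ x ∈ G.neighborFinset v, ((G.neighborFinset v).filter (G.Adj x)).card
      ≤ 2 * (2 * k - 1) * (G.neighborFinset v).card := by
    refine fun v => sum_card_filter_adj_le _ fun x y p hp hpS hl => hG ?_
    have hx := hpS x p.start_mem_support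
    have hy := hpS y p.end_mem_support
    rw [mem_neighborFinset] at hx hy
    refine contains_cycleGraph_of_isPath (by omega) (.cons hx p) ?_ (by simp [hl]; omega) hy.symm
    rw [Walk.cons_isPath_iff]
    exact ⟨hp, fun hs => by simpa using hpS v hs⟩
  calc (G.cliqueFinset 3).card
      ≤ ∑ v, ∑ x ∈ G.neighborFinset v, ((G.neighborFinset v).filter (G.Adj x)).card := by
        refine (Finset.card_le_card hsub).trans (Finset.card_biUnion_le.trans ?_)
        gcongr with v
        refine Finset.card_biUnion_le.trans ?_
        gcongr with x
        exact Finset.card_image_le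
    _ ≤ ∑ v, 4 * k * G.degree v := by
        gcongr with v
        refine (hv v).trans ?_
        rw [card_neighborFinset_eq_degree]
        exact Nat.mul_le_mul_right _ (by omega)
    _ = 8 * k * G.edgeFinset.card := by
        rw [← Finset.mul_sum, sum_degrees_eq_twice_card_edges]
        ring

end TriangleBound

/-- A dense graph on sufficiently many vertices contains a large complete bipartite graph. -/
lemma exists_complete_bipartite (s : ℕ) {δ : ℝ} (hδ : 0 < δ) : ∃ n₀ : ℕ, ∀ (V : Type)
    [Fintype V] [DecidableEq V] (G : SimpleGraph V) [DecidableRel G.Adj], n₀ ≤ Fintype.card V →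
    δ * (Fintype.card V : ℝ) ^ 2 < G.edgeFinset.card →
    ∃ X Y : Finset V, s ≤ X.card ∧ s ≤ Y.card ∧ ∀ x ∈ X, ∀ y ∈ Y, G.Adj x y := by
  obtain ⟨n₀, hn₀⟩ := exists_nat_gt (max (2 * s / δ) (s / δ * (2 / δ) ^ s))
  refine ⟨n₀, fun V _ _ G _ hn he => ?_⟩
  set n := Fintype.card V with hnV
  have hn' : (n₀ : ℝ) ≤ n := by exact_mod_cast hn
  have h1 : 2 * s / δ < n := (le_max_left _ _).trans_lt (hn₀.trans_le hn')
  have h2 : s / δ * (2 / δ) ^ s < n := (le_max_right _ _).trans_lt (hn₀.trans_le hn')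
  have hnpos : (0 : ℝ) < n := lt_of_le_of_lt (by positivity) h1
  by_contra! hcon
  set D := Finset.univ.filter fun v => δ * n ≤ G.degree v with hD
  have hDcard : δ * n ≤ D.card := by
    have hsum : (2 * G.edgeFinset.card : ℝ) ≤ D.card * n + n * (δ * n) := by
      have hs : (2 * G.edgeFinset.card : ℝ) = ∑ v, (G.degree v : ℝ) := by
        exact_mod_cast G.sum_degrees_eq_twice_card_edges.symm
      rw [hs]
      calc ∑ v, (G.degree v : ℝ) ≤ ∑ v, ((if δ * n ≤ G.degree v then (n : ℝ) else 0) + δ * n) := by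
            refine Finset.sum_le_sum fun v _ => ?_
            have hd : (G.degree v : ℝ) ≤ n := by exact_mod_cast (G.degree_lt_card_verts v).le
            split_ifs with h
            · nlinarith
            · linarith
        _ = D.card * n + n * (δ * n) := by
            rw [Finset.sum_add_distrib, ← Finset.sum_filter]
            simp [hD, hnV]
    nlinarith
  have hcount : ∑ v ∈ D, ((G.neighborFinset v).powersetCard s).card
      ≤ ((Finset.univ : Finset V).powersetCard s).card * s := by
    have := Finset.sum_card_bipartiteAbove_eq_sum_card_bipartiteBelow (s := D)
      (t := (Finset.univ : Finset V).powersetCard s) (fun v X => X ⊆ G.neighborFinset v)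
    calc _ = ∑ X ∈ (Finset.univ : Finset V).powersetCard s,
          (D.bipartiteBelow (fun v X => X ⊆ G.neighborFinset v) X).card := by
            rw [← this]
            refine Finset.sum_congr rfl fun v _ => congrArg _ ?_
            ext X
            simp [Finset.mem_powersetCard, Finset.mem_bipartiteAbove, and_comm]
      _ ≤ _ := by
            rw [← smul_eq_mul]
            refine Finset.sum_le_card_nsmul _ _ _ fun X hX => ?_
            rw [Finset.mem_powersetCard] at hX
            by_contra! hlt
            obtain ⟨x, hx, y, hy, hxy⟩ := hcon X _ hX.2.ge hlt.le
            rw [Finset.mem_bipartiteBelow] at hy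
            have := hy.2 hx
            rw [mem_neighborFinset] at this
            exact hxy this.symm
  have hlow : ∀ v ∈ D, (δ * n / 2) ^ s ≤ s.factorial * ((G.neighborFinset v).powersetCard s).card := by
    intro v hv
    rw [hD, Finset.mem_filter] at hv
    rw [Finset.card_powersetCard, card_neighborFinset_eq_degree]
    have h3 : 2 * s < δ * n := by rw [div_lt_iff₀ hδ] at h1; linarith
    have h4 : s ≤ G.degree v := by
      have : (s : ℝ) ≤ G.degree v := by
        have : (0 : ℝ) ≤ s := by positivity
        linarith [hv.2]
      exact_mod_cast this
    have h5 := Nat.pow_le_choose (α := ℝ) s (G.degree v)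
    rw [div_le_iff₀' (by positivity), Nat.cast_sub (by omega)] at h5
    push_cast at h5
    refine le_trans ?_ h5
    gcongr
    linarith [hv.2]
  have hup : (s.factorial : ℝ) * ((Finset.univ : Finset V).powersetCard s).card ≤ (n : ℝ) ^ s := by
    rw [Finset.card_powersetCard, Finset.card_univ]
    have := Nat.choose_le_pow_div (α := ℝ) s n
    rw [le_div_iff₀ (by positivity)] at this
    linarith
  have hfin : δ * n * (δ * n / 2) ^ s ≤ n ^ s * s := by
    calc δ * n * (δ * n / 2) ^ s ≤ D.card * (δ * n / 2) ^ s := by gcongr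
      _ ≤ ∑ v ∈ D, (s.factorial : ℝ) * ((G.neighborFinset v).powersetCard s).card := by
          rw [← nsmul_eq_mul]
          exact Finset.card_nsmul_le_sum _ _ _ hlow
      _ ≤ s.factorial * (((Finset.univ : Finset V).powersetCard s).card * s) := by
          rw [← Finset.mul_sum]
          gcongr
          exact_mod_cast hcount
      _ ≤ n ^ s * s := by rw [← mul_assoc]; gcongr
  have h6 : δ * n * (δ / 2) ^ s ≤ s := by
    have : δ * n * (δ * n / 2) ^ s = n ^ s * (δ * n * (δ / 2) ^ s) := by
      rw [mul_div_right_comm, mul_pow]; ring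
    rw [this] at hfin
    exact le_of_mul_le_mul_left hfin (by positivity)
  have h7 : (2 / δ) ^ s * (δ / 2) ^ s = 1 := by
    rw [← mul_pow]
    field_simp
    simp
  have h8 : s / δ * (2 / δ) ^ s * (δ * (δ / 2) ^ s) = s := by
    calc _ = (s / δ * δ) * ((2 / δ) ^ s * (δ / 2) ^ s) := by ring
      _ = s := by rw [h7]; field_simp
  have h9 := mul_lt_mul_of_pos_right h2 (show 0 < δ * (δ / 2) ^ s by positivity)
  nlinarith

/-- The subgraph formed by the edges of `G` that lie in a triangle. -/
def triangleGraph {V : Type*} (G : SimpleGraph V) : SimpleGraph V where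
  Adj u v := G.Adj u v ∧ ∃ w, G.Adj u w ∧ G.Adj v w
  symm := ⟨fun _ _ ⟨h, w, hu, hv⟩ => ⟨h.symm, w, hv, hu⟩⟩
  loopless := ⟨fun _ h => h.1.ne rfl⟩

section TriangleGraph

variable {V : Type*} {G : SimpleGraph V}

lemma triangleGraph_le (G : SimpleGraph V) : triangleGraph G ≤ G := fun _ _ h => h.1

lemma cliqueFinset_triangleGraph [Fintype V] [DecidableEq V] [DecidableRel G.Adj]
    [DecidableRel (triangleGraph G).Adj] :
    G.cliqueFinset 3 ⊆ (triangleGraph G).cliqueFinset 3 := by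
  intro t ht
  rw [mem_cliqueFinset_iff, is3Clique_iff] at ht ⊢
  obtain ⟨a, b, c, hab, hac, hbc, rfl⟩ := ht
  exact ⟨a, b, c, ⟨hab, c, hac, hbc⟩, ⟨hac, b, hab, hbc.symm⟩, ⟨hbc, a, hab.symm, hac.symm⟩, rfl⟩

lemma cliqueFree_sdiff_triangleGraph : (G \ triangleGraph G).CliqueFree 3 := by
  classical
  intro t ht
  rw [is3Clique_iff] at ht
  obtain ⟨a, b, c, hab, hac, hbc, rfl⟩ := ht
  simp only [sdiff_adj] at hab hac hbc
  exact hab.2 ⟨hab.1, c, hac.1, hbc.1⟩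

end TriangleGraph

lemma exists_card_edgeFinset_triangleGraph_le {k : ℕ} (hk : 2 ≤ k) {δ : ℝ} (hδ : 0 < δ) :
    ∃ n₀ : ℕ, ∀ (V : Type) [Fintype V] [DecidableEq V] (G : SimpleGraph V)
      [DecidableRel (triangleGraph G).Adj], n₀ ≤ Fintype.card V →
      ¬ Contains G (cycleGraph (2 * k + 1)) →
      ((triangleGraph G).edgeFinset.card : ℝ) ≤ δ * (Fintype.card V : ℝ) ^ 2 := by
  classical
  obtain ⟨n₀, hn₀⟩ := exists_complete_bipartite (2 * k + 4) hδ
  refine ⟨n₀, fun V _ _ G _ hn hG => ?_⟩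
  by_contra! hlt
  obtain ⟨X, Y, hX, hY, hXY⟩ := hn₀ V (triangleGraph G) hn hlt
  have hrich : IsRichPair G (fun i => bif i then Y else X) (fun i => bif i then Y else X)
      (2 * k + 4) := by
    refine ⟨fun i => subset_rfl, fun i x hx y hy => ?_⟩
    rw [Finset.filter_true_of_mem]
    · cases i <;> simpa
    · intro z hz
      cases i
      · exact ⟨(hXY x hx z hz).1, (hXY y hy z hz).1⟩
      · exact ⟨(hXY z hz x hx).1.symm, (hXY z hz y hy).1.symm⟩
  obtain ⟨x, hx⟩ : X.Nonempty := Finset.card_pos.1 (by omega)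
  obtain ⟨y, hy⟩ : Y.Nonempty := Finset.card_pos.1 (by omega)
  obtain ⟨-, w, hxw, hyw⟩ := hXY x hx y hy
  exact hrich.not_adj_both hk le_rfl hG (i := false) hx hy hxw.symm hyw.symm

/-- Stability for triangle-free graphs: the neighbourhood of a vertex of maximum degree is one side
of a cut containing almost `n ^ 2 / 4` edges. -/
lemma exists_cut_of_cliqueFree_three {V : Type*} [Fintype V] [Nonempty V] [DecidableEq V]
    {H : SimpleGraph V} [DecidableRel H.Adj] (hH : H.CliqueFree 3) :
    ∃ A : Finset V, 2 * (H.edgeFinset.card : ℝ) ≤ (Fintype.card V : ℝ) ^ 2 / 4 +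
      ∑ x ∈ A, ((Aᶜ.filter (H.Adj x)).card : ℝ) := by
  obtain ⟨v, hv⟩ := H.exists_maximal_degree_vertex
  refine ⟨H.neighborFinset v, ?_⟩
  set A := H.neighborFinset v with hA
  have hAdeg : ∀ x ∈ A, (H.degree x : ℝ) = ((Aᶜ.filter (H.Adj x)).card : ℝ) := by
    intro x hx
    rw [hA, mem_neighborFinset] at hx
    rw [← card_neighborFinset_eq_degree]
    congr 2
    ext y
    simp only [mem_neighborFinset, Finset.mem_filter, Finset.mem_compl, hA]
    refine ⟨fun hxy => ⟨fun hvy => hH {v, x, y} ?_, hxy⟩, fun h => h.2⟩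
    exact is3Clique_triple_iff.2 ⟨hx, hvy, hxy⟩
  have hBdeg : ∑ x ∈ Aᶜ, (H.degree x : ℝ) ≤ (Fintype.card V : ℝ) ^ 2 / 4 := by
    have h1 : ∑ x ∈ Aᶜ, (H.degree x : ℝ) ≤ Aᶜ.card • (A.card : ℝ) := by
      refine Finset.sum_le_card_nsmul _ _ _ fun x _ => ?_
      rw [hA, card_neighborFinset_eq_degree, ← hv]
      exact_mod_cast H.degree_le_maxDegree x
    have h2 : (A.card : ℝ) + Aᶜ.card = Fintype.card V := by exact_mod_cast A.card_add_card_compl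
    rw [nsmul_eq_mul] at h1
    rw [← h2]
    nlinarith [sq_nonneg ((A.card : ℝ) - Aᶜ.card)]
  have hsum : 2 * (H.edgeFinset.card : ℝ) = ∑ x, (H.degree x : ℝ) := by
    exact_mod_cast H.sum_degrees_eq_twice_card_edges.symm
  rw [hsum, ← Finset.sum_add_sum_compl A, Finset.sum_congr rfl hAdeg]
  linarith

section Core

variable {V : Type*} {G : SimpleGraph V} [DecidableRel G.Adj]

lemma card_filter_lt_card_nonadj_le {A B : Finset V} {ε n : ℝ} (hn : 0 < n)
    (h : ∑ x ∈ A, ((B.filter fun y => ¬ G.Adj x y).card : ℝ) ≤ ε * n ^ 2) :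
    ((A.filter fun x => ¬ ((B.filter fun y => ¬ G.Adj x y).card : ℝ) ≤ n / 16).card : ℝ)
      ≤ 16 * ε * n := by
  set A' := A.filter fun x => ¬ ((B.filter fun y => ¬ G.Adj x y).card : ℝ) ≤ n / 16 with hA'
  have h1 : A'.card • (n / 16) ≤ ∑ x ∈ A, ((B.filter fun y => ¬ G.Adj x y).card : ℝ) := by
    refine (Finset.card_nsmul_le_sum A' _ _ fun x hx => ?_).trans
      (Finset.sum_le_sum_of_subset_of_nonneg (Finset.filter_subset _ _) fun _ _ _ => by positivity)
    rw [hA', Finset.mem_filter, not_le] at hx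
    exact hx.2.le
  rw [nsmul_eq_mul] at h1
  have h2 : (A'.card : ℝ) * n ≤ (16 * ε * n) * n := by nlinarith
  exact le_of_mul_le_mul_right h2 hn

lemma sum_card_nonadj_comm (A B : Finset V) :
    ∑ x ∈ A, ((B.filter fun y => ¬ G.Adj x y).card : ℝ)
      = ∑ y ∈ B, ((A.filter fun x => ¬ G.Adj y x).card : ℝ) := by
  have := Finset.sum_card_bipartiteAbove_eq_sum_card_bipartiteBelow (s := A) (t := B)
    fun x y => ¬ G.Adj x y
  simp only [Finset.bipartiteAbove, Finset.bipartiteBelow] at this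
  simp only [G.adj_comm] at this ⊢
  exact_mod_cast this

variable [Fintype V]

/-- The vertices that are adjacent to all but few vertices of `B`. -/
noncomputable def nearComplete (G : SimpleGraph V) [DecidableRel G.Adj] (B : Finset V) : Finset V :=
  Finset.univ.filter fun v =>
    ((B.filter fun y => ¬ G.Adj v y).card : ℝ) ≤ (Fintype.card V : ℝ) / 16

lemma mem_nearComplete {B : Finset V} {v : V} : v ∈ nearComplete G B ↔
    ((B.filter fun y => ¬ G.Adj v y).card : ℝ) ≤ (Fintype.card V : ℝ) / 16 := by
  simp [nearComplete]

/-- A graph with few missing edges across a nearly balanced cut has a large rich core. -/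
lemma exists_isRichPair_of_cut [DecidableEq V] (A : Finset V) {ε : ℝ} {M : ℕ} (hε : ε ≤ 1 / 16384)
    (hn : 8 * M ≤ Fintype.card V) (hpos : 0 < Fintype.card V)
    (hcut : (Fintype.card V : ℝ) ^ 2 / 4 - ε * (Fintype.card V : ℝ) ^ 2
      ≤ ∑ x ∈ A, ((Aᶜ.filter (G.Adj x)).card : ℝ)) :
    ∃ C : Bool → Finset V, IsRichPair G C (fun i => nearComplete G (C (!i))) M ∧
      (∀ i, (Fintype.card V : ℝ) / 2 - Fintype.card V / 32 ≤ (C i).card) ∧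
      (((C false ∪ C true)ᶜ.card : ℝ) ≤ 32 * ε * Fintype.card V) := by
  set n : ℝ := (Fintype.card V : ℝ) with hnV
  have hnpos : 0 < n := by rw [hnV]; exact_mod_cast hpos
  have hAB : (A.card : ℝ) + Aᶜ.card = n := by rw [hnV]; exact_mod_cast A.card_add_card_compl
  have hmiss : ∑ x ∈ A, ((Aᶜ.filter fun y => ¬ G.Adj x y).card : ℝ)
      = A.card * Aᶜ.card - ∑ x ∈ A, ((Aᶜ.filter (G.Adj x)).card : ℝ) := by
    rw [eq_sub_iff_add_eq, ← Finset.sum_add_distrib, ← nsmul_eq_mul, ← Finset.sum_const]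
    refine Finset.sum_congr rfl fun x _ => ?_
    rw [add_comm]
    exact_mod_cast Finset.card_filter_add_card_filter_not (s := Aᶜ) (G.Adj x)
  have hmiss_nonneg : 0 ≤ ∑ x ∈ A, ((Aᶜ.filter fun y => ¬ G.Adj x y).card : ℝ) :=
    Finset.sum_nonneg fun _ _ => by positivity
  have hmiss_le : ∑ x ∈ A, ((Aᶜ.filter fun y => ¬ G.Adj x y).card : ℝ) ≤ ε * n ^ 2 := by
    rw [hmiss]
    nlinarith [sq_nonneg ((A.card : ℝ) - Aᶜ.card)]
  have hsq : ((A.card : ℝ) - n / 2) ^ 2 ≤ (n / 128) ^ 2 := by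
    have : (Aᶜ.card : ℝ) = n - A.card := by linarith
    rw [this] at hmiss
    nlinarith [sq_nonneg n]
  have habs := abs_le_of_sq_le_sq' hsq (by positivity)
  set P : Bool → Finset V := fun i => bif i then Aᶜ else A with hP
  have hPsum : ∀ i, ∑ x ∈ P i, (((P (!i)).filter fun y => ¬ G.Adj x y).card : ℝ) ≤ ε * n ^ 2 := by
    rintro (_ | _)
    · exact hmiss_le
    · exact (sum_card_nonadj_comm _ _).trans_le hmiss_le
  have hPcard : ∀ i, n / 2 - n / 128 ≤ (P i).card := by
    rintro (_ | _) <;> simp only [hP, cond_true, cond_false] <;> linarith [habs.1, habs.2]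
  set C : Bool → Finset V := fun i => (P i).filter fun x =>
    (((P (!i)).filter fun y => ¬ G.Adj x y).card : ℝ) ≤ n / 16 with hC
  have hCcompl : ∀ i, ((P i).filter fun x =>
      ¬ (((P (!i)).filter fun y => ¬ G.Adj x y).card : ℝ) ≤ n / 16).card ≤ 16 * ε * n :=
    fun i => card_filter_lt_card_nonadj_le hnpos (hPsum i)
  have hCcard : ∀ i, n / 2 - n / 32 ≤ (C i).card := by
    intro i
    have h1 : ((C i).card : ℝ) + ((P i).filter fun x =>
      ¬ (((P (!i)).filter fun y => ¬ G.Adj x y).card : ℝ) ≤ n / 16).card = (P i).card := by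
      exact_mod_cast Finset.card_filter_add_card_filter_not _
    have h2 := hCcompl i
    have h3 := hPcard i
    nlinarith
  refine ⟨C, ⟨fun i x hx => ?_, fun i x hx y hy => ?_⟩, hCcard, ?_⟩
  · rw [mem_nearComplete]
    rw [hC, Finset.mem_filter] at hx
    refine le_trans ?_ hx.2
    exact_mod_cast Finset.card_le_card (Finset.filter_subset_filter _ (Finset.filter_subset _ _))
  · rw [mem_nearComplete] at hx hy
    have hsub : C (!i) ⊆ ((C (!i)).filter fun z => G.Adj x z ∧ G.Adj y z) ∪
        (((C (!i)).filter fun z => ¬ G.Adj x z) ∪ ((C (!i)).filter fun z => ¬ G.Adj y z)) := by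
      intro z hz
      simp only [Finset.mem_union, Finset.mem_filter]
      tauto
    have h1 := (Finset.card_le_card hsub).trans
      ((Finset.card_union_le _ _).trans (Nat.add_le_add_left (Finset.card_union_le _ _) _))
    have h1' : ((C (!i)).card : ℝ) ≤ ((C (!i)).filter fun z => G.Adj x z ∧ G.Adj y z).card +
        (((C (!i)).filter fun z => ¬ G.Adj x z).card + ((C (!i)).filter fun z => ¬ G.Adj y z).card) :=
      by exact_mod_cast h1
    have h2 := hCcard (!i)
    have h3 : (8 * M : ℝ) ≤ n := by rw [hnV]; exact_mod_cast hn
    have h4 : (M : ℝ) ≤ ((C (!i)).filter fun z => G.Adj x z ∧ G.Adj y z).card := by linarith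
    exact_mod_cast h4
  · have hsub : (C false ∪ C true)ᶜ ⊆ ((P false).filter fun x =>
        ¬ (((P (!false)).filter fun y => ¬ G.Adj x y).card : ℝ) ≤ n / 16) ∪ ((P true).filter fun x =>
        ¬ (((P (!true)).filter fun y => ¬ G.Adj x y).card : ℝ) ≤ n / 16) := by
      intro x hx
      simp only [Finset.mem_compl, Finset.mem_union, hC, Finset.mem_filter, not_or] at hx ⊢
      have : x ∈ P false ∨ x ∈ P true := by simpa [hP] using em (x ∈ A)
      tauto
    have h1 : ((C false ∪ C true)ᶜ.card : ℝ) ≤ _ :=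
      Nat.cast_le.2 ((Finset.card_le_card hsub).trans (Finset.card_union_le _ _))
    push_cast at h1
    linarith [hCcompl false, hCcompl true]

end Core

namespace IsRichPair

variable {V : Type*} [Fintype V] [DecidableEq V] {G : SimpleGraph V} [DecidableRel G.Adj]
  {C S : Bool → Finset V} {M k : ℕ}

lemma disjoint (h : IsRichPair G C S M) (hk : 2 ≤ k) (hM : 2 * k + 4 ≤ M)
    (hG : ¬ Contains G (cycleGraph (2 * k + 1))) (i : Bool) : Disjoint (S i) (S (!i)) := by
  rw [Finset.disjoint_left]
  intro v hv hv'
  obtain ⟨x, hx, -, hvx, -⟩ := h.exists_common hv hv (F := ∅) (by simp; omega)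
  obtain ⟨y, hy, -, hvy, -⟩ := h.exists_common hv' hv' (F := ∅) (by simp; omega)
  exact h.not_adj_both hk hM hG (h.subset _ hx) (h.subset _ hy) hvx hvy

lemma exists_mem_of_notMem_compl {v : V} (hv : v ∉ (S false ∪ S true)ᶜ) : ∃ i, v ∈ S i := by
  rw [Finset.notMem_compl, Finset.mem_union] at hv
  exact hv.elim (fun h => ⟨_, h⟩) fun h => ⟨_, h⟩

/-- Every triangle has at most one vertex in the rich pair. -/
lemma mem_compl_or_mem_compl (h : IsRichPair G C S M) (hk : 2 ≤ k) (hM : 2 * k + 4 ≤ M)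
    (hG : ¬ Contains G (cycleGraph (2 * k + 1))) {x y w : V} (hxy : G.Adj x y) (hwx : G.Adj w x)
    (hwy : G.Adj w y) : x ∈ (S false ∪ S true)ᶜ ∨ y ∈ (S false ∪ S true)ᶜ := by
  by_contra! hcon
  obtain ⟨i, hi⟩ := exists_mem_of_notMem_compl hcon.1
  obtain ⟨j, hj⟩ := exists_mem_of_notMem_compl hcon.2
  rcases Bool.eq_or_eq_not j i with rfl | rfl
  · exact h.not_adj (by omega) hM hG hi hj hxy
  · exact h.not_adj_both hk hM hG hi hj hwx hwy

lemma card_edgeFinset_le (h : IsRichPair G C S M) (hk : 2 ≤ k) (hM : 2 * k + 4 ≤ M)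
    (hG : ¬ Contains G (cycleGraph (2 * k + 1))) :
    G.edgeFinset.card ≤ (S false).card * (S true).card +
      ∑ r ∈ (S false ∪ S true)ᶜ, G.degree r := by
  have hsub : G.edgeFinset ⊆ ((S false ×ˢ S true).image fun p => s(p.1, p.2)) ∪
      (S false ∪ S true)ᶜ.biUnion fun r => G.incidenceFinset r := by
    intro e
    induction e with | h x y => ?_
    intro hxy
    rw [mem_edgeFinset, mem_edgeSet] at hxy
    rw [Finset.mem_union, or_iff_not_imp_right]
    intro hR
    have hinc : ∀ r ∈ (S false ∪ S true)ᶜ, s(x, y) ∉ G.incidenceFinset r := by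
      intro r hr hmem
      exact hR (Finset.mem_biUnion.2 ⟨r, hr, hmem⟩)
    have hx : x ∉ (S false ∪ S true)ᶜ := fun hx => hinc x hx (by simpa using hxy)
    have hy : y ∉ (S false ∪ S true)ᶜ := fun hy => hinc y hy (by
      rw [Sym2.eq_swap]; simpa using hxy.symm)
    obtain ⟨i, hi⟩ := exists_mem_of_notMem_compl hx
    obtain ⟨j, hj⟩ := exists_mem_of_notMem_compl hy
    rw [Finset.mem_image]
    rcases Bool.eq_or_eq_not j i with rfl | rfl
    · exact absurd hxy (h.not_adj (by omega) hM hG hi hj)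
    · cases i
      · exact ⟨(x, y), Finset.mem_product.2 ⟨hi, hj⟩, rfl⟩
      · exact ⟨(y, x), Finset.mem_product.2 ⟨hj, hi⟩, Sym2.eq_swap⟩
  refine (Finset.card_le_card hsub).trans ((Finset.card_union_le _ _).trans ?_)
  gcongr
  · exact Finset.card_image_le.trans (Finset.card_product _ _).le
  · refine Finset.card_biUnion_le.trans ?_
    simp

/-- The triangles with exactly two vertices outside the rich pair are determined by these. -/
lemma card_filter_card_inter_eq_two_le (h : IsRichPair G C S M) (hk : 2 ≤ k)
    (hM : 2 * k + 4 ≤ M) (hG : ¬ Contains G (cycleGraph (2 * k + 1))) :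
    ((G.cliqueFinset 3).filter fun t => (t ∩ (S false ∪ S true)ᶜ).card = 2).card
      ≤ (S false ∪ S true)ᶜ.card ^ 2 := by
  set R := (S false ∪ S true)ᶜ with hR
  have hle : ((G.cliqueFinset 3).filter fun t => (t ∩ R).card = 2).card
      ≤ (R.powersetCard 2).card := by
    have hsingle : ∀ t ∈ (G.cliqueFinset 3).filter fun t => (t ∩ R).card = 2,
        ∃ x, t \ R = {x} := by
      intro t ht
      rw [Finset.mem_filter, mem_cliqueFinset_iff] at ht
      rw [← Finset.card_eq_one]
      have := Finset.card_sdiff_add_card_inter t R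
      have := ht.1.card_eq
      omega
    refine Finset.card_le_card_of_injOn (fun t => t ∩ R) ?_ ?_
    · intro t ht
      rw [Finset.mem_coe, Finset.mem_filter] at ht
      exact Finset.mem_coe.2 (Finset.mem_powersetCard.2 ⟨Finset.inter_subset_right, ht.2⟩)
    · intro t ht t' ht' htt'
      obtain ⟨x, hx⟩ := hsingle t ht
      obtain ⟨y, hy⟩ := hsingle t' ht'
      rw [Finset.mem_coe, Finset.mem_filter, mem_cliqueFinset_iff] at ht ht'
      obtain ⟨r, s, hrs, hrsR⟩ := Finset.card_eq_two.1 ht.2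
      have htt'' : t ∩ R = t' ∩ R := htt'
      have hrsR' : t' ∩ R = {r, s} := htt''.symm.trans hrsR
      have hxt : x ∈ t \ R := by simp [hx]
      have hyt : y ∈ t' \ R := by simp [hy]
      have hrt : r ∈ t ∩ R := by simp [hrsR]
      have hst : s ∈ t ∩ R := by simp [hrsR]
      have hrt' : r ∈ t' ∩ R := by simp [hrsR']
      have hst' : s ∈ t' ∩ R := by simp [hrsR']
      rw [Finset.mem_sdiff] at hxt hyt
      rw [Finset.mem_inter] at hrt hst hrt' hst'
      have hrx : r ≠ x := fun he => hxt.2 (he ▸ hrt.2)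
      have hsx : s ≠ x := fun he => hxt.2 (he ▸ hst.2)
      have hry : r ≠ y := fun he => hyt.2 (he ▸ hrt.2)
      have hsy : s ≠ y := fun he => hyt.2 (he ▸ hst.2)
      have arx := ht.1.isClique hrt.1 hxt.1 hrx
      have asx := ht.1.isClique hst.1 hxt.1 hsx
      have ary := ht'.1.isClique hrt'.1 hyt.1 hry
      have ars := ht.1.isClique hrt.1 hst.1 hrs
      have hxy : x = y := by
        obtain ⟨i, hi⟩ := exists_mem_of_notMem_compl hxt.2
        obtain ⟨j, hj⟩ := exists_mem_of_notMem_compl hyt.2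
        rcases Bool.eq_or_eq_not j i with rfl | rfl
        · exact h.eq_of_adj hk hM hG hi hj ars asx ary hrx hsy
        · exact absurd ary (h.not_adj_both hk hM hG hi hj arx)
      rw [← Finset.sdiff_union_inter t R, ← Finset.sdiff_union_inter t' R, hx, hy, htt'', hxy]
  rw [Finset.card_powersetCard] at hle
  exact hle.trans (Nat.choose_le_pow _ _)

lemma card_cliqueFinset_three_le (h : IsRichPair G C S M) (hk : 2 ≤ k) (hM : 2 * k + 4 ≤ M)
    (hG : ¬ Contains G (cycleGraph (2 * k + 1))) :
    (G.cliqueFinset 3).card ≤ (8 * k + 1) * (S false ∪ S true)ᶜ.card ^ 2 := by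
  classical
  set R := (S false ∪ S true)ᶜ with hR
  let K : SimpleGraph V :=
    { Adj := fun u v => G.Adj u v ∧ u ∈ R ∧ v ∈ R
      symm := ⟨fun _ _ ⟨h, hu, hv⟩ => ⟨h.symm, hv, hu⟩⟩
      loopless := ⟨fun _ h => h.1.ne rfl⟩ }
  have hKG : K ≤ G := fun _ _ h => h.1
  have hKe : K.edgeFinset.card ≤ R.card ^ 2 := by
    have hsub : K.edgeFinset ⊆ (R ×ˢ R).image fun p => s(p.1, p.2) := by
      intro e
      induction e with | h x y => ?_
      intro hxy
      rw [mem_edgeFinset, mem_edgeSet] at hxy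
      exact Finset.mem_image.2 ⟨(x, y), Finset.mem_product.2 hxy.2, rfl⟩
    refine (Finset.card_le_card hsub).trans (Finset.card_image_le.trans ?_)
    rw [Finset.card_product, sq]
  have hsub : G.cliqueFinset 3 ⊆ K.cliqueFinset 3 ∪
      (G.cliqueFinset 3).filter fun t => (t ∩ R).card = 2 := by
    intro t ht
    rw [Finset.mem_union, Finset.mem_filter]
    have ht' := ht
    rw [mem_cliqueFinset_iff, is3Clique_iff] at ht'
    obtain ⟨a, b, c, hab, hac, hbc, rfl⟩ := ht'
    have h1 := h.mem_compl_or_mem_compl hk hM hG hab hac.symm hbc.symm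
    have h2 := h.mem_compl_or_mem_compl hk hM hG hac hab.symm hbc
    have h3 := h.mem_compl_or_mem_compl hk hM hG hbc hab hac
    rw [← hR] at h1 h2 h3
    by_cases ha : a ∈ R
    · by_cases hb : b ∈ R
      · by_cases hc : c ∈ R
        · left
          rw [mem_cliqueFinset_iff, is3Clique_iff]
          exact ⟨a, b, c, ⟨hab, ha, hb⟩, ⟨hac, ha, hc⟩, ⟨hbc, hb, hc⟩, rfl⟩
        · right
          refine ⟨ht, ?_⟩
          simp [Finset.insert_inter_of_mem, ha, hb, hc, Finset.card_pair hab.ne]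
      · right
        have hc : c ∈ R := by tauto
        refine ⟨ht, ?_⟩
        simp [Finset.insert_inter_of_mem, ha, hb, hc, Finset.card_pair hac.ne]
    · right
      have hb : b ∈ R := by tauto
      have hc : c ∈ R := by tauto
      refine ⟨ht, ?_⟩
      simp [Finset.insert_inter_of_mem, ha, hb, hc, Finset.card_pair hbc.ne]
  have hKt := card_cliqueFinset_le (G := K) (by omega : 1 ≤ k) fun hK => hG (hK.mono hKG)
  calc (G.cliqueFinset 3).card
      ≤ (K.cliqueFinset 3).card + ((G.cliqueFinset 3).filter fun t => (t ∩ R).card = 2).card :=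
        (Finset.card_le_card hsub).trans (Finset.card_union_le _ _)
    _ ≤ 8 * k * R.card ^ 2 + R.card ^ 2 :=
        Nat.add_le_add (hKt.trans (Nat.mul_le_mul_left _ hKe))
          (h.card_filter_card_inter_eq_two_le hk hM hG)
    _ = (8 * k + 1) * R.card ^ 2 := by ring

lemma degree_le_of_mem_compl (h : IsRichPair G C (fun i => nearComplete G (C (!i))) M)
    (hk : 2 ≤ k) (hM : 2 * k + 4 ≤ M) (hG : ¬ Contains G (cycleGraph (2 * k + 1)))
    (hC : ∀ i, (Fintype.card V : ℝ) / 2 - Fintype.card V / 32 ≤ (C i).card) {r : V}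
    (hr : r ∈ (nearComplete G (C true) ∪ nearComplete G (C false))ᶜ) :
    (G.degree r : ℝ) ≤ (Fintype.card V : ℝ) / 2 - Fintype.card V / 32 := by
  simp only [Finset.mem_compl, Finset.mem_union, not_or, mem_nearComplete, not_le] at hr
  have hr' : ∀ i, (Fintype.card V : ℝ) / 16 < ((C i).filter fun y => ¬ G.Adj r y).card := by
    rintro (_ | _)
    exacts [hr.2, hr.1]
  obtain ⟨i, hi⟩ : ∃ i, ∀ x ∈ C i, ¬ G.Adj r x := by
    by_contra! hcon
    obtain ⟨x, hx, hrx⟩ := hcon false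
    obtain ⟨y, hy, hry⟩ := hcon true
    exact h.not_adj_both hk hM hG (h.subset _ hx) (h.subset _ hy) hrx hry
  have hd1 : Disjoint (C i) ((C (!i)).filter fun y => ¬ G.Adj r y) :=
    Finset.disjoint_of_subset_left (h.subset i) (Finset.disjoint_of_subset_right
      ((Finset.filter_subset _ _).trans (h.subset (!i))) (h.disjoint hk hM hG i))
  have hd2 : Disjoint (G.neighborFinset r) (C i ∪ (C (!i)).filter fun y => ¬ G.Adj r y) := by
    rw [Finset.disjoint_left]
    intro y hy hy'
    rw [mem_neighborFinset] at hy
    rw [Finset.mem_union, Finset.mem_filter] at hy'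
    rcases hy' with hy' | hy'
    · exact hi y hy' hy
    · exact hy'.2 hy
  have hcard : G.degree r + ((C i).card + ((C (!i)).filter fun y => ¬ G.Adj r y).card)
      ≤ Fintype.card V := by
    rw [← card_neighborFinset_eq_degree, ← Finset.card_union_of_disjoint hd1,
      ← Finset.card_union_of_disjoint hd2]
    exact Finset.card_le_univ _
  have hcard' : (G.degree r : ℝ) + ((C i).card + ((C (!i)).filter fun y => ¬ G.Adj r y).card)
      ≤ Fintype.card V := by exact_mod_cast hcard
  linarith [hr' (!i), hC i]

/-- A graph with a large rich core and at least `n ^ 2 / 4 - 1` edges and triangles is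
triangle-free. -/
lemma cliqueFree_three (h : IsRichPair G C (fun i => nearComplete G (C (!i))) M)
    (hk : 2 ≤ k) (hM : 2 * k + 4 ≤ M) (hG : ¬ Contains G (cycleGraph (2 * k + 1)))
    (hC : ∀ i, (Fintype.card V : ℝ) / 2 - Fintype.card V / 32 ≤ (C i).card) {ε : ℝ}
    (hε : ε * (8 * k + 2) ≤ 1 / 2048)
    (hR : ((C false ∪ C true)ᶜ.card : ℝ) ≤ 32 * ε * Fintype.card V)
    (hn : 64 < Fintype.card V)
    (hcount : (Fintype.card V : ℝ) ^ 2 / 4 - 1 ≤ G.edgeFinset.card + (G.cliqueFinset 3).card) :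
    G.CliqueFree 3 := by
  have he := h.card_edgeFinset_le hk hM hG
  have ht := h.card_cliqueFinset_three_le hk hM hG
  have hdisj := h.disjoint hk hM hG false
  have hdeg : ∀ r ∈ (nearComplete G (C true) ∪ nearComplete G (C false))ᶜ, (G.degree r : ℝ)
      ≤ (Fintype.card V : ℝ) / 2 - Fintype.card V / 32 :=
    fun r hr => h.degree_le_of_mem_compl hk hM hG hC hr
  have hsub : (nearComplete G (C true) ∪ nearComplete G (C false))ᶜ ⊆ (C false ∪ C true)ᶜ :=
    Finset.compl_subset_compl.2 (Finset.union_subset_union (h.subset false) (h.subset true))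
  simp only [Bool.not_false, Bool.not_true] at he ht hdisj
  set R := (nearComplete G (C true) ∪ nearComplete G (C false))ᶜ with hRdef
  set a := (nearComplete G (C true)).card
  set b := (nearComplete G (C false)).card
  have hsum : a + b + R.card = Fintype.card V := by
    rw [← Finset.card_union_of_disjoint hdisj, hRdef, Finset.card_add_card_compl]
  have hsum' : (a : ℝ) + b + R.card = Fintype.card V := by exact_mod_cast hsum
  have hdegsum : ∑ r ∈ R, (G.degree r : ℝ) ≤
      R.card * ((Fintype.card V : ℝ) / 2 - Fintype.card V / 32) := by
    rw [← nsmul_eq_mul]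
    exact Finset.sum_le_card_nsmul _ _ _ hdeg
  have he' : (G.edgeFinset.card : ℝ) ≤ a * b + ∑ r ∈ R, (G.degree r : ℝ) := by exact_mod_cast he
  have ht' : ((G.cliqueFinset 3).card : ℝ) ≤ (8 * k + 1) * (R.card : ℝ) ^ 2 := by
    exact_mod_cast ht
  have hR' : (R.card : ℝ) ≤ 32 * ε * Fintype.card V :=
    le_trans (by exact_mod_cast Finset.card_le_card hsub) hR
  have hRempty : R.card = 0 := by
    by_contra hne
    have hm : (1 : ℝ) ≤ R.card := by exact_mod_cast Nat.one_le_iff_ne_zero.2 hne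
    have hn' : (64 : ℝ) < Fintype.card V := by exact_mod_cast hn
    set n : ℝ := (Fintype.card V : ℝ)
    set m : ℝ := (R.card : ℝ)
    have hab : (a : ℝ) * b ≤ (n - m) ^ 2 / 4 := by
      rw [show n - m = a + b by linarith]
      nlinarith [sq_nonneg ((a : ℝ) - b)]
    have hk0 : (0 : ℝ) ≤ 8 * k + 2 := by positivity
    have h1 : (8 * k + 2) * m ≤ n / 64 := by
      calc (8 * k + 2) * m ≤ (8 * k + 2) * (32 * ε * n) := by gcongr
        _ = (ε * (8 * k + 2)) * (32 * n) := by ring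
        _ ≤ (1 / 2048) * (32 * n) := by gcongr
        _ = n / 64 := by ring
    have h2 : (8 * k + 2) * m * m ≤ n / 64 * m := by gcongr
    nlinarith
  rw [Finset.card_eq_zero] at hRempty
  intro t hclique
  rw [is3Clique_iff] at hclique
  obtain ⟨x, y, w, hxy, hxw, hyw, -⟩ := hclique
  have := h.mem_compl_or_mem_compl hk hM hG hxy hxw.symm hyw.symm
  simp only [Bool.not_false, Bool.not_true, ← hRdef, hRempty] at this
  simp at this

end IsRichPair

lemma nonempty_iso_turanGraph_of_cliqueFree {V : Type*} [Fintype V] {G : SimpleGraph V}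
    [DecidableRel G.Adj] (hG : G.CliqueFree 3)
    (he : G.edgeFinset.card = Fintype.card V ^ 2 / 4) :
    Nonempty (G ≃g turanGraph (Fintype.card V) 2) := by
  refine IsTuranMaximal.nonempty_iso_turanGraph ⟨hG, fun H _ hH => ?_⟩
  have h1 := hH.card_edgeFinset_le
  rw [he]
  refine h1.trans ?_
  rcases Nat.mod_two_eq_zero_or_one (Fintype.card V) with h | h
  · simp [h]
  · simp only [h]
    simp
    omega

lemma edgeCount_eq {V : Type*} [Fintype V] [DecidableEq V] (G : SimpleGraph V)
    [DecidableRel G.Adj] : edgeCount G = G.edgeFinset.card := by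
  rw [edgeCount, ← coe_edgeFinset, Set.ncard_coe_finset]

lemma triangleCount_eq {V : Type*} [Fintype V] [DecidableEq V] (G : SimpleGraph V)
    [DecidableRel G.Adj] : triangleCount G = (G.cliqueFinset 3).card := by
  rw [triangleCount, ← coe_cliqueFinset, Set.ncard_coe_finset]

lemma cliqueFree_three_of_not_contains {V : Type*} {G : SimpleGraph V}
    (hG : ¬ Contains G (cycleGraph 3)) : G.CliqueFree 3 := by
  classical
  intro t ht
  rw [is3Clique_iff] at ht
  obtain ⟨a, b, c, hab, hac, hbc, -⟩ := ht
  exact hG (contains_cycleGraph_of_isPath le_rfl (.cons hab (.cons hbc .nil))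
    (by simp [hab.ne, hac.ne, hbc.ne]) rfl hac.symm)

/-- For large `n`, a `C_{2k+1}`-free graph with `n ^ 2 / 4` edges and triangles is triangle-free. -/
lemma exists_cliqueFree_three {k : ℕ} (hk : 2 ≤ k) : ∃ n₀ : ℕ, ∀ (V : Type) [Fintype V]
    [DecidableEq V] (G : SimpleGraph V) [DecidableRel G.Adj], n₀ ≤ Fintype.card V →
    ¬ Contains G (cycleGraph (2 * k + 1)) →
    G.edgeFinset.card + (G.cliqueFinset 3).card = Fintype.card V ^ 2 / 4 → G.CliqueFree 3 := by
  classical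
  have hkr : (2 : ℝ) ≤ k := by exact_mod_cast hk
  set ε : ℝ := 1 / (2048 * (8 * k + 2)) with hε
  set δ : ℝ := ε / (2 * (8 * k + 2)) with hδ
  have hεpos : 0 < ε := by positivity
  have hδpos : 0 < δ := by positivity
  have hδε : 2 * ((8 * k + 2) * δ) = ε := by rw [hδ]; field_simp
  have hεk : ε * (8 * k + 2) = 1 / 2048 := by rw [hε]; field_simp
  have hε' : ε ≤ 1 / 16384 := by nlinarith
  obtain ⟨n₀, hn₀⟩ := exists_card_edgeFinset_triangleGraph_le hk hδpos
  obtain ⟨n₁, hn₁⟩ := exists_nat_gt (1 / δ)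
  refine ⟨max (max n₀ n₁) (8 * (2 * k + 4) + 64), fun V _ _ G _ hn hG hcount => ?_⟩
  simp only [max_le_iff] at hn
  have hn0 : 0 < Fintype.card V := by omega
  have : Nonempty V := Fintype.card_pos_iff.1 hn0
  have hfloor : (Fintype.card V : ℝ) ^ 2 / 4 - 1 ≤ G.edgeFinset.card + (G.cliqueFinset 3).card := by
    have h1 : Fintype.card V ^ 2 ≤ 4 * (G.edgeFinset.card + (G.cliqueFinset 3).card) + 4 := by
      rw [hcount]; omega
    have h2 : (Fintype.card V : ℝ) ^ 2 ≤
        4 * (G.edgeFinset.card + (G.cliqueFinset 3).card) + 4 := by exact_mod_cast h1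
    linarith
  have hT := hn₀ V G hn.1.1 hG
  have htri : ((G.cliqueFinset 3).card : ℝ) ≤ 8 * k * (triangleGraph G).edgeFinset.card := by
    exact_mod_cast (Finset.card_le_card cliqueFinset_triangleGraph).trans
      (card_cliqueFinset_le (by omega) fun h => hG (h.mono (triangleGraph_le G)))
  obtain ⟨A, hA⟩ := exists_cut_of_cliqueFree_three (cliqueFree_sdiff_triangleGraph (G := G))
  have hedge : (G.edgeFinset.card : ℝ) ≤ (G \ triangleGraph G).edgeFinset.card +
      (triangleGraph G).edgeFinset.card := by
    have hsub : G.edgeFinset ⊆ (G \ triangleGraph G).edgeFinset ∪ (triangleGraph G).edgeFinset := by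
      intro e
      simp only [Finset.mem_union, mem_edgeFinset, edgeSet_sdiff, Set.mem_sdiff]
      tauto
    exact_mod_cast (Finset.card_le_card hsub).trans (Finset.card_union_le _ _)
  have hcutle : ∑ x ∈ A, ((Aᶜ.filter ((G \ triangleGraph G).Adj x)).card : ℝ) ≤
      ∑ x ∈ A, ((Aᶜ.filter (G.Adj x)).card : ℝ) := by
    gcongr with x hx y hy
    exact fun h => h.1
  have hone : 1 ≤ δ * (Fintype.card V : ℝ) ^ 2 := by
    have h1 : 1 / δ ≤ Fintype.card V := hn₁.le.trans (by exact_mod_cast hn.1.2)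
    have h2 : (1 : ℝ) ≤ Fintype.card V := by exact_mod_cast hn0
    rw [div_le_iff₀ hδpos] at h1
    nlinarith
  obtain ⟨C, hrich, hC, hR⟩ := exists_isRichPair_of_cut (G := G) A (ε := ε) (M := 2 * k + 4) hε'
    (by omega) hn0 (by
      have h1 : (8 * k + 1) * ((triangleGraph G).edgeFinset.card : ℝ) ≤
          (8 * k + 1) * (δ * (Fintype.card V : ℝ) ^ 2) := by gcongr
      have h2 : (Fintype.card V : ℝ) ^ 2 / 4 - 1 ≤ (G \ triangleGraph G).edgeFinset.card +
          (8 * k + 1) * ((triangleGraph G).edgeFinset.card : ℝ) := by linarith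
      have h3 : ε * (Fintype.card V : ℝ) ^ 2 =
          2 * (8 * k + 1) * (δ * (Fintype.card V : ℝ) ^ 2) + 2 * (δ * (Fintype.card V : ℝ) ^ 2) := by
        rw [← hδε]; ring
      have h4 : 2 * ((G \ triangleGraph G).edgeFinset.card : ℝ) ≤ (Fintype.card V : ℝ) ^ 2 / 4 +
          ∑ x ∈ A, ((Aᶜ.filter ((G \ triangleGraph G).Adj x)).card : ℝ) := by convert hA
      have h5 : (Fintype.card V : ℝ) ^ 2 / 4 - ε * (Fintype.card V : ℝ) ^ 2 ≤
          ∑ x ∈ A, ((Aᶜ.filter (G.Adj x)).card : ℝ) := by linarith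
      convert h5)
  exact hrich.cliqueFree_three hk le_rfl hG hC hεk.le hR (by omega) hfloor

/-- For `n` sufficiently large, a `C_{2k+1}`-free graph on `n` vertices with
`e(G) + t(G) = ⌊n²/4⌋` is isomorphic to the Turán graph `T_2(n)`. -/
theorem stmt_6 (k : ℕ) (hk : 1 ≤ k) :
    ∃ n₀ : ℕ, ∀ n : ℕ, n₀ ≤ n →
      ∀ (V : Type) [Fintype V] (G : SimpleGraph V), Fintype.card V = n →
        ¬ Contains G (cycleGraph (2 * k + 1)) →
        edgeCount G + triangleCount G = n ^ 2 / 4 →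
        Nonempty (G ≃g turanGraph n 2) := by
  classical
  obtain ⟨n₀, hn₀⟩ : ∃ n₀ : ℕ, ∀ (V : Type) [Fintype V] [DecidableEq V] (G : SimpleGraph V)
      [DecidableRel G.Adj], n₀ ≤ Fintype.card V → ¬ Contains G (cycleGraph (2 * k + 1)) →
      G.edgeFinset.card + (G.cliqueFinset 3).card = Fintype.card V ^ 2 / 4 → G.CliqueFree 3 := by
    rcases hk.eq_or_lt with rfl | hk
    · exact ⟨0, fun V _ _ G _ _ hG _ => cliqueFree_three_of_not_contains hG⟩
    · exact exists_cliqueFree_three hk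
  refine ⟨n₀, fun n hn V _ G hV hG hcount => ?_⟩
  subst hV
  rw [edgeCount_eq, triangleCount_eq] at hcount
  have hfree := hn₀ V G hn hG hcount
  refine nonempty_iso_turanGraph_of_cliqueFree hfree ?_
  rwa [cliqueFinset_eq_empty_iff.2 hfree, Finset.card_empty, add_zero] at hcount
end

section
/- Let k ≥ 1 and let G be a C_{2k+1}-free graph. Then for every vertex v of G, the subgraph of G induced on the neighborhood N(v) contains no path on 2k vertices; consequently, the number of triangles of G containing v is at most (k−1)·d(v), where d(v) is the degree of v. -/
open SimpleGraph

open Finset in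
/-- Let `l` be a path inside `S` that starts at `x` and ends at `y`, and that contains all the
neighbours of `x` and of `y` in `S`. If the degrees of `x` and `y` in `S` add up to at least
`l.length`, then the vertices of `l` can be arranged in a cycle. -/
theorem SimpleGraph.exists_isChain_cycle {V : Type*} [DecidableEq V] (G : SimpleGraph V)
    [DecidableRel G.Adj] (S : Finset V) (l : List V) (hl : l ≠ []) (hchain : l.IsChain G.Adj)
    (hhead : ∀ w ∈ S, G.Adj (l.head hl) w → w ∈ l)
    (hlast : ∀ w ∈ S, G.Adj (l.getLast hl) w → w ∈ l)
    (hdeg : l.length ≤ #{w ∈ S | G.Adj (l.head hl) w} + #{w ∈ S | G.Adj (l.getLast hl) w}) :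
    ∃ c : List V, c.Perm l ∧ c.IsChain G.Adj ∧
      ∀ a ∈ c.getLast?, ∀ b ∈ c.head?, G.Adj a b := by
  have hpos : 0 < l.length := List.length_pos_iff.2 hl
  set A : Finset ℕ :=
    {i ∈ range (l.length - 1) | ∃ h : i + 1 < l.length, G.Adj (l.head hl) l[i + 1]}
  set B : Finset ℕ := {i ∈ range (l.length - 1) | ∃ h : i < l.length, G.Adj (l.getLast hl) l[i]}
  have hA : #{w ∈ S | G.Adj (l.head hl) w} ≤ #A := by
    refine card_le_card_of_surjOn (fun i => l.getD (i + 1) (l.head hl)) ?_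
    intro w hw
    simp only [coe_filter, Set.mem_ofPred_eq] at hw
    obtain ⟨i, hi, rfl⟩ := List.mem_iff_getElem.1 (hhead w hw.1 hw.2)
    rcases i with _ | i
    · simp [List.head_eq_getElem] at hw
    · refine ⟨i, ?_, by simp [hi]⟩
      simp only [A, coe_filter, Set.mem_ofPred_eq, mem_range]
      exact ⟨by omega, hi, hw.2⟩
  have hB : #{w ∈ S | G.Adj (l.getLast hl) w} ≤ #B := by
    refine card_le_card_of_surjOn (fun i => l.getD i (l.head hl)) ?_
    intro w hw
    simp only [coe_filter, Set.mem_ofPred_eq] at hw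
    obtain ⟨i, hi, rfl⟩ := List.mem_iff_getElem.1 (hlast w hw.1 hw.2)
    refine ⟨i, ?_, by simp [hi]⟩
    have hne : i ≠ l.length - 1 := by
      rintro rfl
      simp [List.getLast_eq_getElem] at hw
    simp only [B, coe_filter, Set.mem_ofPred_eq, mem_range]
    exact ⟨by omega, hi, hw.2⟩
  have hinter : (A ∩ B).Nonempty := by
    rw [← card_pos]
    have hunion : #(A ∪ B) ≤ #(range (l.length - 1)) :=
      card_le_card (union_subset (filter_subset _ _) (filter_subset _ _))
    have := card_union_add_card_inter A B
    rw [card_range] at hunion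
    omega
  obtain ⟨i, hi⟩ := hinter
  simp only [A, B, mem_inter, mem_filter, mem_range] at hi
  obtain ⟨⟨hi, hi', hx⟩, -, hi'', hy⟩ := hi
  have hsplit : l = l.take (i + 1) ++ l.drop (i + 1) := (List.take_append_drop _ _).symm
  have htake : l.take (i + 1) ≠ [] := by simp [hl]
  have hdrop : l.drop (i + 1) ≠ [] := by simp; omega
  have hc := hchain
  rw [hsplit, List.isChain_append] at hc
  refine ⟨l.take (i + 1) ++ (l.drop (i + 1)).reverse, ?_, ?_, ?_⟩
  · conv_rhs => rw [hsplit]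
    exact (List.reverse_perm _).append_left _
  · refine List.isChain_append.2 ⟨hc.1, ?_, ?_⟩
    · rw [List.isChain_reverse]
      exact hc.2.1.imp fun _ _ h => h.symm
    · intro a ha b hb
      obtain rfl : l[i] = a := by simpa [List.getLast?_take, hi''] using ha
      obtain rfl : l.getLast hl = b := by
        simpa [List.getLast?_drop, List.getLast?_eq_getLast_of_ne_nil hl, not_le.2 hi'] using hb
      exact hy.symm
  · intro a ha b hb
    obtain rfl : l[i + 1] = a := by
      rw [List.getLast?_append_of_ne_nil _ (by simpa using hdrop), List.getLast?_reverse] at ha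
      simpa [hi'] using ha
    obtain rfl : l.head hl = b := by
      rw [List.head?_append_of_ne_nil _ htake] at hb
      simpa [List.head?_take, List.head?_eq_some_head hl] using hb
    exact hx.symm

open Finset in
/-- A nonempty finite set of vertices containing no path on `2 * k` vertices either has a vertex
of degree less than `k`, or contains a nonempty union of components having less than `2 * k`
vertices. -/
theorem SimpleGraph.exists_small_degree_or_small_component {V : Type*} [DecidableEq V]
    (G : SimpleGraph V) [DecidableRel G.Adj] (k : ℕ) (S : Finset V) (hS : S.Nonempty)
    (hpath : ∀ l : List V, l.Nodup → l.IsChain G.Adj → (∀ x ∈ l, x ∈ S) → l.length < 2 * k) :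
    (∃ x ∈ S, #{w ∈ S | G.Adj x w} < k) ∨
      ∃ T ⊆ S, T.Nonempty ∧ #T < 2 * k ∧ ∀ x ∈ T, ∀ y ∈ S, G.Adj x y → y ∈ T := by
  by_contra! hcon
  obtain ⟨hdeg, hcomp⟩ := hcon
  let P : ℕ → Prop := fun n =>
    ∃ l : List V, l.Nodup ∧ l.IsChain G.Adj ∧ (∀ x ∈ l, x ∈ S) ∧ l.length = n
  obtain ⟨x₀, hx₀⟩ := hS
  have hP1 : P 1 := ⟨[x₀], by simp, by simp, by simpa using hx₀, rfl⟩
  classical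
  have hbound : ∀ n, P n → n ≤ 2 * k := by
    rintro n ⟨l, h1, h2, h3, rfl⟩
    exact (hpath l h1 h2 h3).le
  obtain ⟨l, hnodup, hchain, hmem, hlen⟩ : P (Nat.findGreatest P (2 * k)) :=
    Nat.findGreatest_spec (hbound 1 hP1) hP1
  have hmax : ∀ l' : List V, l'.Nodup → l'.IsChain G.Adj → (∀ x ∈ l', x ∈ S) →
      l'.length ≤ l.length := by
    intro l' h1 h2 h3
    have hP : P l'.length := ⟨l', h1, h2, h3, rfl⟩
    exact hlen ▸ Nat.le_findGreatest (hbound _ hP) hP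
  have hl : l ≠ [] := by
    rintro rfl
    simpa using hmax [x₀] (by simp) (by simp) (by simpa using hx₀)
  have hextend : ∀ l' : List V, l'.Perm l → l'.IsChain G.Adj →
      ∀ x ∈ l'.head?, ∀ w ∈ S, G.Adj x w → w ∈ l := by
    intro l' hperm hchain' x hx w hw hadj
    by_contra hwl
    have hlen' := hmax (w :: l')
      (List.nodup_cons.2 ⟨by rwa [hperm.mem_iff], hperm.nodup_iff.2 hnodup⟩)
      (List.isChain_cons.2 ⟨by
        intro y hy
        obtain rfl : x = y := Option.mem_unique hx hy
        exact hadj.symm, hchain'⟩)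
      (by
        intro y hy
        rcases List.mem_cons.1 hy with rfl | hy
        · exact hw
        · exact hmem y (hperm.mem_iff.1 hy))
    simp [hperm.length_eq] at hlen'
  have hhead : ∀ w ∈ S, G.Adj (l.head hl) w → w ∈ l :=
    hextend l (List.Perm.refl l) hchain _ (List.head_mem_head? hl)
  have hlast : ∀ w ∈ S, G.Adj (l.getLast hl) w → w ∈ l :=
    hextend l.reverse l.reverse_perm
      (by
        rw [List.isChain_reverse]
        exact hchain.imp fun _ _ h => h.symm) _
      (by rw [List.head?_reverse]; exact List.getLast_mem_getLast? hl)
  have hlt := hpath l hnodup hchain hmem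
  obtain ⟨c, hperm, hcchain, hclose⟩ := G.exists_isChain_cycle S l hl hchain hhead hlast (by
    have := hdeg _ (hmem _ (List.head_mem hl))
    have := hdeg _ (hmem _ (List.getLast_mem hl))
    omega)
  obtain ⟨x, hx, y, hy, hadj, hyl⟩ := hcomp l.toFinset
    (fun x hx => hmem x (List.mem_toFinset.1 hx)) (by simpa using hl)
    (by rwa [List.toFinset_card_of_nodup hnodup])
  apply hyl
  rw [List.mem_toFinset] at hx ⊢
  obtain ⟨d, e, rfl⟩ := List.append_of_mem (hperm.mem_iff.2 hx)
  rw [List.isChain_append] at hcchain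
  refine hextend ((x :: e) ++ d) (List.perm_append_comm.trans hperm) ?_ x (by simp) y hy hadj
  refine List.isChain_append.2 ⟨hcchain.2.1, hcchain.1, ?_⟩
  intro a ha b hb
  refine hclose a ?_ b ?_
  · rwa [List.getLast?_append_of_ne_nil _ (by simp)]
  · rwa [List.head?_append_of_ne_nil _ (by rintro rfl; simp at hb)]

open Finset in
/-- The Erdős–Gallai bound for paths on `2 * k` vertices: if a finite set `S` of vertices contains
no such path, then at most `2 * (k - 1) * #S` ordered pairs of vertices of `S` are adjacent. -/
theorem SimpleGraph.card_adj_pairs_le_of_no_path {V : Type*} [DecidableEq V]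
    (G : SimpleGraph V) [DecidableRel G.Adj] (k : ℕ) (S : Finset V)
    (hpath : ∀ l : List V, l.Nodup → l.IsChain G.Adj → (∀ x ∈ l, x ∈ S) → l.length < 2 * k) :
    #{p ∈ S ×ˢ S | G.Adj p.1 p.2} ≤ 2 * ((k - 1) * #S) := by
  induction S using Finset.strongInduction with
  | H S ih =>
    rcases S.eq_empty_or_nonempty with rfl | hS
    · simp
    have hrec : ∀ T ⊆ S, T.Nonempty →
        #{p ∈ (S \ T) ×ˢ (S \ T) | G.Adj p.1 p.2} ≤ 2 * ((k - 1) * (#S - #T)) := by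
      intro T hT hne
      rw [← card_sdiff_of_subset hT]
      exact ih _ (sdiff_ssubset hT hne) fun l h1 h2 h3 =>
        hpath l h1 h2 fun x hx => (mem_sdiff.1 (h3 x hx)).1
    rcases G.exists_small_degree_or_small_component k S hS hpath with
      ⟨x, hx, hdeg⟩ | ⟨T, hT, hne, hcard, hclosed⟩
    · have h := hrec {x} (by simpa using hx) (by simp)
      have hsub : ({p ∈ S ×ˢ S | G.Adj p.1 p.2} : Finset (V × V)) ⊆
          {p ∈ (S \ {x}) ×ˢ (S \ {x}) | G.Adj p.1 p.2} ∪
            (({w ∈ S | G.Adj x w}.image fun w => (x, w)) ∪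
              ({w ∈ S | G.Adj x w}.image fun w => (w, x))) := by
        rintro ⟨a, b⟩ hab
        simp only [mem_filter, mem_product, mem_union, mem_image, mem_sdiff, mem_singleton,
          Prod.mk.injEq] at hab ⊢
        have := hab.2.symm
        grind
      have h1 := card_le_card hsub
      have h2 := card_union_le {p ∈ (S \ {x}) ×ˢ (S \ {x}) | G.Adj p.1 p.2}
        (({w ∈ S | G.Adj x w}.image fun w => (x, w)) ∪
              ({w ∈ S | G.Adj x w}.image fun w => (w, x)))
      have h3 := card_union_le ({w ∈ S | G.Adj x w}.image fun w => (x, w))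
              ({w ∈ S | G.Adj x w}.image fun w => (w, x))
      have h4 := card_image_le (s := {w ∈ S | G.Adj x w}) (f := fun w => (x, w))
      have h5 := card_image_le (s := {w ∈ S | G.Adj x w}) (f := fun w => (w, x))
      obtain ⟨m, hm⟩ : ∃ m, #S = m + 1 := ⟨#S - 1, by have := hS.card_pos; omega⟩
      rw [card_singleton, hm, Nat.add_sub_cancel] at h
      rw [hm, mul_add]
      omega
    · have h := hrec T hT hne
      have hsub : ({p ∈ S ×ˢ S | G.Adj p.1 p.2} : Finset (V × V)) ⊆
          {p ∈ (S \ T) ×ˢ (S \ T) | G.Adj p.1 p.2} ∪ T.offDiag := by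
        rintro ⟨a, b⟩ hab
        simp only [mem_filter, mem_product, mem_union, mem_sdiff, mem_offDiag] at hab ⊢
        have h1 := hclosed a
        have h2 := hclosed b
        have := hab.2.symm
        have := hab.2.ne
        grind
      have h1 := card_le_card hsub
      have h2 := card_union_le {p ∈ (S \ T) ×ˢ (S \ T) | G.Adj p.1 p.2} T.offDiag
      have h3 : #T.offDiag ≤ 2 * ((k - 1) * #T) := by
        rw [offDiag_card, ← Nat.mul_sub_one, mul_comm, ← mul_assoc]
        exact Nat.mul_le_mul_right _ (by omega)
      obtain ⟨m, hm⟩ := Nat.exists_eq_add_of_le (card_le_card hT)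
      rw [hm, Nat.add_sub_cancel_left] at h
      rw [hm, mul_add]
      omega

/-- A path on `n` vertices in the neighbourhood of `v` yields a cycle on `n + 1` vertices. -/
theorem Contains.cycleGraph_of_pathGraph_neighborSet {V : Type*} {G : SimpleGraph V} {v : V}
    {n : ℕ} (hn : 1 ≤ n) (h : Contains (G.induce (G.neighborSet v)) (pathGraph n)) :
    Contains G (cycleGraph (n + 1)) := by
  obtain ⟨f, hinj, hadj⟩ := h
  have hv : ∀ i, G.Adj v (f i) := fun i => (f i).2
  refine ⟨Fin.cons v fun i => (f i : V), ?_, ?_⟩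
  · refine Fin.cons_injective_iff.2 ⟨?_, Subtype.val_injective.comp hinj⟩
    rintro ⟨i, hi⟩
    exact (hv i).ne hi.symm
  · obtain ⟨m, rfl⟩ := Nat.exists_eq_add_of_le' hn
    intro i j hij
    have hij' := hij
    rw [cycleGraph_adj'] at hij'
    induction i using Fin.cases with
    | zero =>
      induction j using Fin.cases with
      | zero => exact absurd rfl hij.ne
      | succ j => exact hv j
    | succ i =>
      induction j using Fin.cases with
      | zero => exact (hv i).symm
      | succ j =>
        simp only [Fin.cons_succ]
        refine hadj (i := i) (j := j) (pathGraph_adj.2 ?_)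
        have hi := i.isLt
        have hj := j.isLt
        simp only [Fin.val_sub, Fin.val_succ] at hij'
        rcases hij' with h | h
        · right
          rcases lt_or_ge i.val j.val with hlt | hge
          · rw [Nat.mod_eq_of_lt (by omega)] at h
            omega
          · rw [Nat.mod_eq_sub_mod (by omega), Nat.mod_eq_of_lt (by omega)] at h
            omega
        · left
          rcases lt_or_ge j.val i.val with hlt | hge
          · rw [Nat.mod_eq_of_lt (by omega)] at h
            omega
          · rw [Nat.mod_eq_sub_mod (by omega), Nat.mod_eq_of_lt (by omega)] at h
            omega

/-- A list of distinct vertices of `s`, consecutive ones adjacent, with at least `n` entries,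
yields a path on `n` vertices in the subgraph induced on `s`. -/
theorem contains_pathGraph_of_isChain {V : Type*} {G : SimpleGraph V} {s : Set V} {n : ℕ}
    (l : List V) (hnodup : l.Nodup) (hchain : l.IsChain G.Adj) (hmem : ∀ x ∈ l, x ∈ s)
    (hn : n ≤ l.length) : Contains (G.induce s) (pathGraph n) := by
  refine ⟨fun i => ⟨l[i.val], hmem _ (List.getElem_mem _)⟩, ?_, ?_⟩
  · intro i j hij
    exact Fin.ext ((hnodup.getElem_inj_iff).1 (congrArg Subtype.val hij))
  · intro i j hij
    have hi := i.isLt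
    have hj := j.isLt
    rw [List.isChain_iff_getElem] at hchain
    simp only [comap_adj, Function.Embedding.subtype_apply]
    rcases pathGraph_adj.1 hij with h | h
    · have := hchain i.val (by omega)
      simpa only [h] using this
    · have := hchain j.val (by omega)
      simpa only [h] using this.symm

open Finset in
/-- Each triangle at `v` gives two ordered pairs of adjacent neighbours of `v`. -/
theorem SimpleGraph.two_mul_ncard_triangles_le {V : Type*} [Fintype V] [DecidableEq V]
    (G : SimpleGraph V) [DecidableRel G.Adj] (v : V) :
    2 * {t ∈ G.cliqueSet 3 | v ∈ t}.ncard ≤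
      #{p ∈ G.neighborFinset v ×ˢ G.neighborFinset v | G.Adj p.1 p.2} := by
  have hset : {t ∈ G.cliqueSet 3 | v ∈ t} =
      (({t ∈ G.cliqueFinset 3 | v ∈ t} : Finset (Finset V)) : Set (Finset V)) := by
    ext t
    simp [mem_cliqueSet_iff, mem_cliqueFinset_iff]
  rw [hset, Set.ncard_coe_finset, mul_comm]
  refine (card_nsmul_le_sum _ (fun t => #{p ∈ {p ∈ G.neighborFinset v ×ˢ G.neighborFinset v |
    G.Adj p.1 p.2} | {v, p.1, p.2} = t}) 2 ?_).trans ?_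
  · intro t ht
    simp only [mem_filter, mem_cliqueFinset_iff] at ht
    obtain ⟨htri, hvt⟩ := ht
    have hcard : #(t.erase v) = 2 := by rw [card_erase_of_mem hvt, htri.card_eq]
    obtain ⟨a, b, hab, hE⟩ := card_eq_two.1 hcard
    obtain rfl : {v, a, b} = t := by rw [← hE, insert_erase hvt]
    obtain ⟨hva, hvb, hadj⟩ := is3Clique_triple_iff.1 htri
    rw [← card_pair (a := (a, b)) (b := (b, a)) (by simp [hab])]
    refine card_le_card ?_
    simp [insert_subset_iff, hva, hvb, hadj, hadj.symm, pair_comm b a]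
  · rw [sum_card_fiberwise_eq_card_filter]
    exact card_filter_le _ _

/-- In a `C_{2k+1}`-free graph, the subgraph induced on any neighbourhood `N(v)` contains
no path on `2k` vertices; consequently the number of triangles containing `v` is at most
`(k−1)·d(v)`. -/
theorem stmt_7 (k : ℕ) (hk : 1 ≤ k) {V : Type*} [Fintype V] (G : SimpleGraph V)
    (hfree : ¬ Contains G (cycleGraph (2 * k + 1))) (v : V) :
    ¬ Contains (G.induce (G.neighborSet v)) (pathGraph (2 * k)) ∧
    {t ∈ G.cliqueSet 3 | v ∈ t}.ncard ≤ (k - 1) * (G.neighborSet v).ncard := by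
  classical
  have hpath : ¬ Contains (G.induce (G.neighborSet v)) (pathGraph (2 * k)) := fun h =>
    hfree (h.cycleGraph_of_pathGraph_neighborSet (by omega))
  refine ⟨hpath, ?_⟩
  have hpairs := G.card_adj_pairs_le_of_no_path k (G.neighborFinset v) fun l h1 h2 h3 => by
    by_contra! hle
    exact hpath (contains_pathGraph_of_isChain l h1 h2 (fun x hx => by simpa using h3 x hx) hle)
  have htri := G.two_mul_ncard_triangles_le v
  rw [← coe_neighborFinset, Set.ncard_coe_finset]
  omega
end

section
/- Let k ≥ 1 and let G be a C_{2k+1}-free graph on n vertices with a vertex v. Then e(G−v) + t(G−v) ≥ e(G) + t(G) − k·d(v), where G−v is the graph obtained by deleting v. -/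
open SimpleGraph

/-- `l` is the vertex sequence of a path of `G` inside `S`. -/
def IsPathIn {V : Type*} (G : SimpleGraph V) (S : Finset V) (l : List V) : Prop :=
  l.IsChain G.Adj ∧ l.Nodup ∧ ∀ x ∈ l, x ∈ S

open Classical in
/-- The ordered pairs of adjacent vertices of `S`. -/
noncomputable def adjPairs {V : Type*} (G : SimpleGraph V) (S : Finset V) : Finset (V × V) :=
  (S ×ˢ S).filter fun p => G.Adj p.1 p.2

/-- The closing-up step: a path whose endpoints have crossing chords can be rearranged into a
spanning cycle of its vertex set. -/
theorem IsPathIn.exists_perm_cycle {V : Type*} {G : SimpleGraph V} {S : Finset V} {l : List V}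
    (hl : IsPathIn G S l) {i : ℕ} (hi : i + 1 < l.length) (h₀ : G.Adj l[0] l[i + 1])
    (h₁ : G.Adj l[i] l[l.length - 1]) :
    ∃ c : List V, c.Perm l ∧ c.IsChain G.Adj ∧
      ∀ x ∈ c.getLast?, ∀ y ∈ c.head?, G.Adj x y := by
  refine ⟨l.take (i + 1) ++ (l.drop (i + 1)).reverse, ?_, ?_, ?_⟩
  · conv_rhs => rw [← List.take_append_drop (i + 1) l]
    exact (List.reverse_perm _).append_left _
  · rw [List.isChain_append]
    refine ⟨hl.1.take _, ?_, ?_⟩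
    · rw [List.isChain_reverse]
      exact (hl.1.drop _).imp fun a b h => h.symm
    · intro x hx y hy
      rw [List.head?_reverse, List.getLast?_drop] at hy
      rw [List.getLast?_take] at hx
      simp [List.getLast?_eq_getElem?, show ¬ l.length ≤ i + 1 by omega] at hx hy
      grind
  · intro x hx y hy
    rw [List.getLast?_append, List.getLast?_reverse] at hx
    rw [List.head?_append, List.head?_take] at hy
    simp [List.head?_eq_getElem?] at hx hy
    have := h₀.symm
    grind

/-- Opening a cyclic sequence at a neighbour of an outside vertex `y` gives a path that is longer
by one. -/
theorem exists_isPathIn_of_cycle {V : Type*} {G : SimpleGraph V} {S : Finset V} {c : List V}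
    (hc : IsPathIn G S c) (hcyc : ∀ x ∈ c.getLast?, ∀ y ∈ c.head?, G.Adj x y)
    {x y : V} (hx : x ∈ c) (hy : y ∈ S) (hyc : y ∉ c) (hadj : G.Adj y x) :
    ∃ l, IsPathIn G S l ∧ l.length = c.length + 1 := by
  obtain ⟨s, t, rfl⟩ := List.append_of_mem hx
  refine ⟨y :: ((x :: t) ++ s), ⟨?_, ?_, ?_⟩, by simp; omega⟩
  · have h := List.isChain_append.1 hc.1
    rw [List.cons_append, List.isChain_cons_cons, ← List.cons_append, List.isChain_append]
    refine ⟨hadj, h.2.1, h.1, fun a ha b hb => hcyc a ?_ b ?_⟩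
    · rw [List.getLast?_append]; grind
    · rw [Option.mem_def] at hb ⊢
      simp [List.head?_append, hb]
  · have := hc.2.1
    rw [List.nodup_cons]
    refine ⟨by grind, List.nodup_append_comm.1 this⟩
  · have := hc.2.2
    grind

/-- In a longest path of `S`, the first vertex has no neighbour in `S` off the path. -/
theorem IsPathIn.mem_of_adj_head {V : Type*} {G : SimpleGraph V} {S : Finset V} {l : List V}
    (hl : IsPathIn G S l) (hmax : ∀ l', IsPathIn G S l' → l'.length ≤ l.length)
    (hpos : 0 < l.length) {y : V} (hy : y ∈ S) (hadj : G.Adj l[0] y) : y ∈ l := by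
  by_contra hyl
  have := hmax (y :: l) ⟨?_, ?_, ?_⟩
  · simp at this
  · rw [List.isChain_cons]
    refine ⟨?_, hl.1⟩
    have := hadj.symm
    intro z hz
    rw [List.head?_eq_getElem?] at hz
    grind
  · exact List.nodup_cons.2 ⟨hyl, hl.2.1⟩
  · have := hl.2.2
    grind

theorem IsPathIn.reverse {V : Type*} {G : SimpleGraph V} {S : Finset V} {l : List V}
    (hl : IsPathIn G S l) : IsPathIn G S l.reverse :=
  ⟨List.isChain_reverse.2 (hl.1.imp fun _ _ h => h.symm), List.nodup_reverse.2 hl.2.1,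
    fun x hx => hl.2.2 x (List.mem_reverse.1 hx)⟩

open Classical in
/-- If every vertex of `S` has more than `m` neighbours in `S`, a longest path of `S` with at most
`2 * m + 1` vertices spans a union of components of `S`. -/
theorem IsPathIn.mem_of_adj {V : Type*} {G : SimpleGraph V} {S : Finset V} {l : List V} {m : ℕ}
    (hl : IsPathIn G S l) (hmax : ∀ l', IsPathIn G S l' → l'.length ≤ l.length)
    (hpos : 0 < l.length) (hlen : l.length ≤ 2 * m + 1)
    (hdeg : ∀ x ∈ S, m + 1 ≤ (S.filter (G.Adj x)).card)
    {x y : V} (hx : x ∈ l) (hy : y ∈ S) (hadj : G.Adj x y) : y ∈ l := by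
  set A := (Finset.range (l.length - 1)).filter fun i => G.Adj l[0] (l.getD (i + 1) x)
  set B := (Finset.range (l.length - 1)).filter fun i => G.Adj l[l.length - 1] (l.getD i x)
  have hA : m + 1 ≤ A.card := by
    refine (hdeg l[0] (hl.2.2 _ (List.getElem_mem _))).trans ?_
    refine (Finset.card_le_card ?_).trans
      (Finset.card_image_le (s := A) (f := fun i => l.getD (i + 1) x))
    intro z hz
    rw [Finset.mem_filter] at hz
    obtain ⟨j, hj, rfl⟩ := List.getElem_of_mem (hl.mem_of_adj_head hmax hpos hz.1 hz.2)
    have hj0 : j ≠ 0 := by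
      rintro rfl
      exact G.loopless.irrefl _ hz.2
    obtain ⟨j, rfl⟩ := Nat.exists_eq_succ_of_ne_zero hj0
    refine Finset.mem_image.2 ⟨j, Finset.mem_filter.2 ⟨Finset.mem_range.2 (by omega), ?_⟩, ?_⟩
    · grind
    · grind
  have hB : m + 1 ≤ B.card := by
    refine (hdeg l[l.length - 1] (hl.2.2 _ (List.getElem_mem _))).trans ?_
    refine (Finset.card_le_card ?_).trans
      (Finset.card_image_le (s := B) (f := fun i => l.getD i x))
    intro z hz
    rw [Finset.mem_filter] at hz
    have hzl : z ∈ l.reverse := hl.reverse.mem_of_adj_head (by simpa using hmax)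
      (by simpa using hpos) hz.1 (by simpa using hz.2)
    obtain ⟨j, hj, rfl⟩ := List.getElem_of_mem (List.mem_reverse.1 hzl)
    have hj0 : j ≠ l.length - 1 := by
      rintro rfl
      exact G.loopless.irrefl _ hz.2
    refine Finset.mem_image.2 ⟨j, Finset.mem_filter.2 ⟨Finset.mem_range.2 (by omega), ?_⟩, ?_⟩
    · grind
    · grind
  obtain ⟨i, hi⟩ : (A ∩ B).Nonempty := by
    rw [← Finset.card_pos]
    have h₁ := Finset.card_union_add_card_inter A B
    have h₂ : (A ∪ B).card ≤ l.length - 1 := by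
      refine (Finset.card_le_card (Finset.union_subset (Finset.filter_subset _ _)
        (Finset.filter_subset _ _))).trans (by simp)
    omega
  rw [Finset.mem_inter, Finset.mem_filter, Finset.mem_filter, Finset.mem_range] at hi
  obtain ⟨⟨hi, h₀⟩, -, h₁⟩ := hi
  obtain ⟨c, hcl, hc, hcyc⟩ := hl.exists_perm_cycle (i := i) (by omega)
    (by grind) (by have := h₁.symm; grind)
  by_contra hyl
  obtain ⟨l', hl', hlen'⟩ := exists_isPathIn_of_cycle (S := S)
    ⟨hc, hcl.nodup_iff.2 hl.2.1, fun z hz => hl.2.2 z (hcl.mem_iff.1 hz)⟩ hcyc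
    (hcl.mem_iff.2 hx) hy (fun h => hyl (hcl.mem_iff.1 h)) hadj.symm
  have := hmax l' hl'
  have := hcl.length_eq
  omega

open Classical in
/-- The Erdős–Gallai bound: if `S` contains no path on `2 * m + 2` vertices, then it spans at most
`m * |S|` edges, each counted twice here. -/
theorem card_adjPairs_le {V : Type*} {G : SimpleGraph V} {m : ℕ} (S : Finset V)
    (hS : ∀ l, IsPathIn G S l → l.length ≠ 2 * m + 2) :
    (adjPairs G S).card ≤ 2 * m * S.card := by
  induction S using Finset.strongInduction with
  | H S ih =>
  have step : ∀ T ⊂ S, (adjPairs G T).card ≤ 2 * m * T.card := fun T hT =>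
    ih T hT fun l hl => hS l ⟨hl.1, hl.2.1, fun x hx => hT.1 (hl.2.2 x hx)⟩
  rcases S.eq_empty_or_nonempty with rfl | ⟨s, hs⟩
  · simp [adjPairs]
  by_cases hdeg : ∀ x ∈ S, m + 1 ≤ (S.filter (G.Adj x)).card
  · have hshort : ∀ l, IsPathIn G S l → l.length ≤ 2 * m + 1 := by
      intro l hl
      by_contra! hlong
      exact hS (l.take (2 * m + 2)) ⟨hl.1.take _, hl.2.1.sublist (List.take_sublist _ _),
        fun x hx => hl.2.2 x (List.mem_of_mem_take hx)⟩ (by simp; omega)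
    have hsing : IsPathIn G S [s] := ⟨by simp, by simp, by simpa using hs⟩
    obtain ⟨l, hl, hmax⟩ : ∃ l, IsPathIn G S l ∧ ∀ l', IsPathIn G S l' → l'.length ≤ l.length := by
      let P : ℕ → Prop := fun n => ∃ l, IsPathIn G S l ∧ l.length = n
      obtain ⟨l, hl, hlen⟩ : P (Nat.findGreatest P (2 * m + 1)) :=
        Nat.findGreatest_spec (m := 1) (by omega) ⟨[s], hsing, rfl⟩
      exact ⟨l, hl, fun l' hl' => hlen ▸ Nat.le_findGreatest (hshort l' hl') ⟨l', hl', rfl⟩⟩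
    have hpos : 0 < l.length := hmax _ hsing
    have hclosed : ∀ x ∈ l, ∀ y ∈ S, G.Adj x y → y ∈ l := fun x hx y hy =>
      hl.mem_of_adj hmax hpos (hshort l hl) hdeg hx hy
    set T := l.toFinset
    have hTS : T ⊆ S := fun x hx => hl.2.2 x (List.mem_toFinset.1 hx)
    have hTcard : T.card = l.length := List.toFinset_card_of_nodup hl.2.1
    have hsub : adjPairs G S ⊆ adjPairs G (S \ T) ∪ T.offDiag := by
      rintro ⟨a, b⟩ hab
      simp only [adjPairs, Finset.mem_union, Finset.mem_filter, Finset.mem_product,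
        Finset.mem_sdiff, Finset.mem_offDiag, T, List.mem_toFinset] at hab ⊢
      have h₁ := hclosed a
      have h₂ := hclosed b
      have h₃ := hab.2.symm
      have h₄ := hab.2.ne
      grind
    have h₁ := (Finset.card_le_card hsub).trans (Finset.card_union_le _ _)
    have h₂ := step (S \ T) (Finset.sdiff_ssubset hTS (Finset.card_pos.1 (by omega)))
    have h₃ : T.offDiag.card ≤ 2 * m * T.card := by
      rw [Finset.offDiag_card, ← Nat.sub_one_mul]
      have := hshort l hl
      exact Nat.mul_le_mul_right _ (by omega)
    have h₄ := Finset.card_sdiff_add_card_eq_card hTS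
    rw [← h₄, mul_add]
    omega
  · push Not at hdeg
    obtain ⟨x, hx, hdx⟩ := hdeg
    set N := S.filter (G.Adj x)
    have hsub : adjPairs G S ⊆ adjPairs G (S.erase x) ∪ ({x} ×ˢ N ∪ N ×ˢ {x}) := by
      rintro ⟨a, b⟩ hab
      simp only [adjPairs, Finset.mem_union, Finset.mem_filter, Finset.mem_product,
        Finset.mem_erase, Finset.mem_singleton, N] at hab ⊢
      have h₃ := hab.2.symm
      grind
    have h₁ := (Finset.card_le_card hsub).trans (Finset.card_union_le _ _)
    have h₂ := step _ (Finset.erase_ssubset hx)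
    have h₃ := Finset.card_union_le ({x} ×ˢ N) (N ×ˢ {x})
    simp only [Finset.card_product, Finset.card_singleton] at h₃
    have h₄ := Finset.card_erase_add_one hx
    rw [← h₄, mul_add]
    omega

/-- A path on `n` vertices in the neighbourhood of `v` closes up to a cycle on `n + 1` vertices. -/
theorem contains_cycleGraph_of_isPathIn {V : Type*} {G : SimpleGraph V} {S : Finset V} {l : List V}
    {v : V} {n : ℕ} (hn : 2 ≤ n) (hS : ∀ x ∈ S, G.Adj v x) (hl : IsPathIn G S l)
    (hlen : l.length = n) : Contains G (cycleGraph (n + 1)) := by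
  have hnd : (v :: l).Nodup :=
    List.nodup_cons.2 ⟨fun h => G.loopless.irrefl _ (hS v (hl.2.2 v h)), hl.2.1⟩
  have hadj : ∀ i (hi : i < n), G.Adj v (l[i]'(by omega)) := fun i hi =>
    hS _ (hl.2.2 _ (List.getElem_mem _))
  have hch := List.isChain_iff_getElem.1 hl.1
  have key : ∀ i j : Fin (n + 1), i = j + 1 →
      G.Adj ((v :: l)[j]'(by simp; omega)) ((v :: l)[i]'(by simp; omega)) := by
    rintro _ j rfl
    rcases (Fin.le_last j).eq_or_lt with rfl | hj
    · obtain ⟨n, rfl⟩ : ∃ p, n = p + 1 := ⟨n - 1, by omega⟩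
      have := (hadj n (by omega)).symm
      simpa using this
    · have h : (j + 1 : Fin (n + 1)).val = j.val + 1 := Fin.val_add_one_of_lt hj
      obtain ⟨j, hj'⟩ := j
      rcases j with _ | j
      · simpa [Nat.mod_eq_of_lt (show 1 < n + 1 by omega)] using hadj 0 (by omega)
      · have := hch j (by rw [Fin.lt_def] at hj; simp at hj; omega)
        simpa [h] using this
  refine ⟨fun i => (v :: l)[i]'(by simp; omega), fun i j hij => ?_, fun i j hij => ?_⟩
  · exact Fin.ext ((List.Nodup.getElem_inj_iff hnd).1 hij)
  · obtain ⟨n, rfl⟩ : ∃ p, n = p + 1 := ⟨n - 1, by omega⟩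
    rw [cycleGraph_adj] at hij
    rcases hij with h | h
    · exact (key i j (by rw [← h]; abel)).symm
    · exact key j i (by rw [← h]; abel)

theorem edgeCount_le_induce_compl_singleton {V : Type*} [Finite V] (G : SimpleGraph V) (v : V) :
    edgeCount G ≤ edgeCount (G.induce ({v}ᶜ : Set V)) + (G.neighborSet v).ncard := by
  have hsub : G.edgeSet ⊆ Sym2.map Subtype.val '' (G.induce ({v}ᶜ : Set V)).edgeSet ∪
      (fun w => s(v, w)) '' G.neighborSet v := by
    intro e he
    induction e using Sym2.ind with
    | _ a b =>
    rw [mem_edgeSet] at he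
    by_cases ha : a = v
    · subst ha
      exact Or.inr ⟨b, he, rfl⟩
    by_cases hb : b = v
    · subst hb
      exact Or.inr ⟨a, he.symm, Sym2.eq_swap⟩
    · exact Or.inl ⟨s(⟨a, ha⟩, ⟨b, hb⟩), by simpa using he, rfl⟩
  exact (Set.ncard_le_ncard hsub).trans ((Set.ncard_union_le _ _).trans
    (add_le_add (Set.ncard_image_le) (Set.ncard_image_le)))

open Classical in
theorem two_mul_card_triangles_le {V : Type*} [Fintype V] (G : SimpleGraph V) (v : V) :
    2 * ((G.cliqueFinset 3).filter (v ∈ ·)).card ≤ (adjPairs G (G.neighborFinset v)).card := by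
  set F := (G.cliqueFinset 3).filter (v ∈ ·)
  have hmaps : ∀ p ∈ adjPairs G (G.neighborFinset v), ({v, p.1, p.2} : Finset V) ∈ F := by
    rintro ⟨a, b⟩ hp
    simp only [adjPairs, Finset.mem_filter, Finset.mem_product, mem_neighborFinset] at hp
    simp only [F, Finset.mem_filter, mem_cliqueFinset_iff]
    exact ⟨is3Clique_triple_iff.2 ⟨hp.1.1, hp.1.2, hp.2⟩, by simp⟩
  rw [Finset.card_eq_sum_card_fiberwise hmaps, mul_comm, ← smul_eq_mul]
  refine Finset.card_nsmul_le_sum _ _ _ fun T hT => ?_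
  simp only [F, Finset.mem_filter, mem_cliqueFinset_iff] at hT
  obtain ⟨hT, hv⟩ := hT
  obtain ⟨a, b, hab, hTab⟩ : ∃ a b, a ≠ b ∧ T.erase v = {a, b} := by
    rw [← Finset.card_eq_two, Finset.card_erase_of_mem hv, hT.card_eq]
  have hTe : T = {v, a, b} := by rw [← Finset.insert_erase hv, hTab]
  subst hTe
  obtain ⟨h₁, h₂, h₃⟩ := is3Clique_triple_iff.1 hT
  have hsub : ({(a, b), (b, a)} : Finset (V × V)) ⊆ (adjPairs G (G.neighborFinset v)).filter
      fun p => ({v, p.1, p.2} : Finset V) = {v, a, b} := by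
    intro p hp
    simp only [Finset.mem_insert, Finset.mem_singleton] at hp
    rcases hp with rfl | rfl
    · simp [adjPairs, h₁, h₂, h₃]
    · simp [adjPairs, h₁, h₂, h₃.symm, Finset.pair_comm]
  refine le_trans ?_ (Finset.card_le_card hsub)
  rw [Finset.card_pair (by simp [hab])]

open Classical in
theorem triangleCount_le_induce_compl_singleton {V : Type*} [Fintype V] (G : SimpleGraph V)
    (v : V) : triangleCount G ≤ triangleCount (G.induce ({v}ᶜ : Set V)) +
      ((G.cliqueFinset 3).filter (v ∈ ·)).card := by
  have hsub : G.cliqueSet 3 ⊆ Finset.map (Function.Embedding.subtype _) ''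
      (G.induce ({v}ᶜ : Set V)).cliqueSet 3 ∪ ↑((G.cliqueFinset 3).filter (v ∈ ·)) := by
    intro T hT
    rw [mem_cliqueSet_iff] at hT
    by_cases hv : v ∈ T
    · exact Or.inr (by simp [hv, hT])
    · have hmap : (T.subtype (· ∈ ({v}ᶜ : Set V))).map (Function.Embedding.subtype _) = T :=
        Finset.subtype_map_of_mem fun x hx h => hv (h ▸ hx)
      refine Or.inl ⟨T.subtype (· ∈ ({v}ᶜ : Set V)), ?_, hmap⟩
      rw [mem_cliqueSet_iff, isNClique_iff]
      refine ⟨fun a ha b hb hab => ?_, ?_⟩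
      · exact hT.isClique (Finset.mem_subtype.1 ha) (Finset.mem_subtype.1 hb)
          fun h => hab (Subtype.ext h)
      · rw [← hT.card_eq, ← Finset.card_map (Function.Embedding.subtype _), hmap]
  refine (Set.ncard_le_ncard hsub).trans ((Set.ncard_union_le _ _).trans ?_)
  rw [Set.ncard_coe_finset]
  exact Nat.add_le_add_right Set.ncard_image_le _

/-- Deleting a vertex `v` from a `C_{2k+1}`-free graph destroys at most `k·d(v)` from the
quantity `e(G) + t(G)`: that is, `e(G−v) + t(G−v) ≥ e(G) + t(G) − k·d(v)`. -/
theorem stmt_8 (k : ℕ) (hk : 1 ≤ k) {V : Type*} [Fintype V] (G : SimpleGraph V)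
    (hfree : ¬ Contains G (cycleGraph (2 * k + 1))) (v : V) :
    edgeCount G + triangleCount G - k * (G.neighborSet v).ncard ≤
      edgeCount (G.induce ({v}ᶜ : Set V)) + triangleCount (G.induce ({v}ᶜ : Set V)) := by
  classical
  obtain ⟨m, rfl⟩ : ∃ m, k = m + 1 := ⟨k - 1, by omega⟩
  have h₁ := edgeCount_le_induce_compl_singleton G v
  have h₂ := triangleCount_le_induce_compl_singleton G v
  have h₃ := two_mul_card_triangles_le G v
  have h₄ := card_adjPairs_le (G := G) (m := m) (G.neighborFinset v) fun l hl hlen =>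
    hfree (contains_cycleGraph_of_isPathIn (by omega) (fun x hx => by simpa using hx) hl hlen)
  have h₅ : (G.neighborSet v).ncard = (G.neighborFinset v).card := by
    simpa using Set.ncard_coe_finset (G.neighborFinset v)
  rw [mul_assoc] at h₄
  rw [add_mul, one_mul, h₅]
  omega
end

section
/- For every integer k ≥ 2 and every real c > 0 there exists n₀ such that for all n ≥ n₀: if G is a C_{2k+1}-free graph on n vertices with e(G) ≥ ⌊n²/4⌋ − c·n^{1+1/k} and G contains a triangle, then G has a vertex v with degree d(v) < n/(2k) − 1. -/
open SimpleGraph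

/-- A path whose two distinct ends are adjacent to a common vertex off the path closes up to a
cycle. -/
lemma contains_cycleGraph_of_isPath_s9 {V : Type*} {G : SimpleGraph V} {a b w : V}
    (p : G.Walk a b) (hp : p.IsPath) (hw : w ∉ p.support) (hwa : G.Adj w a) (hwb : G.Adj w b)
    (hab : a ≠ b) : Contains G (cycleGraph (p.length + 2)) := by
  have hlen : 0 < p.length := by
    rcases Nat.eq_zero_or_pos p.length with h | h
    · exact absurd (Walk.eq_of_length_eq_zero h) hab
    · exact h
  have hcyc : (Walk.cons hwa (p.concat hwb.symm)).IsCycle := by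
    rw [Walk.cons_isCycle_iff]
    refine ⟨hp.concat hw hwb.symm, fun h => ?_⟩
    rw [Walk.edges_concat, List.concat_eq_append, List.mem_append, List.mem_singleton] at h
    rcases h with h | h
    · exact hw (Walk.fst_mem_support_of_mem_edges _ h)
    · rw [Sym2.eq_swap, Sym2.eq_iff] at h
      rcases h with ⟨h, -⟩ | ⟨-, h⟩
      · exact hab h
      · exact hwb.ne h
  obtain ⟨f⟩ := (cycleGraph_isContained_iff (G := G) (n := p.length + 2) (by omega)).2
    ⟨w, _, hcyc, by simp⟩
  exact ⟨f, f.injective, fun i j h => f.toHom.map_adj h⟩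

open Classical Finset in
/-- In a set where every vertex has more than `m` neighbours there is a path with `m` edges. -/
lemma exists_isPath_of_lt_degree {V : Type*} {G : SimpleGraph V} {U : Finset V} {m : ℕ}
    (hne : U.Nonempty) (hU : ∀ u ∈ U, m < #{w ∈ U | G.Adj u w}) (j : ℕ) (hj : j ≤ m) :
    ∃ (x y : V) (p : G.Walk x y), p.IsPath ∧ p.length = j ∧ ∀ z ∈ p.support, z ∈ U := by
  induction j with
  | zero =>
    obtain ⟨x, hx⟩ := hne
    exact ⟨x, x, Walk.nil, by simp, by simp, by simpa using hx⟩
  | succ j ih =>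
    obtain ⟨x, y, p, hp, hlen, hsupp⟩ := ih (by omega)
    have hcard : #p.support.toFinset < #{w ∈ U | G.Adj x w} := by
      have := p.support.toFinset_card_le
      rw [Walk.length_support] at this
      have := hU x (hsupp x p.start_mem_support)
      omega
    obtain ⟨z, hz, hzp⟩ := exists_mem_notMem_of_card_lt_card hcard
    rw [mem_filter] at hz
    rw [List.mem_toFinset] at hzp
    refine ⟨z, y, Walk.cons hz.2.symm p, hp.cons hzp, by simp [hlen], ?_⟩
    intro t ht
    rw [Walk.support_cons, List.mem_cons] at ht
    rcases ht with rfl | ht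
    · exact hz.1
    · exact hsupp t ht

open Classical Finset in
/-- A set of average degree more than `2 * m` contains a nonempty set of minimum degree at
least `m`. -/
lemma exists_subset_forall_le_degree {V : Type*} (G : SimpleGraph V) (m : ℕ) (T : Finset V)
    (hT : 2 * m * #T < ∑ u ∈ T, #{w ∈ T | G.Adj u w}) :
    ∃ U ⊆ T, U.Nonempty ∧ ∀ u ∈ U, m ≤ #{w ∈ U | G.Adj u w} := by
  induction T using Finset.strongInduction with
  | H T ih =>
    by_cases h : ∀ u ∈ T, m ≤ #{w ∈ T | G.Adj u w}
    · refine ⟨T, Subset.rfl, ?_, h⟩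
      by_contra hne
      rw [not_nonempty_iff_eq_empty] at hne
      simp [hne] at hT
    · push Not at h
      obtain ⟨u, hu, hdeg⟩ := h
      have hsplit : ∀ x, #{w ∈ T | G.Adj x w} =
          #{w ∈ T.erase u | G.Adj x w} + if G.Adj x u then 1 else 0 := by
        intro x
        simp only [card_filter]
        rw [← add_sum_erase _ _ hu, add_comm]
      have hsum : ∑ x ∈ T, #{w ∈ T | G.Adj x w} =
          ∑ x ∈ T.erase u, #{w ∈ T.erase u | G.Adj x w} + 2 * #{w ∈ T | G.Adj u w} := by
        rw [← add_sum_erase _ _ hu]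
        have h1 : ∑ x ∈ T.erase u, #{w ∈ T | G.Adj x w} =
            ∑ x ∈ T.erase u, #{w ∈ T.erase u | G.Adj x w} + #{w ∈ T.erase u | G.Adj u w} := by
          rw [sum_congr rfl fun x _ => hsplit x, sum_add_distrib, ← card_filter]
          simp only [G.adj_comm u]
        have h2 := hsplit u
        simp only [G.irrefl, if_false] at h2
        omega
      have hcard := card_erase_add_one hu
      obtain ⟨U, hUT, hU⟩ := ih (T.erase u) (erase_ssubset hu) (by
        rw [← hcard, mul_add] at hT
        omega)
      exact ⟨U, hUT.trans (erase_subset _ _), hU⟩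

open Classical Finset in
/-- In a `C_{2k+1}`-free graph a neighbourhood spans only linearly many edges. -/
lemma sum_degree_neighborhood_le {V : Type*} [Fintype V] {G : SimpleGraph V} {k : ℕ}
    (hk : 1 ≤ k) (hG : ¬ Contains G (cycleGraph (2 * k + 1))) (v : V) :
    ∑ u ∈ G.neighborFinset v, #{w ∈ G.neighborFinset v | G.Adj u w} ≤
      4 * k * #(G.neighborFinset v) := by
  by_contra! h
  obtain ⟨U, hUv, hne, hU⟩ := exists_subset_forall_le_degree G (2 * k) _
    (by rwa [← mul_assoc])
  obtain ⟨x, y, p, hp, hlen, hsupp⟩ := exists_isPath_of_lt_degree (G := G) (m := 2 * k - 1) hne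
    (fun u hu => by have := hU u hu; omega) _ le_rfl
  have hadj : ∀ z ∈ p.support, G.Adj v z := fun z hz =>
    (G.mem_neighborFinset v z).1 (hUv (hsupp z hz))
  apply hG
  have hxy : x ≠ y := by
    rintro rfl
    have := Walk.length_eq_zero_iff.2 (Walk.isPath_iff_nil.1 hp)
    omega
  have := contains_cycleGraph_of_isPath_s9 p hp (fun hv => G.irrefl (hadj v hv))
    (hadj x p.start_mem_support) (hadj y p.end_mem_support) hxy
  rwa [show p.length + 2 = 2 * k + 1 by omega] at this

open Classical Finset in
/-- Two vertices on prescribed sides of a nearly complete bipartite graph are joined by a path of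
any length `L + 2` of the right parity, avoiding a given small set. -/
lemma exists_isPath_of_nearly_complete {V : Type*} {G : SimpleGraph V} {S : Bool → Finset V}
    {g : ℕ} (hS : ∀ i, ∀ x ∈ S i, #{w ∈ S (!i) | ¬ G.Adj x w} ≤ g) (L : ℕ) :
    ∀ (i : Bool) (F : Finset V), (∀ i, 2 * g + #F + L + 3 ≤ #(S i)) →
    ∀ x ∈ S i, ∀ y ∈ S (i ^^ L.bodd), x ≠ y → x ∉ F → y ∉ F →
    ∃ p : G.Walk x y, p.IsPath ∧ p.length = L + 2 ∧ ∀ z ∈ p.support, z ∉ F := by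
  induction L with
  | zero =>
    intro i F hF x hx y hy hxy hxF hyF
    rw [Nat.bodd_zero, Bool.xor_false] at hy
    have hlt : #({w ∈ S (!i) | ¬ G.Adj x w} ∪ {w ∈ S (!i) | ¬ G.Adj y w} ∪ F) < #(S (!i)) := by
      have h1 := card_union_le ({w ∈ S (!i) | ¬ G.Adj x w} ∪ {w ∈ S (!i) | ¬ G.Adj y w}) F
      have h2 := card_union_le {w ∈ S (!i) | ¬ G.Adj x w} {w ∈ S (!i) | ¬ G.Adj y w}
      have := hS i x hx
      have := hS i y hy
      have := hF (!i)
      omega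
    obtain ⟨z, hz, hzn⟩ := exists_mem_notMem_of_card_lt_card hlt
    simp only [mem_union, mem_filter, hz, true_and, not_or, not_not] at hzn
    obtain ⟨⟨hxz, hyz⟩, hzF⟩ := hzn
    refine ⟨Walk.cons hxz (Walk.cons hyz.symm Walk.nil), ?_, by simp, ?_⟩
    · simp [Walk.cons_isPath_iff, hxy, hxz.ne, hyz.ne.symm]
    · simp [hxF, hyF, hzF]
  | succ L ih =>
    intro i F hF x hx y hy hxy hxF hyF
    have hlt : #({w ∈ S (!i) | ¬ G.Adj x w} ∪ insert y F) < #(S (!i)) := by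
      have h1 := card_union_le {w ∈ S (!i) | ¬ G.Adj x w} (insert y F)
      have h2 := card_insert_le y F
      have := hS i x hx
      have := hF (!i)
      omega
    obtain ⟨z, hz, hzn⟩ := exists_mem_notMem_of_card_lt_card hlt
    simp only [mem_union, mem_filter, mem_insert, hz, true_and, not_or, not_not] at hzn
    obtain ⟨hxz, hzy, hzF⟩ := hzn
    obtain ⟨p, hp, hlen, hsupp⟩ := ih (!i) (insert x F)
      (fun i => by have := card_insert_le x F; have := hF i; omega) z hz y
      (by rw [Nat.bodd_succ] at hy; simpa using hy) hzy (by simp [hxz.ne.symm, hzF])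
      (by simp [hxy.symm, hyF])
    refine ⟨Walk.cons hxz p, hp.cons fun h => hsupp x h (mem_insert_self _ _), by simp [hlen], ?_⟩
    intro t ht
    rw [Walk.support_cons, List.mem_cons] at ht
    rcases ht with rfl | ht
    · exact hxF
    · exact fun h => hsupp t ht (mem_insert_of_mem h)

open Classical Finset in
/-- If two adjacent vertices both have several neighbours on the same side of a nearly complete
bipartite graph, then there is a cycle of length `2 * k + 1`. -/
lemma contains_cycleGraph_of_adj {V : Type*} {G : SimpleGraph V} {S : Bool → Finset V}
    {g k : ℕ} (hk : 2 ≤ k) (hS : ∀ i, ∀ x ∈ S i, #{w ∈ S (!i) | ¬ G.Adj x w} ≤ g)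
    (hcard : ∀ i, 2 * g + 2 * k + 1 ≤ #(S i)) {u v : V} (huv : G.Adj u v) (i : Bool)
    (hu : 4 ≤ #{w ∈ S i | G.Adj u w}) (hv : 4 ≤ #{w ∈ S i | G.Adj v w}) :
    Contains G (cycleGraph (2 * k + 1)) := by
  obtain ⟨x, hx, hxn⟩ := exists_mem_notMem_of_card_lt_card
    (s := {u, v}) (lt_of_le_of_lt card_le_two (by omega : 2 < #{w ∈ S i | G.Adj u w}))
  obtain ⟨y, hy, hyn⟩ := exists_mem_notMem_of_card_lt_card
    (s := {u, v, x}) (lt_of_le_of_lt card_le_three (by omega : 3 < #{w ∈ S i | G.Adj v w}))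
  simp only [mem_filter, mem_insert, mem_singleton, not_or] at hx hy hxn hyn
  obtain ⟨p, hp, hlen, hsupp⟩ := exists_isPath_of_nearly_complete hS (2 * k - 4) i {u, v}
    (fun i => by have := hcard i; have := card_le_two (a := u) (b := v); omega)
    x hx.1 y
    (by rw [show 2 * k - 4 = 2 * (k - 2) by omega, Nat.bodd_mul]; simpa using hy.1)
    (Ne.symm hyn.2.2) (by simp [hxn]) (by simp [hyn])
  have hu' : u ∉ p.support := fun h => hsupp u h (by simp)
  have hv' : v ∉ p.support := fun h => hsupp v h (by simp)
  have := contains_cycleGraph_of_isPath_s9 (p.concat hy.2.symm) (hp.concat hv' hy.2.symm) (w := u)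
    (by simp [Walk.support_concat, hu', huv.ne]) hx.2 huv hxn.2
  rwa [Walk.length_concat, show p.length + 1 + 2 = 2 * k + 1 by omega] at this

open Classical Finset in
/-- Double counting of the adjacent pairs between two finite sets. -/
lemma sum_card_adj_comm {V : Type*} (G : SimpleGraph V) (A B : Finset V) :
    ∑ u ∈ A, #{w ∈ B | G.Adj u w} = ∑ w ∈ B, #{u ∈ A | G.Adj w u} := by
  simp only [card_filter]
  rw [sum_comm]
  simp only [G.adj_comm]

open Classical Finset in
/-- In a `C_{2k+1}`-free graph, splitting off the neighbourhood of a vertex of maximum degree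
gives a bipartition with few nonadjacent pairs across. -/
lemma exists_bipartition_few_nonadjacent {V : Type*} [Fintype V] [Nonempty V]
    {G : SimpleGraph V} {k : ℕ} (hk : 1 ≤ k) (hG : ¬ Contains G (cycleGraph (2 * k + 1))) :
    ∃ A : Finset V, ∑ u ∈ A, #{w ∈ Aᶜ | ¬ G.Adj u w} + 2 * edgeCount G ≤
      2 * (#A * #Aᶜ) + 4 * k * Fintype.card V := by
  obtain ⟨v, hv⟩ := G.exists_maximal_degree_vertex
  set B := G.neighborFinset v with hB
  refine ⟨Bᶜ, ?_⟩
  rw [compl_compl]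
  have hsplit : ∀ u, G.degree u = #{w ∈ Bᶜ | G.Adj u w} + #{w ∈ B | G.Adj u w} := by
    intro u
    rw [← card_neighborFinset_eq_degree, neighborFinset_eq_filter]
    simp only [card_filter]
    exact (sum_compl_add_sum B _).symm
  have hedges : ∑ u, G.degree u = 2 * edgeCount G := by
    rw [sum_degrees_eq_twice_card_edges, edgeCount, ← coe_edgeFinset, Set.ncard_coe_finset]
  rw [← sum_compl_add_sum B] at hedges
  have hBdeg : ∑ u ∈ B, G.degree u =
      ∑ u ∈ B, #{w ∈ Bᶜ | G.Adj u w} + ∑ u ∈ B, #{w ∈ B | G.Adj u w} := by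
    rw [← sum_add_distrib]
    exact sum_congr rfl fun u _ => hsplit u
  have hBB := sum_degree_neighborhood_le hk hG v
  rw [← hB] at hBB
  have hcomm := sum_card_adj_comm G B Bᶜ
  have hAdeg : ∑ u ∈ Bᶜ, G.degree u ≤ #Bᶜ * #B := by
    rw [← smul_eq_mul]
    refine sum_le_card_nsmul _ _ _ fun u _ => ?_
    rw [hB, card_neighborFinset_eq_degree, ← hv]
    exact G.degree_le_maxDegree u
  have hmiss : ∑ u ∈ Bᶜ, #{w ∈ B | ¬ G.Adj u w} + ∑ u ∈ Bᶜ, #{w ∈ B | G.Adj u w} =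
      #Bᶜ * #B := by
    rw [← sum_add_distrib, ← smul_eq_mul]
    refine sum_eq_card_nsmul fun u _ => ?_
    rw [add_comm]
    exact card_filter_add_card_filter_not _
  have hle : 4 * k * #B ≤ 4 * k * Fintype.card V := Nat.mul_le_mul_left _ (card_le_univ _)
  omega

open Classical Finset in
/-- All but few vertices of each part have few nonneighbours in the other part. -/
lemma card_filter_many_nonadjacent_le {V : Type*} (G : SimpleGraph V) {A B : Finset V} {g : ℕ}
    (h : ∑ u ∈ A, #{w ∈ B | ¬ G.Adj u w} ≤ g ^ 2) :
    #{u ∈ A | ¬ #{w ∈ B | ¬ G.Adj u w} ≤ g} ≤ g := by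
  by_contra hlt
  rw [not_le] at hlt
  have h1 : #{u ∈ A | ¬ #{w ∈ B | ¬ G.Adj u w} ≤ g} • (g + 1) ≤
      ∑ u ∈ A with ¬ #{w ∈ B | ¬ G.Adj u w} ≤ g, #{w ∈ B | ¬ G.Adj u w} :=
    card_nsmul_le_sum _ _ _ fun u hu => by
      have := (mem_filter.1 hu).2
      omega
  have h2 : ∑ u ∈ A with ¬ #{w ∈ B | ¬ G.Adj u w} ≤ g, #{w ∈ B | ¬ G.Adj u w} ≤
      ∑ u ∈ A, #{w ∈ B | ¬ G.Adj u w} := sum_le_sum_of_subset (filter_subset _ _)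
  rw [smul_eq_mul] at h1
  nlinarith

open Classical Finset in
/-- A graph that is nearly complete between `A` and its complement, has large minimum degree and
contains a triangle, contains a cycle of length `2 * k + 1`. -/
lemma contains_cycleGraph_of_bipartition {V : Type*} [Fintype V] {G : SimpleGraph V} {g k : ℕ}
    (hk : 2 ≤ k) (A : Finset V) (hmiss : ∑ u ∈ A, #{w ∈ Aᶜ | ¬ G.Adj u w} ≤ g ^ 2)
    (hA : 3 * g + 2 * k + 1 ≤ #A) (hB : 3 * g + 2 * k + 1 ≤ #Aᶜ)
    (hdeg : ∀ v, 2 * g + 7 ≤ G.degree v) (htri : (G.cliqueSet 3).Nonempty) :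
    Contains G (cycleGraph (2 * k + 1)) := by
  set P : Bool → Finset V := fun i => if i then A else Aᶜ with hP
  set S : Bool → Finset V := fun i => {u ∈ P i | #{w ∈ P (!i) | ¬ G.Adj u w} ≤ g} with hSdef
  have hmissP : ∀ i, ∑ u ∈ P i, #{w ∈ P (!i) | ¬ G.Adj u w} ≤ g ^ 2 := by
    intro i
    cases i
    · refine le_trans (le_of_eq ?_) hmiss
      simp only [hP, card_filter, Bool.not_false, if_true, Bool.false_eq_true, if_false]
      rw [sum_comm]
      simp only [G.adj_comm]
    · simpa [hP] using hmiss
  have hbad : ∀ i, #{u ∈ P i | ¬ #{w ∈ P (!i) | ¬ G.Adj u w} ≤ g} ≤ g := fun i =>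
    card_filter_many_nonadjacent_le G (hmissP i)
  have hPcard : ∀ i, 3 * g + 2 * k + 1 ≤ #(P i) := by
    intro i
    cases i
    · simpa [hP] using hB
    · simpa [hP] using hA
  have hScard : ∀ i, 2 * g + 2 * k + 1 ≤ #(S i) := by
    intro i
    have h1 := card_filter_add_card_filter_not (s := P i)
      (fun u => #{w ∈ P (!i) | ¬ G.Adj u w} ≤ g)
    have h2 := hbad i
    have h3 := hPcard i
    have h4 : #(S i) = #{u ∈ P i | #{w ∈ P (!i) | ¬ G.Adj u w} ≤ g} := rfl
    omega
  have hS : ∀ i, ∀ x ∈ S i, #{w ∈ S (!i) | ¬ G.Adj x w} ≤ g := fun i x hx =>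
    (card_le_card (filter_subset_filter _ (filter_subset _ _))).trans (mem_filter.1 hx).2
  have hpart : ∀ v i, #{w ∈ P i | G.Adj v w} ≤ #{w ∈ S i | G.Adj v w} + g := by
    intro v i
    have hsub : {w ∈ P i | G.Adj v w} ⊆
        {w ∈ S i | G.Adj v w} ∪ {u ∈ P i | ¬ #{w ∈ P (!i) | ¬ G.Adj u w} ≤ g} := by
      intro w hw
      rw [mem_filter] at hw
      by_cases h : #{x ∈ P (!i) | ¬ G.Adj w x} ≤ g
      · exact mem_union_left _ (mem_filter.2 ⟨mem_filter.2 ⟨hw.1, h⟩, hw.2⟩)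
      · exact mem_union_right _ (mem_filter.2 ⟨hw.1, h⟩)
    exact (card_le_card hsub).trans ((card_union_le _ _).trans (Nat.add_le_add_left (hbad i) _))
  have hside : ∀ v, ∃ i, 4 ≤ #{w ∈ S i | G.Adj v w} := by
    intro v
    have hsplit : G.degree v = #{w ∈ P true | G.Adj v w} + #{w ∈ P false | G.Adj v w} := by
      rw [← card_neighborFinset_eq_degree, neighborFinset_eq_filter]
      simp only [card_filter, hP, if_true, Bool.false_eq_true, if_false]
      exact (sum_add_sum_compl A _).symm
    by_contra! h
    have := hdeg v
    have := hpart v true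
    have := hpart v false
    have := h true
    have := h false
    omega
  choose side hside using hside
  obtain ⟨t, ht⟩ := htri
  obtain ⟨a, b, c, hab, hac, hbc, -⟩ := is3Clique_iff.1 ((G.mem_cliqueSet_iff).1 ht)
  have key : ∀ {u v}, G.Adj u v → side u = side v → Contains G (cycleGraph (2 * k + 1)) :=
    fun {u v} huv h => contains_cycleGraph_of_adj hk hS hScard huv (side u) (hside u)
      (h ▸ hside v)
  by_cases h1 : side a = side b
  · exact key hab h1
  by_cases h2 : side a = side c
  · exact key hac h2
  refine key hbc ?_
  revert h1 h2
  cases side a <;> cases side b <;> cases side c <;> simp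

open Filter in
lemma isLittleO_rpow_rpow_atTop {p q : ℝ} (h : p < q) :
    (fun x : ℝ => x ^ p) =o[atTop] fun x : ℝ => x ^ q := by
  rw [Asymptotics.isLittleO_iff_tendsto']
  · refine (tendsto_rpow_neg_atTop (sub_pos.2 h)).congr' ?_
    filter_upwards [eventually_gt_atTop 0] with x hx
    rw [← Real.rpow_sub hx, neg_sub]
  · filter_upwards [eventually_gt_atTop 0] with x hx h0
    exact absurd h0 (Real.rpow_pos_of_pos hx q).ne'

open Filter in
/-- The error terms are eventually smaller than any fixed multiple of `n ^ 2`. -/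
lemma eventually_error_le {k : ℕ} (hk : 2 ≤ k) (c d : ℝ) {ε : ℝ} (hε : 0 < ε) :
    ∀ᶠ n : ℕ in atTop, c * (n : ℝ) ^ ((1 : ℝ) + 1 / k) + 1 + d * n ≤ ε * (n : ℝ) ^ 2 := by
  have hk' : (1 : ℝ) / k < 1 := by
    rw [div_lt_one (by positivity)]
    exact_mod_cast hk
  have h1 : (fun x : ℝ => x ^ ((1 : ℝ) + 1 / k)) =o[atTop] fun x : ℝ => x ^ (2 : ℝ) :=
    isLittleO_rpow_rpow_atTop (by linarith)
  have h2 : (fun _ : ℝ => (1 : ℝ)) =o[atTop] fun x : ℝ => x ^ (2 : ℝ) := by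
    simp
  have h3 : (fun x : ℝ => x) =o[atTop] fun x : ℝ => x ^ (2 : ℝ) := by
    simpa using isLittleO_rpow_rpow_atTop (p := 1) (q := 2) (by norm_num)
  have h := (((h1.const_mul_left c).add h2).add (h3.const_mul_left d)).bound hε
  have h' := tendsto_natCast_atTop_atTop (R := ℝ) |>.eventually h
  filter_upwards [h'] with n hn
  rw [Real.norm_eq_abs, Real.norm_eq_abs, Real.rpow_two, abs_of_nonneg (sq_nonneg (n : ℝ))] at hn
  exact (le_abs_self _).trans hn

/-- For `k ≥ 2` and `c > 0`, for sufficiently large `n`: every `C_{2k+1}`-free graph on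
`n` vertices with `e(G) ≥ ⌊n²/4⌋ − c·n^{1+1/k}` containing a triangle has a vertex of
degree less than `n/(2k) − 1`. -/
theorem stmt_9 (k : ℕ) (hk : 2 ≤ k) (c : ℝ) (hc : 0 < c) :
    ∃ n₀ : ℕ, ∀ n : ℕ, n₀ ≤ n →
      ∀ (V : Type) [Fintype V] (G : SimpleGraph V), Fintype.card V = n →
        ¬ Contains G (cycleGraph (2 * k + 1)) →
        ((n ^ 2 / 4 : ℕ) : ℝ) - c * (n : ℝ) ^ ((1 : ℝ) + 1 / k) ≤ (edgeCount G : ℝ) →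
        (G.cliqueSet 3).Nonempty →
        ∃ v : V, ((G.neighborSet v).ncard : ℝ) < (n : ℝ) / (2 * k) - 1 := by
  classical
  have hk0 : (2 : ℝ) ≤ k := by exact_mod_cast hk
  obtain ⟨N, hN⟩ := Filter.eventually_atTop.1
    (eventually_error_le hk c (2 * k) (ε := 1 / (8192 * (k : ℝ) ^ 2)) (by positivity))
  refine ⟨max N (1000 * k ^ 2), fun n hn V _ G hcard hfree he htri => ?_⟩
  have herr := hN n (le_of_max_le_left hn)
  have hlarge : 1000 * (k : ℝ) ^ 2 ≤ n := by exact_mod_cast le_of_max_le_right hn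
  by_contra! hdeg
  have : Nonempty V := by
    obtain ⟨t, ht⟩ := htri
    obtain ⟨a, -⟩ := is3Clique_iff.1 ((G.mem_cliqueSet_iff).1 ht)
    exact ⟨a⟩
  obtain ⟨A, hA⟩ := exists_bipartition_few_nonadjacent (by omega) hfree
  have hAc : (A.card : ℝ) + (Aᶜ.card : ℝ) = n := by
    rw [← hcard]; exact_mod_cast A.card_add_card_compl
  rw [hcard] at hA
  have hA' : ((∑ u ∈ A, (Aᶜ.filter fun w => ¬ G.Adj u w).card : ℕ) : ℝ) + 2 * edgeCount G ≤
      2 * (A.card * Aᶜ.card) + 4 * k * n := by exact_mod_cast hA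
  have hmiss0 : (0 : ℝ) ≤ ((∑ u ∈ A, (Aᶜ.filter fun w => ¬ G.Adj u w).card : ℕ) : ℝ) :=
    Nat.cast_nonneg _
  have hfloor : (n : ℝ) ^ 2 / 4 - 1 ≤ ((n ^ 2 / 4 : ℕ) : ℝ) := by
    have : n ^ 2 ≤ 4 * (n ^ 2 / 4) + 4 := by omega
    have : (n : ℝ) ^ 2 ≤ 4 * ((n ^ 2 / 4 : ℕ) : ℝ) + 4 := by exact_mod_cast this
    linarith
  have hn0 : (0 : ℝ) < n := by nlinarith
  have hprod : (A.card : ℝ) * Aᶜ.card ≤ (n : ℝ) ^ 2 / 4 := by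
    rw [← hAc]; nlinarith [sq_nonneg ((A.card : ℝ) - Aᶜ.card)]
  have hε : 1 / (8192 * (k : ℝ) ^ 2) * (n : ℝ) ^ 2 ≤ (n : ℝ) ^ 2 / 8 := by
    rw [div_mul_eq_mul_div, div_le_div_iff₀ (by positivity) (by norm_num)]
    have hk1 : (1 : ℝ) ≤ (k : ℝ) ^ 2 := by nlinarith
    nlinarith [mul_le_mul_of_nonneg_left hk1 (sq_nonneg (n : ℝ))]
  have hlower : (n : ℝ) ^ 2 / 8 ≤ A.card * Aᶜ.card := by linarith
  have hAn : (n : ℝ) / 8 ≤ A.card := by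
    have : (Aᶜ.card : ℝ) ≤ n := by linarith [(Nat.cast_nonneg A.card : (0 : ℝ) ≤ _)]
    by_contra! h
    nlinarith [(Nat.cast_nonneg A.card : (0 : ℝ) ≤ _)]
  have hBn : (n : ℝ) / 8 ≤ Aᶜ.card := by
    have : (A.card : ℝ) ≤ n := by linarith [(Nat.cast_nonneg Aᶜ.card : (0 : ℝ) ≤ _)]
    by_contra! h
    nlinarith [(Nat.cast_nonneg Aᶜ.card : (0 : ℝ) ≤ _)]
  set g := ⌊(n : ℝ) / (32 * k)⌋₊ with hg
  have hg1 : (g : ℝ) ≤ (n : ℝ) / (32 * k) := Nat.floor_le (by positivity)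
  have hg2 : (n : ℝ) / (32 * k) < g + 1 := Nat.lt_floor_add_one _
  have hnk : 15 * (k : ℝ) ≤ n / (64 * k) := by
    rw [le_div_iff₀ (by positivity)]; nlinarith
  have hhalf : (n : ℝ) / (32 * k) = 2 * (n / (64 * k)) := by field_simp; norm_num
  have hdeg2 : (n : ℝ) / (2 * k) = 32 * (n / (64 * k)) := by field_simp; norm_num
  have hglow : (n : ℝ) / (64 * k) ≤ g := by linarith
  have hsmall : (n : ℝ) / (64 * k) ≤ n / 128 := by
    apply div_le_div_of_nonneg_left hn0.le (by norm_num); linarith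
  have hn8 : 3 * g + 2 * k + 1 ≤ (n : ℝ) / 8 := by linarith
  refine hfree (contains_cycleGraph_of_bipartition (g := g) hk A ?_ ?_ ?_ (fun v => ?_) htri)
  · have hsq : 2 * (1 / (8192 * (k : ℝ) ^ 2) * (n : ℝ) ^ 2) = (n / (64 * k)) ^ 2 := by
      field_simp; norm_num
    have hgsq : ((n : ℝ) / (64 * k)) ^ 2 ≤ (g : ℝ) ^ 2 := by gcongr
    have : ((∑ u ∈ A, (Aᶜ.filter fun w => ¬ G.Adj u w).card : ℕ) : ℝ) ≤ (g : ℝ) ^ 2 := by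
      linarith
    exact_mod_cast this
  · exact_mod_cast hn8.trans hAn
  · exact_mod_cast hn8.trans hBn
  · have hv := hdeg v
    rw [← coe_neighborFinset, Set.ncard_coe_finset, card_neighborFinset_eq_degree] at hv
    have : (2 * g + 7 : ℝ) ≤ G.degree v := by linarith
    exact_mod_cast this
end

section
/- Let k ≥ 2 and let G be a C_{2k+1}-free graph whose vertex set is partitioned as V₁ ∪ V₂ with |V₁|, |V₂| ≥ 8k. For i ∈ {1,2} let L_i = {v ∈ V_i : v has at least (1 − 1/(10k))·|V_{3−i}| neighbors in V_{3−i}} and suppose |V_i ∖ L_i| ≤ |V_i|/(4k) for each i. Then L₁ and L₂ are independent sets in G. -/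
open SimpleGraph

/-- Adjacency in a cycle graph: consecutive vertices, or the last and the first one. -/
theorem cycleGraph_adj_cases {n : ℕ} {i j : Fin n} (h : (cycleGraph n).Adj i j) :
    ((j : ℕ) = i + 1 ∨ ((i : ℕ) + 1 = n ∧ (j : ℕ) = 0)) ∨
      ((i : ℕ) = j + 1 ∨ ((j : ℕ) + 1 = n ∧ (i : ℕ) = 0)) := by
  have key : ∀ a b : Fin n, (a - b).val = 1 →
      (a : ℕ) = b + 1 ∨ ((b : ℕ) + 1 = n ∧ (a : ℕ) = 0) := by
    intro a b hab
    rcases le_or_gt b a with hle | hlt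
    · rw [Fin.sub_val_of_le hle] at hab
      omega
    · rw [Fin.coe_sub_iff_lt.mpr hlt] at hab
      have := a.isLt
      have := b.isLt
      rw [Fin.lt_def] at hlt
      omega
  rcases cycleGraph_adj'.mp h with h | h
  · exact Or.inr (key i j h)
  · exact Or.inl (key j i h)

/-- Vertices `a 0, …, a k` and `b 0, …, b (k - 1)`, such that each `b i` is adjacent to `a i` and
`a (i + 1)`, form an odd cycle if `a k` is adjacent to `a 0`. -/
theorem contains_odd_cycle {V : Type*} {G : SimpleGraph V} {k : ℕ} {a : Fin (k + 1) → V}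
    {b : Fin k → V} (ha : Function.Injective a) (hb : Function.Injective b)
    (hne : ∀ i j, a i ≠ b j) (hleft : ∀ i : Fin k, G.Adj (a i.castSucc) (b i))
    (hright : ∀ i : Fin k, G.Adj (b i) (a i.succ)) (hclose : G.Adj (a (Fin.last k)) (a 0)) :
    Contains G (cycleGraph (2 * k + 1)) := by
  let f : Fin (2 * k + 1) → V := fun j =>
    if h : (j : ℕ) % 2 = 0 then a ⟨j / 2, by omega⟩ else b ⟨j / 2, by omega⟩
  have hstep : ∀ i j : Fin (2 * k + 1),
      (j : ℕ) = i + 1 ∨ ((i : ℕ) + 1 = 2 * k + 1 ∧ (j : ℕ) = 0) → G.Adj (f i) (f j) := by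
    intro i j h
    rcases h with h | ⟨hi, hj⟩
    · by_cases hi : (i : ℕ) % 2 = 0
      · have hj : ¬ (j : ℕ) % 2 = 0 := by omega
        simp only [f, hi, hj, dif_pos, dif_neg, not_false_eq_true]
        convert hleft ⟨j / 2, by omega⟩ using 2
        ext
        simp only [Fin.val_castSucc]
        omega
      · have hj : (j : ℕ) % 2 = 0 := by omega
        simp only [f, hi, hj, dif_pos, dif_neg, not_false_eq_true]
        convert hright ⟨i / 2, by omega⟩ using 2
        ext
        simp only [Fin.val_succ]
        omega
    · have hi' : (i : ℕ) % 2 = 0 := by omega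
      have hj' : (j : ℕ) % 2 = 0 := by omega
      simp only [f, hi', hj', dif_pos]
      convert hclose using 2
      · ext
        simp only [Fin.val_last]
        omega
      · ext
        simp only [Fin.val_zero]
        omega
  refine ⟨f, fun i j hij => ?_, fun i j hij => ?_⟩
  · ext
    by_cases hi : (i : ℕ) % 2 = 0 <;> by_cases hj : (j : ℕ) % 2 = 0 <;>
      simp only [f, hi, hj, dif_pos, dif_neg, not_false_eq_true] at hij
    · have := Fin.val_eq_of_eq (ha hij)
      simp only at this
      omega
    · exact (hne _ _ hij).elim
    · exact (hne _ _ hij.symm).elim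
    · have := Fin.val_eq_of_eq (hb hij)
      simp only at this
      omega
  · rcases cycleGraph_adj_cases hij with h | h
    · exact hstep i j h
    · exact (hstep j i h).symm

/-- Sets `t i`, at least as large as their number, have distinct representatives. -/
theorem exists_injective_mem_of_le_ncard {V : Type*} [Finite V] {k : ℕ} {t : Fin k → Set V}
    (ht : ∀ i, k ≤ (t i).ncard) : ∃ b : Fin k → V, Function.Injective b ∧ ∀ i, b i ∈ t i := by
  classical
  have hfin : ∀ i, (t i).Finite := fun i => Set.toFinite _
  obtain ⟨b, hb, hmem⟩ := (Finset.all_card_le_biUnion_card_iff_exists_injective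
    fun i => (hfin i).toFinset).mp (by
      intro s
      rcases s.eq_empty_or_nonempty with rfl | ⟨i, hi⟩
      · simp
      · calc s.card ≤ k := s.card_le_univ.trans_eq (Fintype.card_fin k)
          _ ≤ (hfin i).toFinset.card := by
            rw [← Set.ncard_eq_toFinset_card]
            exact ht i
          _ ≤ _ := Finset.card_le_card
            (Finset.subset_biUnion_of_mem (fun i => (hfin i).toFinset) hi))
  exact ⟨b, hb, fun i => (hfin i).mem_toFinset.mp (hmem i)⟩

/-- Two heavy vertices on the same side have many common neighbours on the other side. -/
theorem le_ncard_common_neighbors {V : Type*} [Finite V] {G : SimpleGraph V} {k : ℕ} (hk : 1 ≤ k)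
    {A B : Set V} (hB : 8 * k ≤ B.ncard) {x y : V} (hx : x ∈ heavySet G k A B)
    (hy : y ∈ heavySet G k A B) :
    k ≤ ((G.neighborSet x ∩ B) ∩ (G.neighborSet y ∩ B)).ncard := by
  have hsum := Set.ncard_union_add_ncard_inter (G.neighborSet x ∩ B) (G.neighborSet y ∩ B)
  have hunion : ((G.neighborSet x ∩ B) ∪ (G.neighborSet y ∩ B)).ncard ≤ B.ncard :=
    Set.ncard_le_ncard (Set.union_subset Set.inter_subset_right Set.inter_subset_right)
  have hx' := hx.2
  have hy' := hy.2
  have hk' : (1 : ℝ) ≤ k := by exact_mod_cast hk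
  have hB' : (8 : ℝ) * k ≤ B.ncard := by exact_mod_cast hB
  have hfrac : (1 : ℝ) / (10 * k) ≤ 1 / 10 :=
    one_div_le_one_div_of_le (by norm_num) (by linarith)
  have hloss : (1 : ℝ) / (10 * k) * B.ncard ≤ 1 / 10 * B.ncard :=
    mul_le_mul_of_nonneg_right hfrac (Nat.cast_nonneg _)
  have hsum' : (((G.neighborSet x ∩ B) ∪ (G.neighborSet y ∩ B)).ncard : ℝ) +
      ((G.neighborSet x ∩ B) ∩ (G.neighborSet y ∩ B)).ncard =
      (G.neighborSet x ∩ B).ncard + (G.neighborSet y ∩ B).ncard := by exact_mod_cast hsum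
  have hunion' : (((G.neighborSet x ∩ B) ∪ (G.neighborSet y ∩ B)).ncard : ℝ) ≤ B.ncard := by
    exact_mod_cast hunion
  have : (k : ℝ) ≤ ((G.neighborSet x ∩ B) ∩ (G.neighborSet y ∩ B)).ncard := by linarith
  exact_mod_cast this

/-- A set with few light vertices has at least `k + 1` heavy ones. -/
theorem succ_le_ncard_heavySet {V : Type*} [Finite V] {G : SimpleGraph V} {k : ℕ} (hk : 1 ≤ k)
    {A B : Set V} (hA : 8 * k ≤ A.ncard)
    (hS : ((A \ heavySet G k A B).ncard : ℝ) ≤ (A.ncard : ℝ) / (4 * k)) :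
    k + 1 ≤ (heavySet G k A B).ncard := by
  have hsum := Set.ncard_sdiff_add_ncard_of_subset
    (show heavySet G k A B ⊆ A from fun _ h => h.1)
  have hk' : (1 : ℝ) ≤ k := by exact_mod_cast hk
  have hA' : (8 : ℝ) * k ≤ A.ncard := by exact_mod_cast hA
  have hlight : (A.ncard : ℝ) / (4 * k) ≤ A.ncard / 4 :=
    div_le_div_of_nonneg_left (Nat.cast_nonneg _) (by norm_num) (by linarith)
  have hsum' : ((A \ heavySet G k A B).ncard : ℝ) + (heavySet G k A B).ncard = A.ncard := by
    exact_mod_cast hsum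
  have : (k : ℝ) + 1 ≤ (heavySet G k A B).ncard := by linarith
  exact_mod_cast this

/-- A set with at least `m + 2` elements carries an injective sequence of length `m + 2` with
prescribed distinct endpoints. -/
theorem exists_injective_with_endpoints {V : Type*} [Finite V] {L : Set V} {m : ℕ}
    (hL : m + 2 ≤ L.ncard) {u v : V} (hu : u ∈ L) (hv : v ∈ L) (huv : u ≠ v) :
    ∃ a : Fin (m + 2) → V, Function.Injective a ∧ (∀ i, a i ∈ L) ∧ a 0 = u ∧
      a (Fin.last (m + 1)) = v := by
  have hcard : m ≤ (L \ {u, v}).ncard := by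
    have := Set.ncard_sdiff_add_ncard_of_subset (Set.pair_subset hu hv)
    rw [Set.ncard_pair huv] at this
    omega
  obtain ⟨g, hg, hmem⟩ := exists_injective_mem_of_le_ncard (t := fun _ : Fin m => L \ {u, v})
    fun _ => hcard
  refine ⟨Fin.cons u (Fin.snoc g v : Fin (m + 1) → V), ?_, ?_, rfl, ?_⟩
  · rw [Fin.cons_injective_iff, Fin.snoc_injective_iff]
    refine ⟨?_, hg, ?_⟩
    · rintro ⟨i, hi⟩
      induction i using Fin.lastCases with
      | last => exact huv (by simpa using hi.symm)
      | cast i => exact (hmem i).2 (Or.inl (by simpa using hi))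
    · rintro ⟨i, hi⟩
      exact (hmem i).2 (Or.inr hi)
  · intro i
    induction i using Fin.cases with
    | zero => exact hu
    | succ i =>
      induction i using Fin.lastCases with
      | last => simpa using hv
      | cast i => simpa using (hmem i).1
  · rw [← Fin.succ_last, Fin.cons_succ, Fin.snoc_last]

/-- If `A` has few light vertices and `G` has no odd cycle of length `2k + 1`, then the heavy
vertices of `A` form an independent set. -/
theorem not_adj_of_mem_heavySet {V : Type*} [Finite V] {G : SimpleGraph V} {k : ℕ} (hk : 1 ≤ k)
    (hfree : ¬ Contains G (cycleGraph (2 * k + 1))) {A B : Set V} (hdisj : Disjoint A B)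
    (hA : 8 * k ≤ A.ncard) (hB : 8 * k ≤ B.ncard)
    (hS : ((A \ heavySet G k A B).ncard : ℝ) ≤ (A.ncard : ℝ) / (4 * k)) {u v : V}
    (hu : u ∈ heavySet G k A B) (hv : v ∈ heavySet G k A B) : ¬ G.Adj u v := by
  intro huv
  have hL := succ_le_ncard_heavySet hk hA hS
  obtain ⟨a, ha, hmem, h0, hlast⟩ : ∃ a : Fin (k + 1) → V, Function.Injective a ∧
      (∀ i, a i ∈ heavySet G k A B) ∧ a 0 = u ∧ a (Fin.last k) = v := by
    obtain ⟨m, rfl⟩ := Nat.exists_eq_add_of_le' hk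
    exact exists_injective_with_endpoints hL hu hv huv.ne
  obtain ⟨b, hb, hbmem⟩ := exists_injective_mem_of_le_ncard fun i : Fin k =>
    le_ncard_common_neighbors hk hB (hmem i.castSucc) (hmem i.succ)
  refine hfree (contains_odd_cycle ha hb (fun i j h => ?_) (fun i => (hbmem i).1.1)
    (fun i => (hbmem i).2.1.symm) ?_)
  · exact Set.disjoint_left.mp hdisj (hmem i).1 (h ▸ (hbmem j).1.2)
  · rw [h0, hlast]
    exact huv.symm

/-- Under the partition assumptions, in a `C_{2k+1}`-free graph the sets `L₁` and `L₂`
are independent. -/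
theorem stmt_12 (k : ℕ) (hk : 2 ≤ k) {V : Type*} [Fintype V] (G : SimpleGraph V)
    (hfree : ¬ Contains G (cycleGraph (2 * k + 1)))
    (V₁ V₂ : Set V) (hpart : V₁ ∪ V₂ = Set.univ) (hdisj : Disjoint V₁ V₂)
    (h₁ : 8 * k ≤ V₁.ncard) (h₂ : 8 * k ≤ V₂.ncard)
    (hS₁ : ((V₁ \ heavySet G k V₁ V₂).ncard : ℝ) ≤ (V₁.ncard : ℝ) / (4 * k))
    (hS₂ : ((V₂ \ heavySet G k V₂ V₁).ncard : ℝ) ≤ (V₂.ncard : ℝ) / (4 * k)) :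
    (∀ u ∈ heavySet G k V₁ V₂, ∀ v ∈ heavySet G k V₁ V₂, ¬ G.Adj u v) ∧
    (∀ u ∈ heavySet G k V₂ V₁, ∀ v ∈ heavySet G k V₂ V₁, ¬ G.Adj u v) := by
  exact ⟨fun _ hu _ hv => not_adj_of_mem_heavySet (by omega) hfree hdisj h₁ h₂ hS₁ hu hv,
    fun _ hu _ hv => not_adj_of_mem_heavySet (by omega) hfree hdisj.symm h₂ h₁ hS₂ hu hv⟩
end

section
/- Let k ≥ 2 and let G be a C_{2k+1}-free graph whose vertex set is partitioned as V₁ ∪ V₂ with |V₁|, |V₂| ≥ 8k. For i ∈ {1,2} let L_i = {v ∈ V_i : v has at least (1 − 1/(10k))·|V_{3−i}| neighbors in V_{3−i}}, let S_i = V_i ∖ L_i, and suppose |S_i| ≤ |V_i|/(4k) for each i. Then G contains no triangle with one vertex in S₁, one vertex in L₁ and one vertex in L₂, and similarly no triangle with one vertex in S₂, one vertex in L₂ and one vertex in L₁. -/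
open SimpleGraph

/-- Two heavy vertices on the same side have a common heavy neighbour on the other side, even
after forbidding any `2 * k` vertices. -/
theorem exists_common_neighbor_mem_heavySet {V : Type*} [Fintype V] {G : SimpleGraph V} {k : ℕ}
    (hk : 2 ≤ k) {A B : Set V} (hB : 8 * k ≤ B.ncard)
    (hS : ((B \ heavySet G k B A).ncard : ℝ) ≤ (B.ncard : ℝ) / (4 * k)) {u v : V}
    (hu : u ∈ heavySet G k A B) (hv : v ∈ heavySet G k A B) (l : List V)
    (hl : l.length ≤ 2 * k) :
    ∃ w ∈ heavySet G k B A, w ∉ l ∧ G.Adj u w ∧ G.Adj v w := by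
  classical
  by_contra! hcon
  have hsub : B ⊆ (B \ G.neighborSet u) ∪ (B \ G.neighborSet v) ∪ (B \ heavySet G k B A)
      ∪ (l.toFinset : Set V) := by
    intro w hw
    by_contra hnot
    simp only [Set.mem_union, Set.mem_sdiff, hw, true_and, SimpleGraph.mem_neighborSet,
      List.coe_toFinset, Set.mem_ofPred_eq, not_or, not_not] at hnot
    exact hcon w hnot.1.2 hnot.2 hnot.1.1.1 hnot.1.1.2
  have hmiss : ∀ x ∈ heavySet G k A B,
      ((B \ G.neighborSet x).ncard : ℝ) ≤ 1 / (10 * k) * B.ncard := by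
    intro x hx
    have hsplit := Set.ncard_inter_add_ncard_sdiff_eq_ncard B (G.neighborSet x) (Set.toFinite _)
    rw [Set.inter_comm] at hsplit
    have hcast : ((G.neighborSet x ∩ B).ncard : ℝ) + ((B \ G.neighborSet x).ncard : ℝ)
        = B.ncard := by exact_mod_cast hsplit
    linarith [hx.2]
  have hlist : ((l.toFinset : Set V).ncard : ℝ) ≤ 2 * k := by
    rw [Set.ncard_coe_finset]
    exact_mod_cast l.toFinset_card_le.trans hl
  have hcard : (B.ncard : ℝ) ≤ (B \ G.neighborSet u).ncard + (B \ G.neighborSet v).ncard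
      + (B \ heavySet G k B A).ncard + (l.toFinset : Set V).ncard := by
    have hle := Set.ncard_le_ncard hsub (Set.toFinite _)
    have hunion₁ := Set.ncard_union_le (B \ G.neighborSet u) (B \ G.neighborSet v)
    have hunion₂ := Set.ncard_union_le (B \ G.neighborSet u ∪ B \ G.neighborSet v)
      (B \ heavySet G k B A)
    have hunion₃ := Set.ncard_union_le
      (B \ G.neighborSet u ∪ B \ G.neighborSet v ∪ B \ heavySet G k B A) (l.toFinset : Set V)
    norm_cast
    simp only [Set.ncard_coe_finset] at hunion₃
    omega
  have hk' : (2 : ℝ) ≤ k := by exact_mod_cast hk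
  have hB' : (8 : ℝ) * k ≤ B.ncard := by exact_mod_cast hB
  have hinv : (k : ℝ)⁻¹ ≤ 1 / 2 := by
    rw [inv_le_comm₀ (by linarith) (by norm_num)]
    linarith
  have hten : (1 : ℝ) / (10 * k) = (k : ℝ)⁻¹ / 10 := by field_simp
  have hfour : (B.ncard : ℝ) / (4 * k) = (k : ℝ)⁻¹ / 4 * B.ncard := by field_simp
  have hmu := hmiss u hu
  have hmv := hmiss v hv
  rw [hten] at hmu hmv
  rw [hfour] at hS
  nlinarith [mul_le_mul_of_nonneg_right hinv (Nat.cast_nonneg (α := ℝ) B.ncard)]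

/-- A path, given as a list of distinct vertices, with adjacent endpoints yields a cycle. -/
theorem contains_cycleGraph_of_isChain {V : Type*} {G : SimpleGraph V} {x c : V} {t : List V}
    (hnodup : (x :: (t ++ [c])).Nodup) (hchain : (x :: (t ++ [c])).IsChain G.Adj)
    (hadj : G.Adj x c) :
    Contains G (SimpleGraph.cycleGraph (t.length + 2)) := by
  have hlen : (x :: (t ++ [c])).length = t.length + 2 := by simp
  have hstep : ∀ i j : Fin (t.length + 2), j - i = 1 →
      G.Adj ((x :: (t ++ [c])).get (i.cast hlen.symm))
        ((x :: (t ++ [c])).get (j.cast hlen.symm)) := by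
    intro i j hij
    obtain rfl : j = i + 1 := by rw [← hij]; abel
    rcases eq_or_ne i (Fin.last _) with rfl | hi
    · simpa using hadj.symm
    · have hval : ((i + 1 : Fin (t.length + 2)) : ℕ) = i + 1 :=
        Fin.val_add_one_of_lt (Fin.lt_last_iff_ne_last.2 hi)
      have := List.isChain_iff_getElem.1 hchain i (by
        have := (i + 1).isLt
        omega)
      simpa only [List.get_eq_getElem, Fin.val_cast, hval] using this
  refine ⟨fun i => (x :: (t ++ [c])).get (i.cast hlen.symm),
    hnodup.injective_get.comp (Fin.cast_injective _), fun i j hij => ?_⟩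
  rcases SimpleGraph.cycleGraph_adj.1 hij with h | h
  · exact (hstep j i h).symm
  · exact hstep i j h

/-- A triangle with two heavy vertices on opposite sides extends to a path of heavy vertices
that starts next to `c`, ends in `b, a, c` and has any odd number of vertices up to `2 * k + 1`. -/
theorem exists_isChain_of_triangle {V : Type*} [Fintype V] {G : SimpleGraph V} {k : ℕ}
    (hk : 2 ≤ k) {A B : Set V} (hA : 8 * k ≤ A.ncard) (hB : 8 * k ≤ B.ncard)
    (hSA : ((A \ heavySet G k A B).ncard : ℝ) ≤ (A.ncard : ℝ) / (4 * k))
    (hSB : ((B \ heavySet G k B A).ncard : ℝ) ≤ (B.ncard : ℝ) / (4 * k))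
    {a b c : V} (hb : b ∈ heavySet G k A B) (hc : c ∈ heavySet G k B A)
    (hab : G.Adj a b) (hac : G.Adj a c) (hbc : G.Adj b c) (j : ℕ) (hj : j + 1 ≤ k) :
    ∃ (x : V) (t : List V), x ∈ heavySet G k A B ∧ t.length = 2 * j + 1 ∧ G.Adj x c ∧
      (x :: (t ++ [c])).Nodup ∧ (x :: (t ++ [c])).IsChain G.Adj := by
  induction j with
  | zero =>
    exact ⟨b, [a], hb, rfl, hbc, by simp [hab.ne', hac.ne, hbc.ne], by simp [hab.symm, hac]⟩
  | succ j ih =>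
    obtain ⟨x, t, hx, ht, -, hnodup, hchain⟩ := ih (by omega)
    obtain ⟨p, hp, hpl, hxp, -⟩ := exists_common_neighbor_mem_heavySet hk hB hSB hx hx
      (x :: (t ++ [c])) (by simp; omega)
    obtain ⟨q, hq, hql, hpq, hcq⟩ := exists_common_neighbor_mem_heavySet hk hA hSA hp hc
      (p :: x :: (t ++ [c])) (by simp; omega)
    refine ⟨q, p :: x :: t, hq, by simp; omega, hcq.symm, ?_, ?_⟩
    · exact List.nodup_cons.2 ⟨hql, List.nodup_cons.2 ⟨hpl, hnodup⟩⟩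
    · exact List.isChain_cons_cons.2 ⟨hpq.symm, List.isChain_cons_cons.2 ⟨hxp.symm, hchain⟩⟩

/-- A triangle with two heavy vertices on opposite sides forces a cycle of length `2 * k + 1`. -/
theorem contains_cycleGraph_of_triangle {V : Type*} [Fintype V] {G : SimpleGraph V} {k : ℕ}
    (hk : 2 ≤ k) {A B : Set V} (hA : 8 * k ≤ A.ncard) (hB : 8 * k ≤ B.ncard)
    (hSA : ((A \ heavySet G k A B).ncard : ℝ) ≤ (A.ncard : ℝ) / (4 * k))
    (hSB : ((B \ heavySet G k B A).ncard : ℝ) ≤ (B.ncard : ℝ) / (4 * k))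
    {a b c : V} (hb : b ∈ heavySet G k A B) (hc : c ∈ heavySet G k B A)
    (hab : G.Adj a b) (hac : G.Adj a c) (hbc : G.Adj b c) :
    Contains G (SimpleGraph.cycleGraph (2 * k + 1)) := by
  obtain ⟨x, t, -, ht, hadj, hnodup, hchain⟩ :=
    exists_isChain_of_triangle hk hA hB hSA hSB hb hc hab hac hbc (k - 1) (by omega)
  have hlen : t.length + 2 = 2 * k + 1 := by omega
  exact hlen ▸ contains_cycleGraph_of_isChain hnodup hchain hadj

/-- Under the partition assumptions, a `C_{2k+1}`-free graph has no triangle with one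
vertex in `S_i = V_i ∖ L_i`, one vertex in `L_i` and one vertex in `L_{3−i}`. -/
theorem stmt_13 (k : ℕ) (hk : 2 ≤ k) {V : Type*} [Fintype V] (G : SimpleGraph V)
    (hfree : ¬ Contains G (cycleGraph (2 * k + 1)))
    (V₁ V₂ : Set V) (hpart : V₁ ∪ V₂ = Set.univ) (hdisj : Disjoint V₁ V₂)
    (h₁ : 8 * k ≤ V₁.ncard) (h₂ : 8 * k ≤ V₂.ncard)
    (hS₁ : ((V₁ \ heavySet G k V₁ V₂).ncard : ℝ) ≤ (V₁.ncard : ℝ) / (4 * k))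
    (hS₂ : ((V₂ \ heavySet G k V₂ V₁).ncard : ℝ) ≤ (V₂.ncard : ℝ) / (4 * k)) :
    (¬ ∃ a ∈ V₁ \ heavySet G k V₁ V₂, ∃ b ∈ heavySet G k V₁ V₂,
        ∃ c ∈ heavySet G k V₂ V₁, G.Adj a b ∧ G.Adj a c ∧ G.Adj b c) ∧
    (¬ ∃ a ∈ V₂ \ heavySet G k V₂ V₁, ∃ b ∈ heavySet G k V₂ V₁,
        ∃ c ∈ heavySet G k V₁ V₂, G.Adj a b ∧ G.Adj a c ∧ G.Adj b c) := by
  constructor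
  · rintro ⟨a, -, b, hb, c, hc, hab, hac, hbc⟩
    exact hfree (contains_cycleGraph_of_triangle hk h₁ h₂ hS₁ hS₂ hb hc hab hac hbc)
  · rintro ⟨a, -, b, hb, c, hc, hab, hac, hbc⟩
    exact hfree (contains_cycleGraph_of_triangle hk h₂ h₁ hS₂ hS₁ hb hc hab hac hbc)
end
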